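/- arXiv:1508.04387 — 4 statements merged into one kernel-verified Lean document; each statement's English description precedes it below -/
import Mathlib

section
/- There exists a Friedberg numbering of the set of all partial computable functions from ℕ to ℕ; that is, a computable numbering ν : ℕ → 𝒫⁽¹⁾ that is injective and surjective onto 𝒫⁽¹⁾. -/
/-- The set of all partial computable functions ℕ ⇀ ℕ. -/
def PCF : Set (ℕ →. ℕ) := {f | Nat.Partrec f}

/-- ν is a numbering of A: every value lies in A and ν is onto A. -/
def IsNumbering (A : Set (ℕ →. ℕ)) (ν : ℕ → ℕ →. ℕ) : Prop :=
  (∀ i, ν i ∈ A) ∧ ∀ f ∈ A, ∃ i, ν i = f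

/-- A computable numbering: (i,x) ↦ ν i x is partial computable. -/
def IsCompNumbering (A : Set (ℕ →. ℕ)) (ν : ℕ → ℕ →. ℕ) : Prop :=
  IsNumbering A ν ∧ Partrec₂ ν

/-- A Friedberg numbering: computable and injective. -/
def IsFriedberg (A : Set (ℕ →. ℕ)) (ν : ℕ → ℕ →. ℕ) : Prop :=
  IsCompNumbering A ν ∧ Function.Injective ν

/-- ν is reducible to μ via a total computable function. -/
def Reducible (ν μ : ℕ → ℕ →. ℕ) : Prop :=
  ∃ f : ℕ → ℕ, Computable f ∧ ∀ n, ν n = μ (f n)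

/-- g is a subfunction of f (graph inclusion). -/
def Subfn (g f : ℕ →. ℕ) : Prop := ∀ x y, y ∈ g x → y ∈ f x

/-- g is a finite subfunction of f. -/
def FinSubfn (g f : ℕ →. ℕ) : Prop := g.Dom.Finite ∧ Subfn g f

/-- A sequence of numberings is uniformly c.e. -/
def UniformlyCE (ν : ℕ → ℕ → ℕ →. ℕ) : Prop :=
  Partrec₂ (fun p : ℕ × ℕ => ν p.1 p.2)

namespace FriedbergNumbering

/-- The total function extending the finite sequence `L` by zeros. -/
def listFun (L : List ℕ) : ℕ →. ℕ := fun x => Part.some (L.getD x 0)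

section BoundedQuantifiers

variable {α : Type*} [Primcodable α] {f : α → ℕ} {R : ℕ → α → Prop}

theorem primrecPred_forall_lt (hf : Primrec f) (hR : PrimrecRel R) :
    PrimrecPred fun a => ∀ x < f a, R x a :=
  (hR.forall_mem_list.comp (Primrec.list_range.comp hf) Primrec.id).of_eq (by simp)

theorem primrecPred_exists_lt (hf : Primrec f) (hR : PrimrecRel R) :
    PrimrecPred fun a => ∃ x < f a, R x a :=
  (hR.exists_mem_list.comp (Primrec.list_range.comp hf) Primrec.id).of_eq (by simp)

end BoundedQuantifiers

theorem computable_nth {p : ℕ → Prop} (hp : PrimrecPred p) (hinf : {n | p n}.Infinite) :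
    Computable (Nat.nth p) := by
  classical
  have hdec : Primrec fun n => decide (p n) := by
    obtain ⟨_, h⟩ := hp
    exact h.of_eq fun n => by congr
  have hcount : Primrec (Nat.count p) := by
    have : Primrec (fun n : ℕ => Nat.rec (motive := fun _ => ℕ) 0
        (fun k c => c + (if p k then 1 else 0)) n) :=
      Primrec.nat_rec₁ 0 (Primrec.nat_add.comp Primrec.snd
        (Primrec.ite (hp.comp Primrec.fst) (Primrec.const 1) (Primrec.const 0)))
    refine this.of_eq fun n => ?_
    induction n with
    | zero => simp
    | succ n ih => simp only [Nat.count_succ, ← ih]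
  have hspec : Primrec₂ fun n m => decide (p m) && decide (Nat.count p m = n) :=
    Primrec.and.comp (hdec.comp Primrec.snd)
      (Primrec.eq.decide.comp (hcount.comp Primrec.snd) Primrec.fst)
  have hfind : Partrec fun n => Nat.rfind fun m =>
      Part.some (decide (p m) && decide (Nat.count p m = n)) :=
    Partrec.rfind hspec.to_comp.partrec₂
  refine hfind.of_eq_tot fun n => ?_
  refine Nat.mem_rfind.2 ⟨?_, fun {m} hm => ?_⟩
  · have h1 := Nat.nth_mem_of_infinite hinf n
    have h2 := Nat.count_nth_of_infinite hinf n
    simp [h1, h2]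
  · suffices ¬ (p m ∧ Nat.count p m = n) by
      simp only [Part.mem_some_iff]
      simpa [Bool.eq_false_iff] using this
    rintro ⟨h1, rfl⟩
    rw [Nat.nth_count h1] at hm
    exact lt_irrefl _ hm

section Construction

variable (A : ℕ → ℕ → ℕ → Option ℕ)

/-- At stage `s`, function `e` agrees below `n` with some function of smaller index. -/
def Agree (e s n : ℕ) : Prop := ∃ i < e, ∀ x < n, A i s x = A e s x

instance (e s n : ℕ) : Decidable (Agree A e s n) :=
  inferInstanceAs (Decidable (∃ i < e, ∀ x < n, A i s x = A e s x))

/-- The stage `s` length of agreement of function `e` with functions of smaller index. -/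
def agreement (e s : ℕ) : ℕ := Nat.findGreatest (Agree A e s) s

/-- The length of agreement of `e` changes at stage `t`, or `t` is the initial stage. -/
def Changes (e t : ℕ) : Prop := t = 0 ∨ agreement A e t ≠ agreement A e (t - 1)

instance (e t : ℕ) : Decidable (Changes A e t) :=
  inferInstanceAs (Decidable (_ ∨ _))

/-- `d` is the first change stage of `e` after `t`. -/
def Dies (e t d : ℕ) : Prop := t < d ∧ Changes A e d ∧ ∀ s < d, t < s → ¬ Changes A e s

instance (e t d : ℕ) : Decidable (Dies A e t d) :=
  inferInstanceAs (Decidable (_ ∧ _ ∧ _))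

/-- The finite sequence extending the stage `d` approximation of function `e`,
whose last entry codes `(e, t, d)`. -/
def dump (e t d : ℕ) : List ℕ :=
  (List.range d).map (fun x => (A e d x).getD 0) ++ [Nat.pair (Nat.pair e t) d + 1]

/-- `L` is the sequence left behind by some request that dies. -/
def IsDump (L : List ℕ) : Prop := ∃ e t d, Changes A e t ∧ Dies A e t d ∧ L = dump A e t d

/-- The index `inl (e, t)` requests to follow function `e` from its change stage `t` on until the
next change stage; the index `inr L` lists the total function given by `L`. -/
def Valid : (ℕ × ℕ) ⊕ List ℕ → Prop
  | .inl p => Changes A p.1 p.2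
  | .inr L => L.reverse.head? ≠ some 0 ∧ ¬ IsDump A L

/-- Stage `s` approximation of the function with a given index. -/
def approx : (ℕ × ℕ) ⊕ List ℕ → ℕ → ℕ → Option ℕ
  | .inl p, s, x =>
    if Nat.findGreatest (Dies A p.1 p.2) s = 0 then A p.1 s x
    else some ((dump A p.1 p.2 (Nat.findGreatest (Dies A p.1 p.2) s)).getD x 0)
  | .inr L, _, x => some (L.getD x 0)

/-- The function with a given index. -/
def limitFun (a : (ℕ × ℕ) ⊕ List ℕ) : ℕ →. ℕ := fun x => Nat.rfindOpt fun s => approx A a s x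

variable {A}

section Computability

theorem primrec_approximation
    (hA : Primrec fun p : (ℕ × ℕ) × ℕ => A p.1.1 p.1.2 p.2)
    {α : Type*} [Primcodable α] {e s x : α → ℕ} (he : Primrec e)
    (hs : Primrec s) (hx : Primrec x) : Primrec fun a => A (e a) (s a) (x a) :=
  hA.comp ((he.pair hs).pair hx)

theorem primrec_agreement
    (hA : Primrec fun p : (ℕ × ℕ) × ℕ => A p.1.1 p.1.2 p.2) :
    Primrec₂ (agreement A) := by
  refine Primrec.nat_findGreatest (p := fun q : ℕ × ℕ => Agree A q.1 q.2) Primrec.snd ?_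
  refine primrecPred_exists_lt (f := fun q : (ℕ × ℕ) × ℕ => q.1.1)
    (R := fun i q => ∀ x < q.2, A i q.1.2 x = A q.1.1 q.1.2 x) (Primrec.fst.comp Primrec.fst) ?_
  refine primrecPred_forall_lt (f := fun q : ℕ × ((ℕ × ℕ) × ℕ) => q.2.2)
    (R := fun x q => A q.1 q.2.1.2 x = A q.2.1.1 q.2.1.2 x) (Primrec.snd.comp Primrec.snd) ?_
  have hpair : Primrec fun q : ℕ × (ℕ × ((ℕ × ℕ) × ℕ)) => q.2.2.1 :=
    Primrec.fst.comp (Primrec.snd.comp Primrec.snd)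
  exact Primrec.eq.comp
    (primrec_approximation hA (Primrec.fst.comp Primrec.snd) (Primrec.snd.comp hpair) Primrec.fst)
    (primrec_approximation hA (Primrec.fst.comp hpair) (Primrec.snd.comp hpair) Primrec.fst)

theorem primrecRel_changes
    (hA : Primrec fun p : (ℕ × ℕ) × ℕ => A p.1.1 p.1.2 p.2) :
    PrimrecRel (Changes A) := by
  have h := primrec_agreement hA
  refine (Primrec.eq.comp Primrec.snd (Primrec.const 0)).or
    (PrimrecPred.not (Primrec.eq.comp (h.comp Primrec.fst Primrec.snd) (h.comp Primrec.fst ?_)))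
  exact Primrec.nat_sub.comp Primrec.snd (Primrec.const 1)

theorem primrecPred_dies
    (hA : Primrec fun p : (ℕ × ℕ) × ℕ => A p.1.1 p.1.2 p.2) :
    PrimrecPred fun q : (ℕ × ℕ) × ℕ => Dies A q.1.1 q.1.2 q.2 := by
  have he : Primrec fun q : (ℕ × ℕ) × ℕ => q.1.1 := Primrec.fst.comp Primrec.fst
  have ht : Primrec fun q : (ℕ × ℕ) × ℕ => q.1.2 := Primrec.snd.comp Primrec.fst
  have h := primrecRel_changes hA
  refine (Primrec.nat_lt.comp ht Primrec.snd).and ((h.comp he Primrec.snd).and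
    (primrecPred_forall_lt (f := fun q : (ℕ × ℕ) × ℕ => q.2)
      (R := fun s q => q.1.2 < s → ¬ Changes A q.1.1 s) Primrec.snd ?_))
  refine PrimrecPred.of_eq (PrimrecPred.or
    (PrimrecPred.not (Primrec.nat_lt.comp (ht.comp Primrec.snd) Primrec.fst))
    (PrimrecPred.not (h.comp (he.comp Primrec.snd) Primrec.fst))) fun q => ?_
  tauto

theorem primrec_dump
    (hA : Primrec fun p : (ℕ × ℕ) × ℕ => A p.1.1 p.1.2 p.2) :
    Primrec fun q : (ℕ × ℕ) × ℕ => dump A q.1.1 q.1.2 q.2 := by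
  have he : Primrec fun q : (ℕ × ℕ) × ℕ => q.1.1 := Primrec.fst.comp Primrec.fst
  have hpair : Primrec₂ Nat.pair := Primrec₂.natPair
  refine Primrec.list_append.comp
    (Primrec.list_map (g := fun (q : (ℕ × ℕ) × ℕ) x => (A q.1.1 q.2 x).getD 0)
      (Primrec.list_range.comp Primrec.snd) ?_)
    (Primrec.list_cons.comp (Primrec.succ.comp (hpair.comp
      (hpair.comp he (Primrec.snd.comp Primrec.fst)) Primrec.snd)) (Primrec.const []))
  exact Primrec.option_getD.comp (primrec_approximation hA (he.comp Primrec.fst)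
    (Primrec.snd.comp Primrec.fst) Primrec.snd) (Primrec.const 0)

theorem reverse_dump_head? (e t d : ℕ) :
    (dump A e t d).reverse.head? = some (Nat.pair (Nat.pair e t) d + 1) := by
  simp [dump]

theorem primrecPred_isDump
    (hA : Primrec fun p : (ℕ × ℕ) × ℕ => A p.1.1 p.1.2 p.2) :
    PrimrecPred (IsDump A) := by
  let m : List ℕ → ℕ := fun L => (L.reverse.head?.getD 0).pred
  let dec : List ℕ → (ℕ × ℕ) × ℕ := fun L => ((m L).unpair.1.unpair, (m L).unpair.2)
  have hm : Primrec m := Primrec.pred.comp (Primrec.option_getD.comp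
    (Primrec.list_head?.comp Primrec.list_reverse) (Primrec.const 0))
  have hu : Primrec fun L => (m L).unpair := Primrec.unpair.comp hm
  have hdec : Primrec dec :=
    (Primrec.unpair.comp (Primrec.fst.comp hu)).pair (Primrec.snd.comp hu)
  have hp : Primrec fun L => (dec L).1 := Primrec.fst.comp hdec
  refine PrimrecPred.of_eq (PrimrecPred.and
    ((primrecRel_changes hA).comp (Primrec.fst.comp hp) (Primrec.snd.comp hp))
    (PrimrecPred.and ((primrecPred_dies hA).comp hdec)
      (Primrec.eq.comp Primrec.id ((primrec_dump hA).comp hdec)))) fun L => ?_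
  constructor
  · rintro ⟨h1, h2, h3⟩
    exact ⟨_, _, _, h1, h2, h3⟩
  · rintro ⟨e, t, d, h1, h2, rfl⟩
    have : dec (dump A e t d) = ((e, t), d) := by simp only [dec, m, reverse_dump_head?]; simp
    simp only [this]
    exact ⟨h1, h2, rfl⟩

theorem primrecPred_valid
    (hA : Primrec fun p : (ℕ × ℕ) × ℕ => A p.1.1 p.1.2 p.2) :
    PrimrecPred (Valid A) := by
  classical
  have h2 : PrimrecPred fun L : List ℕ => L.reverse.head? ≠ some 0 ∧ ¬ IsDump A L :=
    (PrimrecPred.not (Primrec.eq.comp (Primrec.list_head?.comp Primrec.list_reverse)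
      (Primrec.const (some 0)))).and (primrecPred_isDump hA).not
  have h : Primrec fun a : (ℕ × ℕ) ⊕ List ℕ => (Sum.casesOn a
      (fun p => decide (Changes A p.1 p.2))
      (fun L => decide (L.reverse.head? ≠ some 0 ∧ ¬ IsDump A L)) : Bool) :=
    Primrec.sumCasesOn Primrec.id ((PrimrecPred.comp (primrecRel_changes hA) Primrec.snd).decide)
      (h2.decide.comp Primrec.snd)
  refine Primrec.primrecPred (h.of_eq fun a => ?_)
  rcases a with p | L <;> exact decide_eq_decide.2 Iff.rfl

theorem primrec_approx
    (hA : Primrec fun p : (ℕ × ℕ) × ℕ => A p.1.1 p.1.2 p.2) :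
    Primrec fun q : (((ℕ × ℕ) ⊕ List ℕ) × ℕ) × ℕ => approx A q.1.1 q.2 q.1.2 := by
  let β := ((((ℕ × ℕ) ⊕ List ℕ) × ℕ) × ℕ) × (ℕ × ℕ)
  have hp : Primrec fun b : β => b.2 := Primrec.snd
  have hs : Primrec fun b : β => b.1.2 := Primrec.snd.comp Primrec.fst
  have hx : Primrec fun b : β => b.1.1.2 :=
    Primrec.snd.comp (Primrec.fst.comp Primrec.fst)
  have hD : Primrec fun b : β => Nat.findGreatest (Dies A b.2.1 b.2.2) b.1.2 :=
    Primrec.nat_findGreatest (p := fun b : β => Dies A b.2.1 b.2.2) hs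
      ((primrecPred_dies hA).comp ((hp.comp Primrec.fst).pair Primrec.snd))
  have h1 : Primrec fun b : β => approx A (.inl b.2) b.1.2 b.1.1.2 :=
    Primrec.ite (Primrec.eq.comp hD (Primrec.const 0))
      (primrec_approximation hA (Primrec.fst.comp hp) hs hx)
      (Primrec.option_some.comp ((Primrec.list_getD 0).comp
        ((primrec_dump hA).comp (hp.pair hD)) hx))
  have h2 : Primrec₂ fun (q : (((ℕ × ℕ) ⊕ List ℕ) × ℕ) × ℕ) (L : List ℕ) =>
      some (L.getD q.1.2 0) :=
    Primrec.option_some.comp ((Primrec.list_getD 0).comp Primrec.snd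
      (Primrec.snd.comp (Primrec.fst.comp Primrec.fst)))
  refine (Primrec.sumCasesOn (f := fun q : (((ℕ × ℕ) ⊕ List ℕ) × ℕ) × ℕ => q.1.1)
    (Primrec.fst.comp Primrec.fst) h1.to₂ h2).of_eq fun q => ?_
  obtain ⟨⟨a | L, x⟩, s⟩ := q <;> rfl

theorem partrec_limitFun
    (hA : Primrec fun p : (ℕ × ℕ) × ℕ => A p.1.1 p.1.2 p.2) :
    Partrec₂ (limitFun A) :=
  Partrec.rfindOpt (primrec_approx hA).to_comp.to₂

end Computability

section Correctness

variable {U : ℕ → ℕ →. ℕ}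

theorem Dies.unique {e t d d' : ℕ} (h : Dies A e t d) (h' : Dies A e t d') : d = d' := by
  rcases lt_trichotomy d d' with hlt | heq | hlt
  · exact absurd h.2.1 (h'.2.2 _ hlt h.1)
  · exact heq
  · exact absurd h'.2.1 (h.2.2 _ hlt h'.1)

theorem exists_dies {e t s : ℕ} (hts : t < s) (hs : Changes A e s) : ∃ d, Dies A e t d := by
  have hex : ∃ d, t < d ∧ Changes A e d := ⟨s, hts, hs⟩
  classical
  exact ⟨Nat.find hex, (Nat.find_spec hex).1, (Nat.find_spec hex).2,
    fun k hk htk hc => Nat.find_min hex hk ⟨htk, hc⟩⟩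

theorem findGreatest_dies_of_dies {e t d s : ℕ} (h : Dies A e t d) (hs : d ≤ s) :
    Nat.findGreatest (Dies A e t) s = d :=
  (Nat.findGreatest_spec hs h).unique h

theorem findGreatest_dies_eq_zero {e t s : ℕ} (h : ∀ d ≤ s, ¬ Dies A e t d) :
    Nat.findGreatest (Dies A e t) s = 0 :=
  Nat.findGreatest_eq_zero_iff.2 fun d _ hd => h d hd

/-- Monotonicity, boundedness and convergence to `U` of the approximation `A`. -/
structure Approximates (A : ℕ → ℕ → ℕ → Option ℕ) (U : ℕ → ℕ →. ℕ) : Prop where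
  mono : ∀ {e s s' x y}, s ≤ s' → y ∈ A e s x → y ∈ A e s' x
  lt : ∀ {e s x y}, y ∈ A e s x → x < s
  mem_iff : ∀ {e x y}, y ∈ U e x ↔ ∃ s, y ∈ A e s x

theorem listFun_injective_of_last {L L' : List ℕ} (hL : L.reverse.head? ≠ some 0)
    (hL' : L'.reverse.head? ≠ some 0) (h : listFun L = listFun L') : L = L' := by
  have hget : ∀ x, L.getD x 0 = L'.getD x 0 := fun x => Part.some_injective (congrFun h x)
  have key : ∀ {K K' : List ℕ}, K.reverse.head? ≠ some 0 → (∀ x, K.getD x 0 = K'.getD x 0) →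
      K.length ≤ K'.length := by
    intro K K' hK hKK'
    by_contra! hlt
    apply hK
    have := hKK' (K.length - 1)
    rw [List.getD_eq_default K' 0 (by omega), List.getD_eq_getElem K 0 (by omega)] at this
    rw [List.head?_reverse, List.getLast?_eq_getElem?, List.getElem?_eq_getElem (by omega), this]
  have hlen := le_antisymm (key hL hget) (key hL' fun x => (hget x).symm)
  refine List.ext_getElem hlen fun i h1 h2 => ?_
  simpa [List.getD_eq_getElem, h1, h2] using hget i

theorem exists_last_ne_zero (L : List ℕ) :
    ∃ L', L'.reverse.head? ≠ some 0 ∧ listFun L' = listFun L := by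
  induction L using List.reverseRecOn with
  | nil => exact ⟨[], by simp, rfl⟩
  | append_singleton L a ih =>
    rcases Nat.eq_zero_or_pos a with rfl | ha
    · obtain ⟨L', h1, h2⟩ := ih
      refine ⟨L', h1, h2.trans ?_⟩
      funext x
      simp only [listFun]
      congr 1
      rcases lt_or_ge x L.length with hx | hx
      · rw [List.getD_append _ _ _ _ hx]
      · rw [List.getD_append_right _ _ _ _ hx, List.getD_eq_default _ _ hx]
        rcases x - L.length with _ | k <;> simp
    · exact ⟨L ++ [a], by simp [ha.ne'], rfl⟩

theorem limitFun_inr (L : List ℕ) : limitFun A (.inr L) = listFun L := by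
  funext x
  refine Part.eq_some_iff.2 ((Nat.rfindOpt_mono ?_).2 ⟨0, rfl⟩)
  exact fun _ h => h

theorem Approximates.dump_getD (hAU : Approximates A U)
    {e t d s x y : ℕ} (hs : s ≤ d) (h : y ∈ A e s x) :
    (dump A e t d).getD x 0 = y := by
  have hx : x < d := (hAU.lt h).trans_le hs
  have hd : A e d x = some y := hAU.mono hs h
  rw [dump, List.getD_append _ _ _ _ (by simpa using hx)]
  simp [hx, hd]

theorem Approximates.limitFun_of_dies (hAU : Approximates A U) {e t d : ℕ} (h : Dies A e t d) :
    limitFun A (.inl (e, t)) = listFun (dump A e t d) := by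
  funext x
  have hd0 : d ≠ 0 := (Nat.zero_le t).trans_lt h.1 |>.ne'
  have hdom : (limitFun A (.inl (e, t)) x).Dom :=
    Nat.rfindOpt_dom.2 ⟨d, _, by
      simp only [approx, findGreatest_dies_of_dies h le_rfl, if_neg hd0]; rfl⟩
  refine Part.eq_some_iff.2 ?_
  obtain ⟨y, hy⟩ := Part.dom_iff_mem.1 hdom
  suffices y = (dump A e t d).getD x 0 from this ▸ hy
  obtain ⟨s, hs⟩ := Nat.rfindOpt_spec hy
  rcases le_or_gt d s with hds | hds
  · simp only [approx, findGreatest_dies_of_dies h hds, if_neg hd0] at hs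
    exact (Option.some.inj hs).symm
  · have hz : Nat.findGreatest (Dies A e t) s = 0 :=
      findGreatest_dies_eq_zero fun d' hd' hdies => by
        have := h.unique hdies
        omega
    simp only [approx, hz, if_true] at hs
    exact (hAU.dump_getD hds.le hs).symm

theorem Approximates.limitFun_of_not_dies (hAU : Approximates A U)
    {e t : ℕ} (h : ∀ d, ¬ Dies A e t d) :
    limitFun A (.inl (e, t)) = U e := by
  have happ : ∀ s x, approx A (.inl (e, t)) s x = A e s x := fun s x => by
    simp only [approx, findGreatest_dies_eq_zero fun d _ => h d, if_true]
  funext x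
  refine Part.ext fun y => ?_
  simp only [limitFun, happ]
  exact (Nat.rfindOpt_mono hAU.mono).trans hAU.mem_iff.symm

theorem Approximates.eventually_const (hAU : Approximates A U) (e x : ℕ) :
    ∃ o : Option ℕ, (∀ y, y ∈ U e x ↔ y ∈ o) ∧ ∀ᶠ s in Filter.atTop, A e s x = o := by
  by_cases h : ∃ s y, y ∈ A e s x
  · obtain ⟨s, y, hy⟩ := h
    have hev : ∀ s' ≥ s, A e s' x = some y := fun s' hs' => hAU.mono hs' hy
    refine ⟨some y, fun z => ⟨fun hz => ?_, fun hz => ?_⟩, Filter.eventually_atTop.2 ⟨s, hev⟩⟩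
    · exact Option.mem_some_iff.2 (Part.mem_unique (hAU.mem_iff.2 ⟨s, hy⟩) hz)
    · cases Option.mem_some_iff.1 hz
      exact hAU.mem_iff.2 ⟨s, hy⟩
  · push Not at h
    refine ⟨none, fun z => ⟨fun hz => ?_, fun hz => by simp at hz⟩,
      Filter.Eventually.of_forall fun s => Option.eq_none_iff_forall_not_mem.2 (h s)⟩
    obtain ⟨s, hs⟩ := hAU.mem_iff.1 hz
    exact absurd hs (h s z)

theorem Approximates.eventually_eq_iff (hAU : Approximates A U) (i e x : ℕ) :
    ∀ᶠ s in Filter.atTop, (A i s x = A e s x ↔ U i x = U e x) := by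
  obtain ⟨o, ho, hi⟩ := hAU.eventually_const i x
  obtain ⟨o', ho', he⟩ := hAU.eventually_const e x
  filter_upwards [hi, he] with s h1 h2
  rw [h1, h2]
  constructor
  · rintro rfl
    exact Part.ext fun y => (ho y).trans (ho' y).symm
  · intro h
    exact Option.ext fun y => by
      have := ho y
      rw [h] at this
      exact this.symm.trans (ho' y)

theorem Approximates.eventually_agree_iff (hAU : Approximates A U) (e n : ℕ) :
    ∀ᶠ s in Filter.atTop, (Agree A e s n ↔ ∃ i < e, ∀ x < n, U i x = U e x) := by
  have : ∀ᶠ s in Filter.atTop, ∀ i < e, ∀ x < n, (A i s x = A e s x ↔ U i x = U e x) := by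
    have h1 : ∀ i ∈ Finset.range e, ∀ᶠ s in Filter.atTop,
        ∀ x ∈ Finset.range n, (A i s x = A e s x ↔ U i x = U e x) := fun i _ =>
      (Filter.eventually_all_finset _).2 fun x _ => hAU.eventually_eq_iff i e x
    simpa using (Filter.eventually_all_finset _).2 h1
  filter_upwards [this] with s hs
  refine exists_congr fun i => and_congr_right fun hi => forall₂_congr fun x hx => hs i hi x hx

theorem Approximates.exists_changes_gt (hAU : Approximates A U)
    {i e : ℕ} (hi : i < e) (h : U i = U e) (t : ℕ) :
    ∃ s > t, Changes A e s := by
  by_contra! hno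
  have hconst : ∀ s ≥ t, agreement A e s = agreement A e t := by
    intro s hs
    induction s, hs using Nat.le_induction with
    | base => rfl
    | succ s hs ih =>
      have := hno (s + 1) (by omega)
      simp only [Changes, not_or, not_not] at this
      simpa [ih] using this.2
  obtain ⟨s, hs, hst, hsn⟩ := ((hAU.eventually_agree_iff e (agreement A e t + 1)).and
    ((Filter.eventually_ge_atTop t).and
      (Filter.eventually_ge_atTop (agreement A e t + 1)))).exists
  have := Nat.le_findGreatest hsn (hs.2 ⟨i, hi, fun x _ => by rw [h]⟩)
  change _ ≤ agreement A e s at this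
  rw [hconst s hst] at this
  omega

theorem Approximates.exists_last_changes (hAU : Approximates A U)
    {e : ℕ} (h : ∀ i < e, U i ≠ U e) :
    ∃ t, Changes A e t ∧ ∀ s > t, ¬ Changes A e s := by
  have hdiff : ∃ n, ¬ ∃ i < e, ∀ x < n, U i x = U e x := by
    have : ∀ i : ℕ, ∃ x, i < e → U i x ≠ U e x := fun i => by
      by_cases hi : i < e
      · obtain ⟨x, hx⟩ := Function.ne_iff.1 (h i hi)
        exact ⟨x, fun _ => hx⟩
      · exact ⟨0, fun h => absurd h hi⟩
    choose w hw using this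
    refine ⟨(Finset.range e).sup w + 1, fun ⟨i, hi, hx⟩ => hw i hi (hx _ ?_)⟩
    exact Nat.lt_succ_of_le (Finset.le_sup (f := w) (Finset.mem_range.2 hi))
  obtain ⟨n, hn⟩ := hdiff
  have hev : ∀ᶠ s in Filter.atTop, ∀ k ∈ Finset.range (n + 1),
      (Agree A e s k ↔ ∃ i < e, ∀ x < k, U i x = U e x) :=
    (Filter.eventually_all_finset _).2 fun k _ => hAU.eventually_agree_iff e k
  obtain ⟨S, hS⟩ := Filter.eventually_atTop.1 (hev.and (Filter.eventually_ge_atTop n))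
  have hlim : ∀ s ≥ S, ∀ k, Agree A e s k ↔ Agree A e S k := by
    intro s hs k
    rcases le_or_gt k n with hk | hk
    · rw [(hS s hs).1 k (by simp; omega), (hS S le_rfl).1 k (by simp; omega)]
    · have hno : ∀ s ≥ S, ¬ Agree A e s k := fun s hs ⟨i, hi, hx⟩ =>
        hn (((hS s hs).1 n (by simp)).1 ⟨i, hi, fun x hxn => hx x (hxn.trans hk)⟩)
      exact iff_of_false (hno s hs) (hno S le_rfl)
  have hbound : ∀ s ≥ S, ∀ k, Agree A e s k → k ≤ n := fun s hs k ⟨i, hi, hx⟩ => by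
    by_contra! hk
    exact hn (((hS s hs).1 n (by simp)).1 ⟨i, hi, fun x hxn => hx x (hxn.trans hk)⟩)
  have hconst : ∀ s ≥ S, agreement A e s = agreement A e S := by
    have hle : ∀ s ≥ S, ∀ s' ≥ S, agreement A e s ≤ agreement A e s' := by
      intro s hs s' hs'
      rcases Nat.eq_zero_or_pos (agreement A e s) with h0 | h0
      · omega
      · have hag : Agree A e s (agreement A e s) := Nat.findGreatest_of_ne_zero rfl h0.ne'
        exact Nat.le_findGreatest ((hbound s hs _ hag).trans (hS s' hs').2)
          ((hlim s' hs' _).2 ((hlim s hs _).1 hag))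
    exact fun s hs => le_antisymm (hle s hs S le_rfl) (hle S le_rfl s hs)
  have hquiet : ∀ s > S, ¬ Changes A e s := by
    rintro s hs (rfl | hne)
    · omega
    · exact hne ((hconst s (by omega)).trans (hconst (s - 1) (by omega)).symm)
  refine ⟨Nat.findGreatest (Changes A e) S, ?_, fun s hs hc => ?_⟩
  · exact Nat.findGreatest_spec (Nat.zero_le S) (Or.inl rfl)
  · rcases le_or_gt s S with hsS | hsS
    · exact absurd (Nat.le_findGreatest hsS hc) (by omega)
    · exact hquiet s hsS hc

theorem Approximates.limitFun_inl_cases (hAU : Approximates A U) (e t : ℕ) :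
    (∃ d, Dies A e t d ∧ limitFun A (.inl (e, t)) = listFun (dump A e t d)) ∨
      (limitFun A (.inl (e, t)) = U e ∧ (∀ i < e, U i ≠ U e) ∧ ∀ s > t, ¬ Changes A e s) := by
  by_cases h : ∃ d, Dies A e t d
  · obtain ⟨d, hd⟩ := h
    exact Or.inl ⟨d, hd, hAU.limitFun_of_dies hd⟩
  · have hs : ∀ s > t, ¬ Changes A e s := fun s hs hc => h (exists_dies hs hc)
    push Not at h
    refine Or.inr ⟨hAU.limitFun_of_not_dies h, fun i hi hie => ?_, hs⟩
    obtain ⟨s, hst, hc⟩ := hAU.exists_changes_gt hi hie t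
    exact hs s hst hc

theorem dump_injective {e t d e' t' d' : ℕ} (h : dump A e t d = dump A e' t' d') :
    (e, t) = (e', t') := by
  have := congrArg (fun L : List ℕ => L.reverse.head?) h
  simp only [reverse_dump_head?, Option.some.injEq, Nat.add_right_cancel_iff, Nat.pair_eq_pair]
    at this
  simp [this.1]

theorem reverse_dump_head?_ne_zero (e t d : ℕ) : (dump A e t d).reverse.head? ≠ some 0 := by
  rw [reverse_dump_head?]
  simp

theorem Approximates.limitFun_injOn (hAU : Approximates A U) (hU : ∀ e L, U e ≠ listFun L) :
    Set.InjOn (limitFun A) {a | Valid A a} := by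
  have hmixed : ∀ {p : ℕ × ℕ} {L : List ℕ}, Valid A (.inl p) → Valid A (.inr L) →
      limitFun A (.inl p) ≠ limitFun A (.inr L) := by
    rintro ⟨e, t⟩ L hp hL heq
    rw [limitFun_inr] at heq
    rcases hAU.limitFun_inl_cases e t with ⟨d, hd, h⟩ | ⟨h, -⟩
    · have := listFun_injective_of_last (reverse_dump_head?_ne_zero e t d) hL.1 (h.symm.trans heq)
      exact hL.2 ⟨e, t, d, hp, hd, this.symm⟩
    · exact hU _ _ (h.symm.trans heq)
  rintro (⟨e, t⟩ | L) ha (⟨e', t'⟩ | L') hb heq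
  · congr 1
    rcases hAU.limitFun_inl_cases e t with ⟨d, hd, h⟩ | ⟨h, hmin, hlast⟩ <;>
      rcases hAU.limitFun_inl_cases e' t' with ⟨d', hd', h'⟩ | ⟨h', hmin', hlast'⟩
    · exact dump_injective (listFun_injective_of_last (reverse_dump_head?_ne_zero e t d)
        (reverse_dump_head?_ne_zero e' t' d') (h.symm.trans (heq.trans h')))
    · exact absurd (h'.symm.trans (heq.symm.trans h)) (hU _ _)
    · exact absurd (h.symm.trans (heq.trans h')) (hU _ _)
    · have hee : U e = U e' := h.symm.trans (heq.trans h')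
      obtain rfl : e = e' := by
        rcases lt_trichotomy e e' with hlt | he | hlt
        · exact absurd hee (hmin' _ hlt)
        · exact he
        · exact absurd hee.symm (hmin _ hlt)
      congr 1
      rcases lt_trichotomy t t' with hlt | ht | hlt
      · exact absurd hb (hlast _ hlt)
      · exact ht
      · exact absurd ha (hlast' _ hlt)
  · exact absurd heq (hmixed ha hb)
  · exact absurd heq.symm (hmixed hb ha)
  · rw [limitFun_inr, limitFun_inr] at heq
    rw [listFun_injective_of_last ha.1 hb.1 heq]

theorem Approximates.exists_valid_limitFun_eq (hAU : Approximates A U) {f : ℕ →. ℕ}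
    (hf : (∃ L, f = listFun L) ∨ ∃ e, U e = f) : ∃ a, Valid A a ∧ limitFun A a = f := by
  rcases hf with ⟨L₀, rfl⟩ | hf
  · obtain ⟨L, hL, hLL⟩ := exists_last_ne_zero L₀
    rw [← hLL]
    by_cases hd : IsDump A L
    · obtain ⟨e, t, d, h1, h2, rfl⟩ := hd
      exact ⟨.inl (e, t), h1, hAU.limitFun_of_dies h2⟩
    · exact ⟨.inr L, ⟨hL, hd⟩, limitFun_inr L⟩
  · classical
    have hmin : ∀ i < Nat.find hf, U i ≠ U (Nat.find hf) := fun i hi h =>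
      Nat.find_min hf hi (h.trans (Nat.find_spec hf))
    obtain ⟨t, ht, hlast⟩ := hAU.exists_last_changes hmin
    exact ⟨.inl (Nat.find hf, t), ht,
      (hAU.limitFun_of_not_dies fun d hd => hlast d hd.1 hd.2.1).trans (Nat.find_spec hf)⟩

end Correctness

end Construction

/-- Any partial computable family omitting the eventually zero total functions but exhausting the
other partial computable functions gives rise to a Friedberg numbering. -/
theorem exists_isFriedberg_of_family {U : ℕ → ℕ →. ℕ} (hU : Partrec₂ U)
    (hne : ∀ e L, U e ≠ listFun L)
    (hsurj : ∀ f : ℕ →. ℕ, Nat.Partrec f → (∃ L, f = listFun L) ∨ ∃ e, U e = f) :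
    ∃ ν : ℕ → ℕ →. ℕ, IsFriedberg PCF ν := by
  obtain ⟨c, hc⟩ := Nat.Partrec.Code.exists_code.1 (Partrec.nat_iff.1
    (hU.comp (Computable.fst.comp Computable.unpair) (Computable.snd.comp Computable.unpair)))
  let A : ℕ → ℕ → ℕ → Option ℕ := fun e s x => c.evaln s (Nat.pair e x)
  have hA : Primrec fun p : (ℕ × ℕ) × ℕ => A p.1.1 p.1.2 p.2 :=
    Nat.Partrec.Code.primrec_evaln.comp
      (((Primrec.snd.comp Primrec.fst).pair (Primrec.const c)).pair
        (Primrec₂.natPair.comp (Primrec.fst.comp Primrec.fst) Primrec.snd))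
  have hAU : Approximates A U :=
    { mono := Nat.Partrec.Code.evaln_mono
      lt := fun h => (Nat.right_le_pair _ _).trans_lt (Nat.Partrec.Code.evaln_bound h)
      mem_iff := fun {e x y} => by
        rw [← Nat.Partrec.Code.evaln_complete, hc]
        simp }
  let index : ℕ → (ℕ × ℕ) ⊕ List ℕ := Denumerable.ofNat _
  have hindex : Primrec index :=
    (Primrec.option_getD.comp Primrec.decode (Primrec.const (.inr []))).of_eq fun n => by
      rw [Denumerable.decode_eq_ofNat]; rfl
  have hinj : Function.Injective index := (Denumerable.eqv _).symm.injective
  have hsur : Function.Surjective index := (Denumerable.eqv _).symm.surjective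
  let p : ℕ → Prop := fun n => Valid A (index n)
  have hp : PrimrecPred p := (primrecPred_valid hA).comp hindex
  have hinf : {n | p n}.Infinite := by
    choose k hk using hsur
    refine Set.infinite_of_injective_forall_mem (f := fun e : ℕ => k (.inl (e, 0)))
      (fun e e' h => ?_) fun e => ?_
    · have := congrArg index h
      simpa [hk] using this
    · simp only [Set.mem_ofPred_eq, p, hk]
      exact Or.inl rfl
  have hnu : Partrec₂ fun n => limitFun A (index (Nat.nth p n)) :=
    (partrec_limitFun hA).comp
      ((hindex.to_comp.comp (computable_nth hp hinf)).comp Computable.fst) Computable.snd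
  refine ⟨fun n => limitFun A (index (Nat.nth p n)), ⟨⟨fun n => ?_, fun f hf => ?_⟩, hnu⟩,
    fun m n h => ?_⟩
  · exact Partrec.nat_iff.1 (hnu.comp (Computable.const n) Computable.id)
  · obtain ⟨a, ha, haf⟩ := hAU.exists_valid_limitFun_eq (hsurj f hf)
    obtain ⟨k, rfl⟩ := hsur a
    obtain ⟨n, rfl⟩ : k ∈ Set.range (Nat.nth p) := by
      rw [Nat.range_nth_of_infinite hinf]
      exact ha
    exact ⟨n, haf⟩
  · exact Nat.nth_injective hinf (hinj (hAU.limitFun_injOn hne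
      (Nat.nth_mem_of_infinite hinf m) (Nat.nth_mem_of_infinite hinf n) h))

/-- The restriction of `φ` to arguments with a later argument where `φ` is nonzero and up to which
`φ` is defined. -/
def untilNonzero (φ : ℕ →. ℕ) : ℕ →. ℕ := fun x =>
  (Nat.rfind fun m => (φ (x + m)).map fun y => decide (y ≠ 0)).bind fun _ => φ x

/-- A family of the partial computable functions that are not total and eventually zero. -/
def family (e : ℕ) : ℕ →. ℕ := fun x =>
  let φ := (Denumerable.ofNat Nat.Partrec.Code e.unpair.2).eval
  bif decide (e.unpair.1 = 0) then untilNonzero φ x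
  else bif decide (x = e.unpair.1 - 1) then Part.none else φ x

theorem partrec_family : Partrec₂ family := by
  have hcode : Computable fun e : ℕ => Denumerable.ofNat Nat.Partrec.Code e.unpair.2 :=
    (Computable.ofNat _).comp (Computable.snd.comp Computable.unpair)
  have hφ : Partrec fun q : ℕ × ℕ =>
      (Denumerable.ofNat Nat.Partrec.Code q.1.unpair.2).eval q.2 :=
    Nat.Partrec.Code.eval_part.comp (hcode.comp Computable.fst) Computable.snd
  have hindex : Computable fun q : ℕ × ℕ => q.1.unpair.1 :=
    Computable.fst.comp (Computable.unpair.comp Computable.fst)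
  refine Partrec.cond (Primrec.eq.decide.to_comp.comp hindex (Computable.const 0)) ?_
    (Partrec.cond (Primrec.eq.decide.to_comp.comp Computable.snd
      (Primrec.nat_sub.to_comp.comp hindex (Computable.const 1))) Partrec.none hφ)
  refine Partrec.bind (Partrec.rfind ?_) (hφ.comp Computable.fst)
  refine Partrec.map (hφ.comp ((Computable.fst.comp Computable.fst).pair
    (Primrec.nat_add.to_comp.comp (Computable.snd.comp Computable.fst) Computable.snd))) ?_
  exact (PrimrecPred.decide (PrimrecPred.not
    (Primrec.eq.comp Primrec.snd (Primrec.const 0)))).to_comp.to₂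

theorem untilNonzero_ne_listFun (φ : ℕ →. ℕ) (L : List ℕ) : untilNonzero φ ≠ listFun L := by
  intro h
  have hφ : ∀ x, L.getD x 0 ∈ φ x := fun x => by
    have hx : L.getD x 0 ∈ untilNonzero φ x := by rw [h]; exact Part.mem_some _
    obtain ⟨-, -, hx⟩ := Part.mem_bind_iff.1 hx
    exact hx
  have hx : L.getD L.length 0 ∈ untilNonzero φ L.length := by rw [h]; exact Part.mem_some _
  obtain ⟨m, hm, -⟩ := Part.mem_bind_iff.1 hx
  obtain ⟨y, hy, hy0⟩ := (Part.mem_map_iff _).1 (Nat.rfind_spec hm)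
  have := Part.mem_unique hy (hφ _)
  rw [List.getD_eq_default _ _ (by omega)] at this
  simp [this] at hy0

theorem untilNonzero_eq {φ : ℕ →. ℕ} (htot : ∀ x, (φ x).Dom) (hφ : ∀ L, φ ≠ listFun L) :
    untilNonzero φ = φ := by
  have hnz : ∀ x, ∃ m, (φ (x + m)).get (htot _) ≠ 0 := by
    intro x
    by_contra! hz
    refine hφ ((List.range x).map fun i => (φ i).get (htot i)) (funext fun i => ?_)
    rw [← Part.some_get (htot i), listFun]
    congr 1
    rcases lt_or_ge i x with hi | hi
    · simp [hi]
    · obtain ⟨m, rfl⟩ := Nat.exists_eq_add_of_le hi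
      rw [List.getD_eq_default _ _ (by simp), hz]
  funext x
  obtain ⟨m, hm⟩ := hnz x
  have hdom : (Nat.rfind fun m => (φ (x + m)).map fun y => decide (y ≠ 0)).Dom :=
    Nat.rfind_dom.2 ⟨m, (Part.mem_map_iff _).2 ⟨_, Part.get_mem (htot _), by simpa using hm⟩,
      fun _ => htot _⟩
  rw [untilNonzero, ← Part.some_get hdom, Part.bind_some]

theorem family_ne_listFun (e : ℕ) (L : List ℕ) : family e ≠ listFun L := by
  intro h
  by_cases he : e.unpair.1 = 0
  · refine untilNonzero_ne_listFun (Denumerable.ofNat Nat.Partrec.Code e.unpair.2).eval L ?_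
    rw [← h]
    funext x
    simp [family, he]
  · have := congrFun h (e.unpair.1 - 1)
    simp only [family, he, decide_false, cond_false, decide_true, cond_true, listFun] at this
    exact Part.some_ne_none _ this.symm

theorem exists_family_eq {f : ℕ →. ℕ} (hf : Nat.Partrec f) :
    (∃ L, f = listFun L) ∨ ∃ e, family e = f := by
  obtain ⟨c, rfl⟩ := Nat.Partrec.Code.exists_code.1 hf
  by_cases hL : ∃ L, c.eval = listFun L
  · exact Or.inl hL
  refine Or.inr ?_
  push Not at hL
  by_cases htot : ∀ x, (c.eval x).Dom
  · refine ⟨Nat.pair 0 (Encodable.encode c), funext fun x => ?_⟩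
    simp [family, untilNonzero_eq htot hL]
  · push Not at htot
    obtain ⟨n, hn⟩ := htot
    refine ⟨Nat.pair (n + 1) (Encodable.encode c), funext fun x => ?_⟩
    by_cases hx : x = n
    · simp [family, hx, Part.eq_none_iff'.2 hn]
    · simp [family, hx]

end FriedbergNumbering

/-- Friedberg: 𝒫⁽¹⁾ has a Friedberg numbering. -/
theorem friedberg_numbering_exists : ∃ ν : ℕ → ℕ →. ℕ, IsFriedberg PCF ν := by
  exact FriedbergNumbering.exists_isFriedberg_of_family FriedbergNumbering.partrec_family
    FriedbergNumbering.family_ne_listFun fun _ => FriedbergNumbering.exists_family_eq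
end

section
/- There exist two incomparable Friedberg numberings of 𝒫⁽¹⁾: Friedberg numberings ν and μ of all partial computable functions such that neither ν ≤ μ nor μ ≤ ν. -/
open Nat.Partrec (Code)
open Nat.Partrec.Code (evaln evaln_mono evaln_sound evaln_complete evaln_bound)

namespace Friedberg

section Primrec

variable {α : Type*} [Primcodable α] {R : α → ℕ → Prop} {f : α → ℕ}

theorem primrecPred_forall_lt (hR : PrimrecRel R) (hf : Primrec f) :
    PrimrecPred fun a => ∀ x < f a, R a x :=
  (hR.swap.forall_mem_list.comp (Primrec.list_range.comp hf) Primrec.id).of_eq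
    fun a => by simp [Function.swap]

theorem primrecPred_exists_lt (hR : PrimrecRel R) (hf : Primrec f) :
    PrimrecPred fun a => ∃ x < f a, R a x :=
  (hR.swap.exists_mem_list.comp (Primrec.list_range.comp hf) Primrec.id).of_eq
    fun a => by simp [Function.swap]

end Primrec

/-- A search whose successful outcomes are all values of `f x`, and which succeeds whenever `f x`
is defined, computes `f x`. -/
theorem rfindOpt_eq {g : ℕ → Option ℕ} {o : Part ℕ} (sound : ∀ s, ∀ y ∈ g s, y ∈ o)
    (complete : ∀ y ∈ o, ∃ s, (g s).isSome) : Nat.rfindOpt g = o := by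
  have key : ∀ y ∈ Nat.rfindOpt g, y ∈ o := fun y hy => by
    obtain ⟨s, hs⟩ := Nat.rfindOpt_spec hy
    exact sound s y hs
  refine Part.ext fun y => ⟨key y, fun hy => ?_⟩
  obtain ⟨s, hs⟩ := complete y hy
  obtain ⟨z, hz⟩ := Option.isSome_iff_exists.1 hs
  have hd : (Nat.rfindOpt g).Dom := Nat.rfindOpt_dom.2 ⟨s, z, hz⟩
  have := key _ (Part.get_mem hd)
  rw [Part.mem_unique hy this]
  exact Part.get_mem hd

/-- A decidable family of indices on which a computable family is a bijection onto `PCF` can be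
renumbered by `ℕ`. -/
theorem exists_isFriedberg_of_primrecPred {T : Type*} [Primcodable T] {p : T → Prop}
    (hp : PrimrecPred p) {ν : T → ℕ →. ℕ} (hν : Partrec₂ ν)
    (hinj : ∀ a b, p a → p b → ν a = ν b → a = b)
    (hsurj : ∀ f, Nat.Partrec f → ∃ a, p a ∧ ν a = f) : ∃ γ, IsFriedberg PCF γ := by
  classical
  let q : ℕ → Prop := fun n => ∃ a : T, p a ∧ Encodable.encode a = n
  have hq : Primrec fun n => decide (q n) := by
    have : Primrec fun n => ((Encodable.decode n : Option T).bind fun a =>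
        if p a ∧ Encodable.encode a = n then some a else none).isSome := by
      refine Primrec.option_isSome.comp (Primrec.option_bind Primrec.decode ?_)
      exact Primrec.ite ((hp.comp Primrec.snd).and
        (Primrec.eq.comp (Primrec.encode.comp Primrec.snd) Primrec.fst))
        (Primrec.option_some.comp Primrec.snd) (Primrec.const none)
    refine this.of_eq fun n => ?_
    rw [Bool.eq_iff_iff, decide_eq_true_iff, Option.isSome_iff_exists]
    constructor
    · rintro ⟨a, ha⟩
      obtain ⟨b, -, hb⟩ := Option.bind_eq_some_iff.1 ha
      split_ifs at hb with h
      exact ⟨b, h⟩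
    · rintro ⟨a, ha, rfl⟩
      exact ⟨a, by simp [ha]⟩
  have hinf : (Set.ofPred q).Infinite := by
    intro hfin
    have hsub : Set.range (fun k : ℕ => (fun _ => Part.some k : ℕ →. ℕ)) ⊆
        (fun n => fun x => ((Encodable.decode n : Option T) : Part T).bind fun a => ν a x) '' Set.ofPred q := by
      rintro _ ⟨k, rfl⟩
      obtain ⟨a, ha, h⟩ := hsurj (fun _ => Part.some k)
        (Partrec.nat_iff.1 (Computable.const k).partrec)
      exact ⟨Encodable.encode a, ⟨a, ha, rfl⟩, by simp [← h]⟩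
    refine Set.infinite_range_of_injective (fun k l h => ?_) ((hfin.image _).subset hsub)
    simpa using congrFun h 0
  have hcount : Primrec (Nat.count q) := by
    have : Primrec fun n => Nat.rec (motive := fun _ => ℕ) 0
        (fun k c => c + if q k then 1 else 0) n :=
      Primrec.nat_rec₁ 0 (Primrec.nat_add.comp Primrec.snd
        (Primrec.ite (PrimrecPred.comp ⟨_, hq⟩ Primrec.fst) (Primrec.const 1) (Primrec.const 0)))
    refine this.of_eq fun n => ?_
    induction n with
    | zero => simp
    | succ n ih => rw [Nat.count_succ, ← ih]
  have hnth : Computable (Nat.nth q) := by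
    have hex : ∀ i, ∃ n, q n ∧ Nat.count q n = i := fun i =>
      ⟨Nat.nth q i, Nat.nth_mem_of_infinite hinf i, Nat.count_nth_of_infinite hinf i⟩
    have hP : PrimrecPred fun a : ℕ × ℕ => q a.2 ∧ Nat.count q a.2 = a.1 :=
      (PrimrecPred.comp ⟨_, hq⟩ Primrec.snd).and
        (Primrec.eq.comp (hcount.comp Primrec.snd) Primrec.fst)
    refine (Computable.find hP.computablePred hex).of_eq fun i => ?_
    have h := Nat.find_spec (hex i)
    calc Nat.find (hex i) = Nat.nth q (Nat.count q (Nat.find (hex i))) := (Nat.nth_count h.1).symm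
      _ = _ := by rw [h.2]
  let γ : ℕ → ℕ →. ℕ := fun i x => ((Encodable.decode (Nat.nth q i) : Option T) : Part T).bind fun a => ν a x
  have hγ : Partrec₂ γ :=
    Partrec.bind (Computable.ofOption (Computable.decode.comp (hnth.comp Computable.fst)))
      (hν.comp Computable.snd (Computable.snd.comp Computable.fst))
  have hval : ∀ i, ∃ a, p a ∧ Encodable.encode a = Nat.nth q i ∧ γ i = ν a := fun i => by
    obtain ⟨a, ha, h⟩ := Nat.nth_mem_of_infinite hinf i
    exact ⟨a, ha, h, by funext x; simp [γ, ← h]⟩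
  refine ⟨γ, ⟨⟨fun i => ?_, fun f hf => ?_⟩, hγ⟩, fun i j hij => ?_⟩
  · exact Partrec.nat_iff.1 (hγ.comp (Computable.const i) Computable.id)
  · obtain ⟨a, ha, h⟩ := hsurj f hf
    refine ⟨Nat.count q (Encodable.encode a), ?_⟩
    funext x
    have : Nat.nth q (Nat.count q (Encodable.encode a)) = Encodable.encode a :=
      Nat.nth_count ⟨a, ha, rfl⟩
    simp [γ, this, h]
  · obtain ⟨a, ha, hai, hγa⟩ := hval i
    obtain ⟨b, hb, hbj, hγb⟩ := hval j
    obtain rfl := hinj a b ha hb (by rw [← hγa, ← hγb, hij])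
    exact Nat.nth_injective hinf (hai.symm.trans hbj)

/-- The partial function with domain `{0, …, l.length - 1}` and values listed by `l`. -/
def ofList (l : List ℕ) : ℕ →. ℕ := fun x => (l[x]? : Part ℕ)

theorem mem_ofList {l : List ℕ} {x y : ℕ} : y ∈ ofList l x ↔ l[x]? = some y := by
  simp [ofList]

theorem ofList_injective : Function.Injective ofList := fun l l' h => by
  refine List.ext_getElem? fun x => Option.ext fun y => ?_
  rw [← mem_ofList, ← mem_ofList, h]

theorem exists_mem_ofList {l : List ℕ} {x : ℕ} : (∃ y, y ∈ ofList l x) ↔ x < l.length := by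
  simp_rw [mem_ofList, ← Option.isSome_iff_exists]
  simp

/-- With `e` coding a program `c` and a pair `(p, q)`, the finite approximation at stage `s` of a
function that is never of the form `ofList l` with `l.length` odd: if `p < q` this is `c` without
its value at `p`, empty until `c` converges at `q`; otherwise it is the restriction of `c` to the
largest initial segment of even or infinite length on which `c` converges. -/
def approx (s e x : ℕ) : Option ℕ :=
  if (e.unpair.2.unpair.1 < e.unpair.2.unpair.2 ∧ x ≠ e.unpair.2.unpair.1 ∧
      (evaln s (Denumerable.ofNat Code e.unpair.1) e.unpair.2.unpair.2).isSome) ∨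
    (¬ e.unpair.2.unpair.1 < e.unpair.2.unpair.2 ∧ ∀ y < 2 * (x / 2) + 2,
      (evaln s (Denumerable.ofNat Code e.unpair.1) y).isSome)
  then evaln s (Denumerable.ofNat Code e.unpair.1) x else none

/-- The limit of the approximations `approx s e`. -/
def limitFn (e : ℕ) : ℕ →. ℕ := fun x => Nat.rfindOpt fun s => approx s e x

theorem isSome_evaln_mono {s t : ℕ} (h : s ≤ t) {c : Code} {x : ℕ} (hs : (evaln s c x).isSome) :
    (evaln t c x).isSome := by
  obtain ⟨y, hy⟩ := Option.isSome_iff_exists.1 hs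
  exact Option.isSome_iff_exists.2 ⟨y, evaln_mono h hy⟩

theorem approx_mono {s t e x y : ℕ} (h : s ≤ t) (hy : approx s e x = some y) :
    approx t e x = some y := by
  unfold approx at hy ⊢
  split_ifs at hy with hc
  rw [if_pos]
  · exact evaln_mono h hy
  · rcases hc with ⟨h1, h2, h3⟩ | ⟨h1, h2⟩
    · exact Or.inl ⟨h1, h2, isSome_evaln_mono h h3⟩
    · exact Or.inr ⟨h1, fun y hy => isSome_evaln_mono h (h2 y hy)⟩

theorem lt_of_approx {s e x y : ℕ} (hy : approx s e x = some y) : x < s := by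
  unfold approx at hy
  split_ifs at hy
  exact evaln_bound hy

theorem mem_limitFn {e x y : ℕ} : y ∈ limitFn e x ↔ ∃ s, approx s e x = some y :=
  Nat.rfindOpt_mono fun h => approx_mono h

theorem primrec_approx {α : Type*} [Primcodable α] {s e x : α → ℕ} (hs : Primrec s)
    (he : Primrec e) (hx : Primrec x) : Primrec fun a => approx (s a) (e a) (x a) := by
  have hu : Primrec fun a => (e a).unpair := Primrec.unpair.comp he
  have hu2 : Primrec fun a => (e a).unpair.2.unpair := Primrec.unpair.comp (Primrec.snd.comp hu)
  have hp := Primrec.fst.comp hu2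
  have hq := Primrec.snd.comp hu2
  have hc : Primrec fun a => Denumerable.ofNat Code (e a).unpair.1 :=
    (Primrec.ofNat Code).comp (Primrec.fst.comp hu)
  have hev : ∀ {β : Type _} [Primcodable β] {i : β → α} {z : β → ℕ}, Primrec i → Primrec z →
      Primrec fun b => evaln (s (i b)) (Denumerable.ofNat Code (e (i b)).unpair.1) (z b) :=
    fun hi hz => Nat.Partrec.Code.primrec_evaln.comp
      (((hs.comp hi).pair (hc.comp hi)).pair hz)
  have hsome : ∀ {β : Type _} [Primcodable β] {i : β → α} {z : β → ℕ}, Primrec i → Primrec z →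
      PrimrecPred fun b =>
        (evaln (s (i b)) (Denumerable.ofNat Code (e (i b)).unpair.1) (z b)).isSome = true :=
    fun hi hz => Primrec.eq.comp (Primrec.option_isSome.comp (hev hi hz)) (Primrec.const true)
  have hlt := Primrec.nat_lt.comp hp hq
  refine Primrec.ite (PrimrecPred.or (hlt.and ((Primrec.eq.comp hx hp).not.and
    (hsome Primrec.id hq))) (hlt.not.and (primrecPred_forall_lt ?_ ?_)))
    (hev Primrec.id hx) (Primrec.const none)
  · exact hsome Primrec.fst Primrec.snd
  · exact Primrec.nat_add.comp (Primrec.nat_mul.comp (Primrec.const 2)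
      (Primrec.nat_div.comp hx (Primrec.const 2))) (Primrec.const 2)

theorem evaln_common {c : Code} (n : ℕ) (h : ∀ x < n, (c.eval x).Dom) :
    ∃ s, ∀ x < n, (evaln s c x).isSome := by
  induction n with
  | zero => exact ⟨0, by simp⟩
  | succ n ih =>
    obtain ⟨s, hs⟩ := ih fun x hx => h x (by omega)
    obtain ⟨t, ht⟩ := evaln_complete.1 (Part.get_mem (h n (by omega)))
    refine ⟨max s t, fun x hx => ?_⟩
    rcases Nat.lt_succ_iff_lt_or_eq.1 hx with hx | rfl
    · exact isSome_evaln_mono (le_max_left _ _) (hs x hx)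
    · exact isSome_evaln_mono (le_max_right _ _) (Option.isSome_iff_exists.2 ⟨_, ht⟩)

theorem dom_of_isSome_evaln {s : ℕ} {c : Code} {x : ℕ} (h : (evaln s c x).isSome) :
    (c.eval x).Dom := by
  obtain ⟨y, hy⟩ := Option.isSome_iff_exists.1 h
  exact Part.dom_iff_mem.2 ⟨y, evaln_sound hy⟩

theorem mem_limitFn_iff {c : Code} {p q x y : ℕ} :
    y ∈ limitFn (Nat.pair (Encodable.encode c) (Nat.pair p q)) x ↔ y ∈ c.eval x ∧
      ((p < q ∧ x ≠ p ∧ (c.eval q).Dom) ∨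
        (¬ p < q ∧ ∀ z < 2 * (x / 2) + 2, (c.eval z).Dom)) := by
  rw [mem_limitFn]
  simp only [approx, Nat.unpair_pair, Denumerable.ofNat_encode]
  constructor
  · rintro ⟨s, hs⟩
    split_ifs at hs with hc
    refine ⟨evaln_sound hs, ?_⟩
    rcases hc with ⟨h1, h2, h3⟩ | ⟨h1, h2⟩
    · exact Or.inl ⟨h1, h2, dom_of_isSome_evaln h3⟩
    · exact Or.inr ⟨h1, fun z hz => dom_of_isSome_evaln (h2 z hz)⟩
  · rintro ⟨hy, hc⟩
    obtain ⟨s, hs⟩ := evaln_complete.1 hy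
    rcases hc with ⟨h1, h2, h3⟩ | ⟨h1, h2⟩
    · obtain ⟨t, ht⟩ := evaln_complete.1 (Part.get_mem h3)
      refine ⟨max s t, ?_⟩
      rw [if_pos]
      · exact evaln_mono (le_max_left _ _) hs
      · exact Or.inl ⟨h1, h2,
          isSome_evaln_mono (le_max_right _ _) (Option.isSome_iff_exists.2 ⟨_, ht⟩)⟩
    · obtain ⟨t, ht⟩ := evaln_common _ h2
      refine ⟨max s t, ?_⟩
      rw [if_pos]
      · exact evaln_mono (le_max_left _ _) hs
      · exact Or.inr ⟨h1, fun z hz => isSome_evaln_mono (le_max_right _ _) (ht z hz)⟩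

theorem limitFn_ne_ofList (e : ℕ) {l : List ℕ} (hl : l.length % 2 = 1) : limitFn e ≠ ofList l := by
  intro h
  obtain ⟨c, p, q, rfl⟩ : ∃ (c : Code) (p q : ℕ),
      e = Nat.pair (Encodable.encode c) (Nat.pair p q) :=
    ⟨Denumerable.ofNat Code e.unpair.1, e.unpair.2.unpair.1, e.unpair.2.unpair.2, by simp⟩
  have key : ∀ x, x < l.length ↔ (c.eval x).Dom ∧
      ((p < q ∧ x ≠ p ∧ (c.eval q).Dom) ∨
        (¬ p < q ∧ ∀ z < 2 * (x / 2) + 2, (c.eval z).Dom)) := fun x => by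
    rw [← exists_mem_ofList, ← h]
    simp only [mem_limitFn_iff, exists_and_right, Part.dom_iff_mem]
  by_cases hpq : p < q
  · simp only [hpq, not_true_eq_false, true_and, false_and, or_false] at key
    have hq : (c.eval q).Dom := ((key 0).1 (by omega)).2.2
    have := (key q).2 ⟨hq, by omega, hq⟩
    exact ((key p).1 (by omega)).2.1 rfl
  · simp only [hpq, not_false_eq_true, true_and, false_and, false_or] at key
    have h1 := ((key (l.length - 1)).1 (by omega)).2
    have h2 := (key l.length).2 ⟨h1 _ (by omega), fun z hz => h1 z (by omega)⟩
    omega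

theorem exists_ofList_or_limitFn {f : ℕ →. ℕ} (hf : Nat.Partrec f) :
    (∃ l : List ℕ, l.length % 2 = 1 ∧ ofList l = f) ∨ ∃ e, limitFn e = f := by
  obtain ⟨c, rfl⟩ := Nat.Partrec.Code.exists_code.1 hf
  by_cases hgap : ∃ p q, p < q ∧ ¬ (c.eval p).Dom ∧ (c.eval q).Dom
  · obtain ⟨p, q, hpq, hp, hq⟩ := hgap
    refine Or.inr ⟨Nat.pair (Encodable.encode c) (Nat.pair p q), ?_⟩
    funext x
    refine Part.ext fun y => ?_
    rw [mem_limitFn_iff]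
    refine ⟨And.left, fun hy => ⟨hy, Or.inl ⟨hpq, ?_, hq⟩⟩⟩
    rintro rfl
    exact hp (Part.dom_iff_mem.2 ⟨y, hy⟩)
  push Not at hgap
  by_cases heven : ∀ x, (c.eval x).Dom → ∀ z < 2 * (x / 2) + 2, (c.eval z).Dom
  · refine Or.inr ⟨Nat.pair (Encodable.encode c) (Nat.pair 0 0), ?_⟩
    funext x
    refine Part.ext fun y => ?_
    rw [mem_limitFn_iff]
    exact ⟨And.left, fun hy => ⟨hy, Or.inr ⟨by omega, heven x (Part.dom_iff_mem.2 ⟨y, hy⟩)⟩⟩⟩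
  · push Not at heven
    obtain ⟨x, hx, z, hz, hzd⟩ := heven
    have hxz : ¬ z < x := fun h => hgap z x h hzd hx
    have hzx : z ≠ x := by rintro rfl; exact hzd hx
    have hdom : ∀ w, (c.eval w).Dom ↔ w < z := fun w => by
      refine ⟨fun hw => ?_, fun hw => ?_⟩
      · by_contra hwz
        rcases Nat.lt_or_eq_of_le (not_lt.1 hwz) with h | rfl
        · exact hgap z w h hzd hw
        · exact hzd hw
      · by_contra hwd
        rcases Nat.lt_or_eq_of_le (show w ≤ x by omega) with h | rfl
        · exact hgap w x h hwd hx
        · exact hwd hx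
    refine Or.inl ⟨List.ofFn fun i : Fin z => (c.eval i).get ((hdom i).2 i.2), ?_, ?_⟩
    · simp only [List.length_ofFn]
      omega
    · funext w
      refine Part.ext fun y => ?_
      rw [mem_ofList, List.getElem?_ofFn]
      by_cases hw : w < z
      · simp [hw, Part.get_eq_iff_mem]
      · simp only [hw, dite_false, reduceCtorEq, false_iff]
        exact fun hy => hw ((hdom w).1 (Part.dom_iff_mem.2 ⟨y, hy⟩))

/-- At stage `s`, the `e`-th approximation agrees below `m` with an earlier one. -/
def Clash (e m s : ℕ) : Prop := m ≤ s ∧ ∃ j < e, ∀ x < m, approx s j x = approx s e x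

/-- `s` is the first stage at which `Clash e m s` holds. -/
def FirstClash (e m s : ℕ) : Prop := Clash e m s ∧ ∀ t < s, ¬ Clash e m t

theorem Clash.anti {e m m' s : ℕ} (h : Clash e m s) (hm : m' ≤ m) : Clash e m' s :=
  ⟨hm.trans h.1, h.2.imp fun _ hj => ⟨hj.1, fun x hx => hj.2 x (by omega)⟩⟩

theorem Clash.exists_firstClash {e m s : ℕ} (h : Clash e m s) : ∃ t, FirstClash e m t := by
  classical
  have hex : ∃ t, Clash e m t := ⟨s, h⟩
  exact ⟨Nat.find hex, Nat.find_spec hex, fun t ht => Nat.find_min hex ht⟩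

theorem FirstClash.unique {e m s t : ℕ} (hs : FirstClash e m s) (ht : FirstClash e m t) :
    s = t := by
  rcases lt_trichotomy s t with h | h | h
  · exact absurd hs.1 (ht.2 s h)
  · exact h
  · exact absurd ht.1 (hs.2 t h)

theorem exists_approx_eq (j n : ℕ) :
    ∃ s, ∀ t ≥ s, ∀ x < n, ∀ y, approx t j x = some y ↔ y ∈ limitFn j x := by
  induction n with
  | zero => exact ⟨0, by simp⟩
  | succ n ih =>
    obtain ⟨s, hs⟩ := ih
    obtain ⟨r, hr⟩ : ∃ r, ∀ t ≥ r, ∀ y, approx t j n = some y ↔ y ∈ limitFn j n := by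
      by_cases hd : ∃ y, y ∈ limitFn j n
      · obtain ⟨y, hy⟩ := hd
        obtain ⟨r, hr⟩ := mem_limitFn.1 hy
        refine ⟨r, fun t ht z => ⟨fun h => mem_limitFn.2 ⟨t, h⟩, fun h => ?_⟩⟩
        rw [Part.mem_unique h hy]
        exact approx_mono ht hr
      · push Not at hd
        exact ⟨0, fun t _ y => ⟨fun h => mem_limitFn.2 ⟨t, h⟩, fun h => absurd h (hd y)⟩⟩
    refine ⟨max s r, fun t ht x hx => ?_⟩
    rcases Nat.lt_succ_iff_lt_or_eq.1 hx with hx | rfl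
    · exact hs t (le_of_max_le_left ht) x hx
    · exact hr t (le_of_max_le_right ht)

theorem exists_clash_of_eq {j e : ℕ} (hj : j < e) (h : limitFn j = limitFn e) (m : ℕ) :
    ∃ s, Clash e m s := by
  obtain ⟨s, hs⟩ := exists_approx_eq j m
  obtain ⟨t, ht⟩ := exists_approx_eq e m
  refine ⟨max m (max s t), le_max_left _ _, j, hj, fun x hx => Option.ext fun y => ?_⟩
  rw [hs _ (by omega) x hx, ht _ (by omega) x hx, h]

theorem exists_forall_not_clash {e : ℕ} (h : ∀ j < e, limitFn j ≠ limitFn e) :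
    ∃ m, ∀ s, ¬ Clash e m s := by
  have key : ∀ k ≤ e, ∃ m, ∀ s ≥ m, ∀ j < k, ¬ ∀ x < m, approx s j x = approx s e x := by
    intro k hk
    induction k with
    | zero => exact ⟨0, by simp⟩
    | succ k ih =>
      obtain ⟨m, hm⟩ := ih (by omega)
      obtain ⟨x, hx⟩ : ∃ x, limitFn k x ≠ limitFn e x := by
        by_contra! hc
        exact h k hk (funext hc)
      obtain ⟨s, hs⟩ := exists_approx_eq k (x + 1)
      obtain ⟨t, ht⟩ := exists_approx_eq e (x + 1)
      refine ⟨max m (max (x + 1) (max s t)), fun r hr j hj hagree => ?_⟩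
      rcases Nat.lt_succ_iff_lt_or_eq.1 hj with hj | rfl
      · exact hm r (by omega) j hj fun z hz => hagree z (by omega)
      · refine hx (Part.ext fun y => ?_)
        rw [← hs r (by omega) x (by omega), ← ht r (by omega) x (by omega),
          hagree x (by omega)]
  obtain ⟨m, hm⟩ := key e le_rfl
  exact ⟨m, fun s ⟨hs, j, hj, hx⟩ => hm s hs j hj hx⟩

theorem primrecPred_clash {α : Type*} [Primcodable α] {e m s : α → ℕ} (he : Primrec e)
    (hm : Primrec m) (hs : Primrec s) : PrimrecPred fun a => Clash (e a) (m a) (s a) := by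
  refine (Primrec.nat_le.comp hm hs).and (primrecPred_exists_lt ?_ he)
  refine primrecPred_forall_lt (α := α × ℕ) ?_ (hm.comp Primrec.fst)
  have h1 : Primrec fun a : (α × ℕ) × ℕ => a.1.1 := Primrec.fst.comp Primrec.fst
  exact Primrec.eq.comp
    (primrec_approx (hs.comp h1) (Primrec.snd.comp Primrec.fst) Primrec.snd)
    (primrec_approx (hs.comp h1) (he.comp h1) Primrec.snd)

theorem primrecPred_firstClash {α : Type*} [Primcodable α] {e m s : α → ℕ} (he : Primrec e)
    (hm : Primrec m) (hs : Primrec s) : PrimrecPred fun a => FirstClash (e a) (m a) (s a) :=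
  (primrecPred_clash he hm hs).and (primrecPred_forall_lt (PrimrecPred.not (primrecPred_clash
    (he.comp Primrec.fst) (hm.comp Primrec.fst) Primrec.snd)) hs)

/-- A list extending the approximation `approx s e`, whose odd length codes `(e, m, s)`. -/
def padded (e m s : ℕ) : List ℕ :=
  (List.range (2 * Nat.pair (Nat.pair e m) s + 1)).map fun x => (approx s e x).getD 0

theorem length_padded (e m s : ℕ) :
    (padded e m s).length = 2 * Nat.pair (Nat.pair e m) s + 1 := by
  simp [padded]

theorem padded_getElem? {e m s x y : ℕ} (h : approx s e x = some y) :
    (padded e m s)[x]? = some y := by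
  have hx := lt_of_approx h
  have hs : s ≤ Nat.pair (Nat.pair e m) s := Nat.right_le_pair _ _
  rw [padded, List.getElem?_map, List.getElem?_range (by omega)]
  simp [h]

theorem padded_injective {e m s e' m' s' : ℕ} (h : padded e m s = padded e' m' s') :
    e = e' ∧ m = m' ∧ s = s' := by
  have h := congrArg List.length h
  rw [length_padded, length_padded] at h
  have h2 : Nat.pair (Nat.pair e m) s = Nat.pair (Nat.pair e' m') s' := by omega
  simpa [Nat.pair_eq_pair, and_assoc] using h2

theorem primrec_padded {α : Type*} [Primcodable α] {e m s : α → ℕ} (he : Primrec e)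
    (hm : Primrec m) (hs : Primrec s) : Primrec fun a => padded (e a) (m a) (s a) := by
  refine Primrec.list_map (Primrec.list_range.comp (Primrec.nat_double_succ.comp
    (Primrec₂.natPair.comp (Primrec₂.natPair.comp he hm) hs))) ?_
  exact Primrec.option_getD.comp (primrec_approx (hs.comp Primrec.fst) (he.comp Primrec.fst)
    Primrec.snd) (Primrec.const 0)

open scoped Classical in
/-- One stage of the computation of `follower e m x`. -/
noncomputable def followerStep (e m x s : ℕ) : Option ℕ :=
  if FirstClash e m s then (padded e m s)[x]?
  else if ∀ t < s + 1, ¬ Clash e m t then approx s e x else none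

/-- Follow `limitFn e` until a clash below `m` occurs, and then turn into a padded list. -/
noncomputable def follower (e m : ℕ) : ℕ →. ℕ := fun x => Nat.rfindOpt (followerStep e m x)

theorem follower_of_forall_not_clash {e m : ℕ} (h : ∀ s, ¬ Clash e m s) :
    follower e m = limitFn e := by
  funext x
  have hstep : ∀ s, followerStep e m x s = approx s e x := fun s => by
    rw [followerStep, if_neg fun hc => h s hc.1, if_pos fun t _ => h t]
  simp [follower, limitFn, funext hstep]

theorem follower_of_firstClash {e m s : ℕ} (h : FirstClash e m s) :
    follower e m = ofList (padded e m s) := by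
  funext x
  refine rfindOpt_eq (fun t y hy => ?_) fun y hy => ⟨s, ?_⟩
  · rw [Option.mem_def, followerStep] at hy
    rw [mem_ofList]
    split_ifs at hy with h1 h2
    · rwa [h.unique h1]
    · have hts : t < s := by
        by_contra hc
        exact h2 s (by omega) h.1
      exact padded_getElem? (approx_mono hts.le hy)
  · rw [followerStep, if_pos h, mem_ofList.1 hy]
    rfl

theorem partrec_follower {α : Type*} [Primcodable α] {e m x : α → ℕ} (he : Primrec e)
    (hm : Primrec m) (hx : Primrec x) : Partrec fun a => follower (e a) (m a) (x a) := by
  classical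
  refine Partrec.rfindOpt (f := fun a s => followerStep (e a) (m a) (x a) s) ?_
  have he' : Primrec fun a : α × ℕ => e a.1 := he.comp Primrec.fst
  have hm' : Primrec fun a : α × ℕ => m a.1 := hm.comp Primrec.fst
  have hx' : Primrec fun a : α × ℕ => x a.1 := hx.comp Primrec.fst
  have hclash : PrimrecRel fun (a : α × ℕ) t => ¬ Clash (e a.1) (m a.1) t :=
    PrimrecPred.not (primrecPred_clash (he'.comp Primrec.fst) (hm'.comp Primrec.fst) Primrec.snd)
  have key := Primrec.to_comp (Primrec.ite (primrecPred_firstClash he' hm' Primrec.snd)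
    (Primrec.list_getElem?.comp (primrec_padded he' hm' Primrec.snd) hx')
    (Primrec.ite (primrecPred_forall_lt hclash (Primrec.succ.comp Primrec.snd))
      (primrec_approx Primrec.snd he' hx') (Primrec.const none)))
  exact key.of_eq fun a => by simp only [followerStep]

/-- The list `l` is the final state of some follower. -/
def Used (l : List ℕ) : Prop :=
  FirstClash (l.length / 2).unpair.1.unpair.1 (l.length / 2).unpair.1.unpair.2
    (l.length / 2).unpair.2 ∧
  l = padded (l.length / 2).unpair.1.unpair.1 (l.length / 2).unpair.1.unpair.2
    (l.length / 2).unpair.2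

theorem used_iff {l : List ℕ} : Used l ↔ ∃ e m s, FirstClash e m s ∧ l = padded e m s := by
  refine ⟨fun h => ⟨_, _, _, h⟩, ?_⟩
  rintro ⟨e, m, s, h, rfl⟩
  have : (padded e m s).length / 2 = Nat.pair (Nat.pair e m) s := by
    rw [length_padded]
    omega
  simpa [Used, this] using h

theorem primrecPred_used : PrimrecPred Used := by
  have hr : Primrec fun l : List ℕ => (l.length / 2).unpair :=
    Primrec.unpair.comp (Primrec.nat_div.comp Primrec.list_length (Primrec.const 2))
  have hr1 : Primrec fun l : List ℕ => (l.length / 2).unpair.1.unpair :=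
    Primrec.unpair.comp (Primrec.fst.comp hr)
  have he := Primrec.fst.comp hr1
  have hm := Primrec.snd.comp hr1
  have hs := Primrec.snd.comp hr
  exact (primrecPred_firstClash he hm hs).and
    (Primrec.eq.comp Primrec.id (primrec_padded he hm hs))

/-- The parameter `m` of a follower of `limitFn e` is eligible, with certificate `t`, once smaller
parameters are known to lead to a clash. -/
def Eligible (e m t : ℕ) : Prop := (m = 0 ∧ t = 0) ∨ (0 < m ∧ FirstClash e (m - 1) t)

theorem Eligible.unique {e m t t' : ℕ} (h : Eligible e m t) (h' : Eligible e m t') : t = t' := by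
  rcases h with ⟨h1, h2⟩ | ⟨h1, h2⟩ <;> rcases h' with ⟨h3, h4⟩ | ⟨h3, h4⟩
  · omega
  · omega
  · omega
  · exact h2.unique h4

theorem Eligible.exists_clash {e m m' t : ℕ} (h : Eligible e m t) (hm : m' < m) :
    ∃ s, Clash e m' s := by
  rcases h with ⟨h1, h2⟩ | ⟨h1, h2⟩
  · omega
  · exact ⟨t, h2.1.anti (by omega)⟩

theorem exists_eligible {e m : ℕ} (h : ∀ m' < m, ∃ s, Clash e m' s) : ∃ t, Eligible e m t := by
  rcases Nat.eq_zero_or_pos m with rfl | hm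
  · exact ⟨0, Or.inl ⟨rfl, rfl⟩⟩
  · obtain ⟨s, hs⟩ := h (m - 1) (by omega)
    obtain ⟨t, ht⟩ := hs.exists_firstClash
    exact ⟨t, Or.inr ⟨hm, ht⟩⟩

theorem primrecPred_eligible :
    PrimrecPred fun a : ℕ × ℕ × ℕ => Eligible a.1 a.2.1 a.2.2 := by
  have hm : Primrec fun a : ℕ × ℕ × ℕ => a.2.1 := Primrec.fst.comp Primrec.snd
  have ht : Primrec fun a : ℕ × ℕ × ℕ => a.2.2 := Primrec.snd.comp Primrec.snd
  exact PrimrecPred.or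
    ((Primrec.eq.comp hm (Primrec.const 0)).and (Primrec.eq.comp ht (Primrec.const 0)))
    ((Primrec.nat_lt.comp (Primrec.const 0) hm).and
      (primrecPred_firstClash Primrec.fst (Primrec.nat_sub.comp hm (Primrec.const 1)) ht))

/-- Eligible followers, and lists of odd length that are not used by a follower. -/
def Valid : (ℕ × ℕ × ℕ) ⊕ List ℕ → Prop
  | .inl a => Eligible a.1 a.2.1 a.2.2
  | .inr l => l.length % 2 = 1 ∧ ¬ Used l

/-- The function named by an index. -/
noncomputable def value : (ℕ × ℕ × ℕ) ⊕ List ℕ → ℕ →. ℕ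
  | .inl a => follower a.1 a.2.1
  | .inr l => ofList l

theorem primrecPred_valid : PrimrecPred Valid := by
  classical
  have hl : PrimrecPred fun l : List ℕ => l.length % 2 = 1 ∧ ¬ Used l :=
    (Primrec.eq.comp (Primrec.nat_mod.comp Primrec.list_length (Primrec.const 2))
      (Primrec.const 1)).and primrecPred_used.not
  refine ⟨Classical.decPred _, (Primrec.sumCasesOn Primrec.id
    (primrecPred_eligible.decide.comp Primrec.snd).to₂
    (hl.decide.comp Primrec.snd).to₂).of_eq fun a => ?_⟩
  rcases a with a | l <;> exact decide_eq_decide.2 Iff.rfl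

theorem partrec_value : Partrec₂ value := by
  refine (Partrec.sumCasesOn (f := fun a : ((ℕ × ℕ × ℕ) ⊕ List ℕ) × ℕ => a.1)
    (g := fun a b => follower b.1 b.2.1 a.2) (h := fun a l => ofList l a.2) Computable.fst
    ?_ ?_).of_eq ?_
  · exact partrec_follower (Primrec.fst.comp Primrec.snd)
      (Primrec.fst.comp (Primrec.snd.comp Primrec.snd)) (Primrec.snd.comp Primrec.fst)
  · exact Computable.ofOption (Primrec.list_getElem?.comp Primrec.snd
      (Primrec.snd.comp Primrec.fst)).to_comp
  · rintro ⟨a | l, x⟩ <;> rfl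

theorem follower_cases (e m : ℕ) :
    (∃ s, FirstClash e m s ∧ follower e m = ofList (padded e m s)) ∨
      ((∀ s, ¬ Clash e m s) ∧ follower e m = limitFn e) := by
  by_cases h : ∃ s, Clash e m s
  · obtain ⟨s, hs⟩ := h
    obtain ⟨t, ht⟩ := hs.exists_firstClash
    exact Or.inl ⟨t, ht, follower_of_firstClash ht⟩
  · push Not at h
    exact Or.inr ⟨h, follower_of_forall_not_clash h⟩

theorem length_padded_mod_two (e m s : ℕ) : (padded e m s).length % 2 = 1 := by
  rw [length_padded]
  omega

theorem follower_injective {e m t e' m' t' : ℕ} (h : Eligible e m t) (h' : Eligible e' m' t')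
    (heq : follower e m = follower e' m') : e = e' ∧ m = m' ∧ t = t' := by
  suffices e = e' ∧ m = m' by
    obtain ⟨rfl, rfl⟩ := this
    exact ⟨rfl, rfl, h.unique h'⟩
  rcases follower_cases e m with ⟨s, -, hf⟩ | ⟨hn, hf⟩ <;>
    rcases follower_cases e' m' with ⟨s', -, hf'⟩ | ⟨hn', hf'⟩ <;> rw [hf, hf'] at heq
  · have := padded_injective (ofList_injective heq)
    exact ⟨this.1, this.2.1⟩
  · exact absurd heq.symm (limitFn_ne_ofList e' (length_padded_mod_two e m s))
  · exact absurd heq (limitFn_ne_ofList e (length_padded_mod_two e' m' s'))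
  · obtain rfl : e = e' := by
      rcases lt_trichotomy e e' with hlt | rfl | hlt
      · obtain ⟨s, hs⟩ := exists_clash_of_eq hlt heq m'
        exact absurd hs (hn' s)
      · rfl
      · obtain ⟨s, hs⟩ := exists_clash_of_eq hlt heq.symm m
        exact absurd hs (hn s)
    refine ⟨rfl, ?_⟩
    rcases lt_trichotomy m m' with hlt | rfl | hlt
    · obtain ⟨s, hs⟩ := h'.exists_clash hlt
      exact absurd hs (hn s)
    · rfl
    · obtain ⟨s, hs⟩ := h.exists_clash hlt
      exact absurd hs (hn' s)

theorem follower_ne_ofList {e m : ℕ} {l : List ℕ} (hl : l.length % 2 = 1) (hu : ¬ Used l) :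
    follower e m ≠ ofList l := by
  intro h
  rcases follower_cases e m with ⟨s, hs, hf⟩ | ⟨-, hf⟩ <;> rw [hf] at h
  · exact hu (used_iff.2 ⟨e, m, s, hs, (ofList_injective h).symm⟩)
  · exact limitFn_ne_ofList e hl h

theorem value_injective (a b : (ℕ × ℕ × ℕ) ⊕ List ℕ) (ha : Valid a) (hb : Valid b)
    (h : value a = value b) : a = b := by
  rcases a with ⟨e, m, t⟩ | l <;> rcases b with ⟨e', m', t'⟩ | l'
  · obtain ⟨rfl, rfl, rfl⟩ := follower_injective ha hb h
    rfl
  · exact absurd h (follower_ne_ofList hb.1 hb.2)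
  · exact absurd h.symm (follower_ne_ofList ha.1 ha.2)
  · exact congrArg _ (ofList_injective h)

theorem exists_value_eq (f : ℕ →. ℕ) (hf : Nat.Partrec f) : ∃ a, Valid a ∧ value a = f := by
  classical
  rcases exists_ofList_or_limitFn hf with ⟨l, hl, rfl⟩ | hex
  · by_cases hu : Used l
    · obtain ⟨e, m, s, hs, rfl⟩ := used_iff.1 hu
      obtain ⟨t, ht⟩ := exists_eligible (m := m) fun m' hm' => ⟨s, hs.1.anti hm'.le⟩
      exact ⟨.inl (e, m, t), ht, follower_of_firstClash hs⟩
    · exact ⟨.inr l, ⟨hl, hu⟩, rfl⟩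
  · have hmin : ∀ j < Nat.find hex, limitFn j ≠ limitFn (Nat.find hex) := fun j hj h =>
      Nat.find_min hex hj (h.trans (Nat.find_spec hex))
    have hm := exists_forall_not_clash hmin
    obtain ⟨t, ht⟩ := exists_eligible (e := Nat.find hex) (m := Nat.find hm) fun m' hm' => by
      simpa using Nat.find_min hm hm'
    exact ⟨.inl (Nat.find hex, Nat.find hm, t), ht,
      (follower_of_forall_not_clash (Nat.find_spec hm)).trans (Nat.find_spec hex)⟩

/-- Friedberg's enumeration theorem. -/
theorem exists_isFriedberg : ∃ γ, IsFriedberg PCF γ :=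
  exists_isFriedberg_of_primrecPred primrecPred_valid partrec_value value_injective exists_value_eq

/-- The index `n` codes the (optional) value at `0` together with an index for the remaining
values. -/
def prepend (γ : ℕ → ℕ →. ℕ) (n : ℕ) : ℕ →. ℕ := fun x =>
  bif x == 0 then (Nat.ppred n.unpair.1 : Part ℕ) else γ n.unpair.2 (x - 1)

theorem prepend_zero (γ : ℕ → ℕ →. ℕ) (n : ℕ) :
    prepend γ n 0 = (Nat.ppred n.unpair.1 : Part ℕ) := rfl

theorem prepend_succ (γ : ℕ → ℕ →. ℕ) (n x : ℕ) : prepend γ n (x + 1) = γ n.unpair.2 x := rfl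

theorem IsFriedberg.prepend {γ : ℕ → ℕ →. ℕ} (hγ : IsFriedberg PCF γ) :
    IsFriedberg PCF (prepend γ) := by
  have hppred : Primrec Nat.ppred :=
    (Primrec.nat_casesOn Primrec.id (Primrec.const none)
      (Primrec.option_some.comp Primrec.snd).to₂).of_eq fun n => by cases n <;> rfl
  have hpart : Partrec₂ (Friedberg.prepend γ) := by
    have hn : Computable fun a : ℕ × ℕ => a.1.unpair := Computable.unpair.comp Computable.fst
    exact Partrec.cond (Primrec.beq.comp Primrec.snd (Primrec.const 0)).to_comp
      (Computable.ofOption (hppred.to_comp.comp (Computable.fst.comp hn)))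
      (hγ.1.2.comp (Computable.snd.comp hn) (Computable.pred.comp Computable.snd))
  refine ⟨⟨⟨fun i => ?_, fun f hf => ?_⟩, hpart⟩, fun i j hij => ?_⟩
  · exact Partrec.nat_iff.1 (hpart.comp (Computable.const i) Computable.id)
  · obtain ⟨k, hk⟩ := hγ.1.1.2 (fun x => f (x + 1))
      (Partrec.nat_iff.1 ((Partrec.nat_iff.2 hf).comp Computable.succ))
    obtain ⟨a, ha⟩ : ∃ a, (Nat.ppred a : Part ℕ) = f 0 := by
      rcases Part.eq_none_or_eq_some (f 0) with h | ⟨y, h⟩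
      · exact ⟨0, by simp [h]⟩
      · exact ⟨y + 1, by simp [h]⟩
    refine ⟨Nat.pair a k, funext fun x => ?_⟩
    cases x with
    | zero => simp [prepend_zero, ha]
    | succ x => simp [prepend_succ, hk]
  · have h2 : i.unpair.2 = j.unpair.2 := hγ.2 (funext fun x => congrFun hij (x + 1))
    have h0 := congrFun hij 0
    have h1 : i.unpair.1 = j.unpair.1 := by
      rw [prepend_zero, prepend_zero] at h0
      generalize i.unpair.1 = k at h0 ⊢
      generalize j.unpair.1 = l at h0 ⊢
      rcases k with - | a <;> rcases l with - | b
      · rfl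
      · exact absurd h0.symm (Part.some_ne_none b)
      · exact absurd h0 (Part.some_ne_none a)
      · rw [Part.some_injective h0]
    rw [← Nat.pair_unpair i, ← Nat.pair_unpair j, h1, h2]

/-- If `γ` reduced to `prepend γ`, then the domains of the functions `γ i` would be uniformly
decidable. -/
theorem not_reducible_prepend {γ : ℕ → ℕ →. ℕ} (hγ : IsNumbering PCF γ) :
    ¬ Reducible γ (prepend γ) := by
  rintro ⟨f, hf, h⟩
  have hshift : ∀ x n, γ n x = γ ((fun i => (f i).unpair.2)^[x] n) 0 := by
    intro x
    induction x with
    | zero => exact fun n => rfl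
    | succ x ih =>
      intro n
      rw [Function.iterate_succ_apply, ← ih, congrFun (h n) (x + 1), prepend_succ]
  have hg : Computable fun i => (f i).unpair.2 := Computable.snd.comp (Computable.unpair.comp hf)
  have hiter : Computable fun n => (fun i => (f i).unpair.2)^[n] n := by
    refine (Computable.nat_rec (f := id) (g := id) (h := fun _ p => (f p.2).unpair.2)
      Computable.id Computable.id
      (hg.comp (Computable.snd.comp Computable.snd))).of_eq fun n => ?_
    suffices ∀ k, Nat.rec (motive := fun _ => ℕ) n (fun _ i => (f i).unpair.2) k =
        (fun i => (f i).unpair.2)^[k] n from this n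
    intro k
    induction k with
    | zero => rfl
    | succ k ih => rw [Function.iterate_succ_apply', ← ih]
  have hdiag : Partrec fun n =>
      bif (f ((fun i => (f i).unpair.2)^[n] n)).unpair.1 == 0 then Part.some 0 else Part.none :=
    Partrec.cond (Primrec.beq.to_comp.comp
      (Computable.fst.comp (Computable.unpair.comp (hf.comp hiter))) (Computable.const 0))
      (Computable.const 0).partrec Partrec.none
  obtain ⟨k, hk⟩ := hγ.2 _ (Partrec.nat_iff.1 hdiag)
  have hkk := congrFun hk k
  rw [hshift, congrFun (h _) 0, prepend_zero] at hkk
  rcases hv : (f ((fun i => (f i).unpair.2)^[k] k)).unpair.1 with - | a <;> rw [hv] at hkk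
  · exact Part.some_ne_none 0 hkk.symm
  · exact Part.some_ne_none a hkk

/-- Reducibility between Friedberg numberings is symmetric. -/
theorem Reducible.symm {ν μ : ℕ → ℕ →. ℕ} (hν : IsNumbering PCF ν) (hμ : IsFriedberg PCF μ)
    (h : Reducible ν μ) : Reducible μ ν := by
  obtain ⟨f, hf, h⟩ := h
  have hsurj : ∀ n, ∃ k, f k = n := fun n => by
    obtain ⟨k, hk⟩ := hν.2 (μ n) (hμ.1.1.1 n)
    exact ⟨k, hμ.2 (by rw [← h, hk])⟩
  have hP : Computable fun a : ℕ × ℕ => decide (f a.2 = a.1) :=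
    Primrec.eq.decide.to_comp.comp (hf.comp Computable.snd) Computable.fst
  exact ⟨fun n => Nat.find (hsurj n), Computable.find hP.computablePred hsurj, fun n => by
    rw [h, Nat.find_spec (hsurj n)]⟩

end Friedberg

/-- Pour-El: there are two incomparable Friedberg numberings of 𝒫⁽¹⁾. -/
theorem two_incomparable_friedberg_numberings :
    ∃ ν μ : ℕ → ℕ →. ℕ, IsFriedberg PCF ν ∧ IsFriedberg PCF μ ∧
      ¬ Reducible ν μ ∧ ¬ Reducible μ ν := by
  obtain ⟨γ, hγ⟩ := Friedberg.exists_isFriedberg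
  have hγ' := Friedberg.IsFriedberg.prepend hγ
  have hnot := Friedberg.not_reducible_prepend hγ.1.1
  exact ⟨γ, Friedberg.prepend γ, hγ, hγ', hnot,
    fun h => hnot (Friedberg.Reducible.symm hγ'.1.1 hγ h)⟩
end

section
/- (Kummer's Extension Lemma) Let 𝒜 and ℬ be disjoint subsets of 𝒫⁽¹⁾. If 𝒜 has a computable numbering, ℬ has a Friedberg numbering, and every finite subfunction of a member of 𝒜 has infinitely many extensions in ℬ, then 𝒜 ∪ ℬ has a Friedberg numbering. -/
/-- A primitive recursive, monotone family of finite approximations to the functions `α i`. -/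
structure IsStageApprox (a : ℕ → ℕ → ℕ → Option ℕ) (α : ℕ → ℕ →. ℕ) : Prop where
  primrec : Primrec fun p : ℕ × ℕ × ℕ => a p.1 p.2.1 p.2.2
  mono : ∀ {s t i x y}, s ≤ t → a s i x = some y → a t i x = some y
  bound : ∀ {s i x y}, a s i x = some y → x < s
  mem_iff : ∀ {i x y}, y ∈ α i x ↔ ∃ s, a s i x = some y

theorem exists_isStageApprox {α : ℕ → ℕ →. ℕ} (hα : Partrec₂ α) :
    ∃ a, IsStageApprox a α := by
  obtain ⟨c, hc⟩ := Nat.Partrec.Code.exists_code.1 (Partrec₂.unpaired'.2 hα)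
  refine ⟨fun s i x => c.evaln s (Nat.pair i x), ?_, ?_, ?_, ?_⟩
  · exact Nat.Partrec.Code.primrec_evaln.comp
      ((Primrec.fst.pair (Primrec.const c)).pair
        (Primrec₂.natPair.comp (Primrec.fst.comp Primrec.snd) (Primrec.snd.comp Primrec.snd)))
  · intro s t i x y hst h
    exact Nat.Partrec.Code.evaln_mono hst h
  · intro s i x y h
    exact (Nat.right_le_pair i x).trans_lt (Nat.Partrec.Code.evaln_bound h)
  · intro i x y
    have := @Nat.Partrec.Code.evaln_complete c (Nat.pair i x) y
    rw [hc] at this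
    simpa using this

/-- The approximations to `α i` and `α j` at stage `n` are both confirmed by stage `u`
of the other function. -/
def Agree (a : ℕ → ℕ → ℕ → Option ℕ) (i j n u : ℕ) : Prop :=
  ∀ x < n, (a n i x = none ∨ a u j x = a n i x) ∧ (a n j x = none ∨ a u i x = a n j x)

/-- Stage `t` is a reset stage for index `i`: either `t = 0`, or `t` codes `(n, u)` where `u` is the
first stage confirming agreement up to `n` of `α i` with some `α j`, `j < i`. -/
def Reset (a : ℕ → ℕ → ℕ → Option ℕ) (i t : ℕ) : Prop :=
  t = 0 ∨ ∃ j < i, Agree a i j t.unpair.1 t.unpair.2 ∧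
    ∀ u < t.unpair.2, ¬ Agree a i j t.unpair.1 u

/-- Stage `u` releases the position `(i, t)`. -/
def Releases (a : ℕ → ℕ → ℕ → Option ℕ) (i t u : ℕ) : Prop :=
  (Reset a i t ∧ t < u ∧ Reset a i u) ∨ (¬ Reset a i t ∧ u = t)

section Computability

open Primrec

variable {a b : ℕ → ℕ → ℕ → Option ℕ}

theorem primrecPred_forall_lt {τ : Type} [Primcodable τ] {R : ℕ → τ → Prop} (hR : PrimrecRel R)
    {n : τ → ℕ} (hn : Primrec n) : PrimrecPred fun p => ∀ x < n p, R x p :=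
  (hR.forall_mem_list.comp (list_range.comp hn) Primrec.id).of_eq (by simp)

theorem primrecPred_exists_lt {τ : Type} [Primcodable τ] {R : ℕ → τ → Prop} (hR : PrimrecRel R)
    {n : τ → ℕ} (hn : Primrec n) : PrimrecPred fun p => ∃ x < n p, R x p :=
  (hR.exists_mem_list.comp (list_range.comp hn) Primrec.id).of_eq (by simp)

theorem primrecPred_confirms {τ : Type} [Primcodable τ]
    (ha : Primrec fun p : ℕ × ℕ × ℕ => a p.1 p.2.1 p.2.2)
    (hb : Primrec fun p : ℕ × ℕ × ℕ => b p.1 p.2.1 p.2.2)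
    {n i u j x : τ → ℕ} (hn : Primrec n) (hi : Primrec i) (hu : Primrec u) (hj : Primrec j)
    (hx : Primrec x) :
    PrimrecPred fun p => a (n p) (i p) (x p) = none ∨ b (u p) (j p) (x p) = a (n p) (i p) (x p) :=
  have h₁ : Primrec fun p => a (n p) (i p) (x p) := ha.comp (hn.pair (hi.pair hx))
  have h₂ : Primrec fun p => b (u p) (j p) (x p) := hb.comp (hu.pair (hj.pair hx))
  (Primrec.eq.comp h₁ (.const none)).or (Primrec.eq.comp h₂ h₁)

theorem primrecPred_agree {τ : Type} [Primcodable τ]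
    (ha : Primrec fun p : ℕ × ℕ × ℕ => a p.1 p.2.1 p.2.2)
    {i j n u : τ → ℕ} (hi : Primrec i) (hj : Primrec j) (hn : Primrec n) (hu : Primrec u) :
    PrimrecPred fun p => Agree a (i p) (j p) (n p) (u p) := by
  have key : PrimrecRel fun (x : ℕ) (p : τ) =>
      (a (n p) (i p) x = none ∨ a (u p) (j p) x = a (n p) (i p) x) ∧
        (a (n p) (j p) x = none ∨ a (u p) (i p) x = a (n p) (j p) x) :=
    (primrecPred_confirms ha ha (hn.comp snd) (hi.comp snd) (hu.comp snd) (hj.comp snd) fst).and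
      (primrecPred_confirms ha ha (hn.comp snd) (hj.comp snd) (hu.comp snd) (hi.comp snd) fst)
  exact primrecPred_forall_lt key hn

theorem primrecPred_reset {τ : Type} [Primcodable τ]
    (ha : Primrec fun p : ℕ × ℕ × ℕ => a p.1 p.2.1 p.2.2)
    {i t : τ → ℕ} (hi : Primrec i) (ht : Primrec t) :
    PrimrecPred fun p => Reset a (i p) (t p) := by
  have ht₁ : Primrec fun p => (t p).unpair.1 := fst.comp (Primrec.unpair.comp ht)
  have ht₂ : Primrec fun p => (t p).unpair.2 := snd.comp (Primrec.unpair.comp ht)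
  have hno : PrimrecRel fun (u : ℕ) (q : ℕ × τ) => ¬ Agree a (i q.2) q.1 (t q.2).unpair.1 u :=
    (primrecPred_agree ha (hi.comp (snd.comp snd)) (fst.comp snd) (ht₁.comp (snd.comp snd))
      fst).not
  have key : PrimrecRel fun (j : ℕ) (p : τ) => Agree a (i p) j (t p).unpair.1 (t p).unpair.2 ∧
      ∀ u < (t p).unpair.2, ¬ Agree a (i p) j (t p).unpair.1 u :=
    (primrecPred_agree ha (hi.comp snd) fst (ht₁.comp snd) (ht₂.comp snd)).and
      (primrecPred_forall_lt hno (ht₂.comp snd))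
  exact (Primrec.eq.comp ht (.const 0)).or (primrecPred_exists_lt key hi)

theorem primrecPred_releases {τ : Type} [Primcodable τ]
    (ha : Primrec fun p : ℕ × ℕ × ℕ => a p.1 p.2.1 p.2.2)
    {i t u : τ → ℕ} (hi : Primrec i) (ht : Primrec t) (hu : Primrec u) :
    PrimrecPred fun p => Releases a (i p) (t p) (u p) :=
  ((primrecPred_reset ha hi ht).and ((nat_lt.comp ht hu).and (primrecPred_reset ha hi hu))).or
    ((primrecPred_reset ha hi ht).not.and (Primrec.eq.comp hu ht))

open Classical in
theorem exists_computable_least {τ : Type} [Primcodable τ] {p : τ → ℕ → Prop}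
    (hp : PrimrecRel p) (h : ∀ x, ∃ n, p x n) :
    ∃ f : τ → ℕ, Computable f ∧ ∀ x, p x (f x) ∧ ∀ m, p x m → f x ≤ m := by
  refine ⟨fun x => Nat.find (h x), ?_, fun x => ⟨Nat.find_spec (h x), fun m => Nat.find_min' _⟩⟩
  have hd : Computable₂ fun x n => decide (p x n) := hp.decide.to_comp
  refine (Partrec.rfind hd.partrec₂).of_eq fun x => ?_
  refine Part.eq_some_iff.2 (Nat.mem_rfind.2 ⟨?_, ?_⟩)
  · simpa using Nat.find_spec (h x)
  · intro m hm
    simpa using Nat.find_min (h x) hm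

/-- Greedy assignment of distinct values: stage `q` takes the first unused value `n.unpair.1` such
that `p q n`. -/
theorem exists_greedy_bijection {p : ℕ → ℕ → Prop} (hp : PrimrecRel p)
    (hex : ∀ (L : List ℕ) q, ∃ n, n.unpair.1 ∉ L ∧ p q n)
    (hinf : {q | ∀ n, p q n}.Infinite) :
    ∃ g : ℕ → ℕ, Computable g ∧ Function.Bijective g ∧ ∀ q, ∃ w, p q (Nat.pair (g q) w) := by
  have hmem : PrimrecRel fun (L : List ℕ) (n : ℕ) => ∃ k ∈ L, k = n.unpair.1 :=
    PrimrecRel.exists_mem_list (R := fun k (n : ℕ) => k = n.unpair.1)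
      (Primrec.eq.comp fst (fst.comp (Primrec.unpair.comp snd)))
  have hP : PrimrecRel fun (s : List ℕ × ℕ) (n : ℕ) => n.unpair.1 ∉ s.1 ∧ p s.2 n :=
    (((hmem.comp (fst.comp fst) snd).not).and (hp.comp (snd.comp fst) snd)).of_eq fun s => by simp
  obtain ⟨f, hf, hfs⟩ := exists_computable_least hP fun s => hex s.1 s.2
  let L : ℕ → List ℕ := fun q => Nat.rec [] (fun q l => (f (l, q)).unpair.1 :: l) q
  have hstep : Computable₂ fun (l : List ℕ) (q : ℕ) => (f (l, q)).unpair.1 :=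
    Computable.fst.comp (Computable.unpair.comp hf)
  have hL : Computable L :=
    Computable.nat_rec Computable.id (Computable.const [])
      (Computable.list_cons.comp
        (hstep.comp (Computable.snd.comp Computable.snd) (Computable.fst.comp Computable.snd))
        (Computable.snd.comp Computable.snd)).to₂
  let g : ℕ → ℕ := fun q => (f (L q, q)).unpair.1
  have hLs : ∀ q, L (q + 1) = g q :: L q := fun q => rfl
  have hLmem : ∀ q k, k ∈ L q ↔ ∃ r < q, g r = k := by
    intro q k
    induction q with
    | zero => simp [L]
    | succ q ih =>
      rw [hLs, List.mem_cons, ih]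
      simp only [Nat.lt_succ_iff_lt_or_eq]
      grind
  have hnew : ∀ q r, r < q → g r ≠ g q := by
    intro q r hr h
    exact (hfs (L q, q)).1.1 ((hLmem q _).2 ⟨r, hr, h⟩)
  have hinj : Function.Injective g := by
    intro q r h
    by_contra hne
    rcases Nat.lt_or_gt_of_ne hne with hlt | hlt
    · exact hnew _ _ hlt h
    · exact hnew _ _ hlt h.symm
  refine ⟨g, hstep.comp hL Computable.id, ⟨hinj, fun j => ?_⟩, fun q => ?_⟩
  · by_contra hj
    push Not at hj
    refine hinf ((Set.Finite.preimage hinj.injOn (Set.finite_Iic (Nat.pair j 0))).subset ?_)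
    intro q hq
    refine (Nat.unpair_left_le _).trans ((hfs (L q, q)).2 _ ⟨?_, hq _⟩)
    simpa [hLmem] using fun r _ => hj r
  · exact ⟨(f (L q, q)).unpair.2, by simpa [g] using (hfs (L q, q)).1.2⟩

end Computability

section Approximation

variable {a : ℕ → ℕ → ℕ → Option ℕ} {α : ℕ → ℕ →. ℕ} {i j t u n : ℕ}

namespace IsStageApprox

theorem eventually_confirms (ha : IsStageApprox a α) {o : ℕ → Option ℕ} (n : ℕ)
    (h : ∀ x y, o x = some y → y ∈ α j x) :
    ∃ w, ∀ u ≥ w, ∀ x < n, o x = none ∨ a u j x = o x := by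
  induction n with
  | zero => exact ⟨0, by simp⟩
  | succ n ih =>
    obtain ⟨w, hw⟩ := ih
    rcases ho : o n with _ | y
    · refine ⟨w, fun u hu x hx => ?_⟩
      rcases Nat.lt_succ_iff_lt_or_eq.1 hx with hx | rfl
      · exact hw u hu x hx
      · exact Or.inl ho
    · obtain ⟨s, hs⟩ := ha.mem_iff.1 (h n y ho)
      refine ⟨max w s, fun u hu x hx => ?_⟩
      rcases Nat.lt_succ_iff_lt_or_eq.1 hx with hx | rfl
      · exact hw u ((le_max_left _ _).trans hu) x hx
      · exact Or.inr ((ha.mono ((le_max_right _ _).trans hu) hs).trans ho.symm)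

theorem agree_anti (ha : IsStageApprox a α) {m : ℕ} (hmn : m ≤ n) (h : Agree a i j n u) :
    Agree a i j m u := by
  intro x hx
  have := h x (hx.trans_le hmn)
  constructor
  · rcases hm : a m i x with _ | y
    · simp
    · simpa [ha.mono hmn hm] using this.1
  · rcases hm : a m j x with _ | y
    · simp
    · simpa [ha.mono hmn hm] using this.2

theorem exists_agree (ha : IsStageApprox a α) (h : α i = α j) (n : ℕ) :
    ∃ u, Agree a i j n u := by
  obtain ⟨v, hv⟩ := ha.eventually_confirms (j := j) (o := a n i) n fun x y hy =>
    h ▸ ha.mem_iff.2 ⟨n, hy⟩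
  obtain ⟨w, hw⟩ := ha.eventually_confirms (j := i) (o := a n j) n fun x y hy =>
    h ▸ ha.mem_iff.2 ⟨n, hy⟩
  exact ⟨max v w, fun x hx => ⟨hv _ (le_max_left _ _) x hx, hw _ (le_max_right _ _) x hx⟩⟩

theorem eq_of_agree (ha : IsStageApprox a α) (h : ∀ n, ∃ u, Agree a i j n u) : α i = α j := by
  funext x
  refine Part.ext fun y => ⟨fun hy => ?_, fun hy => ?_⟩
  all_goals
    obtain ⟨s, hs⟩ := ha.mem_iff.1 hy
    obtain ⟨u, hu⟩ := h s
    have := hu x (ha.bound hs)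
    rw [hs] at this
    refine ha.mem_iff.2 ⟨u, ?_⟩
    simp_all

theorem infinite_reset (ha : IsStageApprox a α) (hj : j < i) (h : α i = α j) :
    {t | Reset a i t}.Infinite := by
  classical
  refine Set.infinite_of_injective_forall_mem
    (f := fun n => Nat.pair n (Nat.find (ha.exists_agree h n))) ?_ ?_
  · intro m n hmn
    exact (Nat.pair_eq_pair.1 hmn).1
  · intro n
    refine Or.inr ⟨j, hj, ?_⟩
    simp only [Nat.unpair_pair]
    exact ⟨Nat.find_spec (ha.exists_agree h n), fun u hu => Nat.find_min (ha.exists_agree h n) hu⟩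

theorem finite_reset (ha : IsStageApprox a α) (h : ∀ j < i, α i ≠ α j) :
    {t | Reset a i t}.Finite := by
  let S : ℕ → Set ℕ := fun j => {t | Agree a i j t.unpair.1 t.unpair.2 ∧
    ∀ u < t.unpair.2, ¬ Agree a i j t.unpair.1 u}
  have hS : ∀ j < i, (S j).Finite := by
    intro j hj
    obtain ⟨n, hn⟩ : ∃ n, ∀ u, ¬ Agree a i j n u := by
      by_contra! hc
      exact h j hj (ha.eq_of_agree hc)
    refine Set.Finite.of_finite_image (f := fun t => t.unpair.1)
      ((Set.finite_Iio n).subset ?_) ?_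
    · rintro _ ⟨t, ht, rfl⟩
      by_contra hle
      exact hn _ (ha.agree_anti (not_lt.1 hle) ht.1)
    · intro s hs t ht hst
      have hst : s.unpair.1 = t.unpair.1 := hst
      have h₁ := hs.2 t.unpair.2
      have h₂ := ht.2 s.unpair.2
      have hs1 := hs.1
      have ht1 := ht.1
      rw [hst] at h₁ hs1
      have : s.unpair.2 = t.unpair.2 := by
        by_contra hne
        rcases Nat.lt_or_gt_of_ne hne with hlt | hlt
        · exact h₂ hlt hs1
        · exact h₁ hlt ht1
      rw [← Nat.pair_unpair s, ← Nat.pair_unpair t, hst, this]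
  refine ((Set.finite_singleton 0).union ((Set.finite_Iio i).biUnion hS)).subset ?_
  rintro t (rfl | ⟨j, hj, ht⟩)
  · exact Or.inl rfl
  · exact Or.inr (Set.mem_biUnion (Set.mem_Iio.2 hj) ht)

end IsStageApprox

theorem Releases.pos (h : Releases a i t u) : 0 < u := by
  rcases h with ⟨_, h, _⟩ | ⟨h, rfl⟩
  · omega
  · exact Nat.pos_of_ne_zero fun h0 => h (Or.inl h0)

theorem eq_of_isLeast_releases {s : ℕ} (hs : IsLeast {v | Releases a i s v} u)
    (ht : IsLeast {v | Releases a i t v} u) : s = t := by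
  rcases hs with ⟨⟨hs, hsu, hu⟩ | ⟨hs, rfl⟩, hmin⟩
  · rcases ht with ⟨⟨ht, htu, -⟩ | ⟨ht, rfl⟩, hmin'⟩
    · by_contra hne
      rcases Nat.lt_or_gt_of_ne hne with hlt | hlt
      · exact htu.not_ge (hmin (Or.inl ⟨hs, hlt, ht⟩))
      · exact hsu.not_ge (hmin' (Or.inl ⟨ht, hlt, hs⟩))
    · exact absurd hu ht
  · rcases ht with ⟨⟨ht, htu, hu⟩ | ⟨ht, rfl⟩, hmin'⟩
    · exact absurd hu hs
    · rfl

theorem exists_isLeast_releases (hu : 0 < u) : ∃ t, IsLeast {v | Releases a i t v} u := by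
  by_cases hr : Reset a i u
  · obtain ⟨t, ⟨htu, ht⟩, hmax⟩ := Set.Finite.exists_maximal
      ((Set.finite_Iio u).subset fun t (ht : t < u ∧ Reset a i t) => ht.1) ⟨0, hu, Or.inl rfl⟩
    refine ⟨t, Or.inl ⟨ht, htu, hr⟩, ?_⟩
    rintro v (⟨-, htv, hv⟩ | ⟨hn, -⟩)
    · by_contra hvu
      exact htv.not_ge (hmax ⟨not_le.1 hvu, hv⟩ htv.le)
    · exact absurd ht hn
  · refine ⟨u, Or.inr ⟨hr, rfl⟩, ?_⟩
    rintro v (⟨h, -⟩ | ⟨-, rfl⟩)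
    · exact absurd h hr
    · exact le_rfl

theorem reset_of_forall_not_releases (h : ∀ u, ¬ Releases a i t u) : Reset a i t := by
  by_contra hn
  exact h t (Or.inr ⟨hn, rfl⟩)

theorem finite_reset_of_forall_not_releases (h : ∀ u, ¬ Releases a i t u) :
    {v | Reset a i v}.Finite := by
  refine (Set.finite_Iic t).subset fun v hv => ?_
  by_contra hvt
  exact h v (Or.inl ⟨reset_of_forall_not_releases h, not_le.1 hvt, hv⟩)

theorem eq_of_forall_not_releases {s : ℕ} (hs : ∀ u, ¬ Releases a i s u)
    (ht : ∀ u, ¬ Releases a i t u) : s = t := by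
  have hs' := reset_of_forall_not_releases hs
  have ht' := reset_of_forall_not_releases ht
  by_contra hne
  rcases Nat.lt_or_gt_of_ne hne with hlt | hlt
  · exact hs t (Or.inl ⟨hs', hlt, ht'⟩)
  · exact ht s (Or.inl ⟨ht', hlt, hs'⟩)

theorem exists_forall_not_releases (h : {v | Reset a i v}.Finite) :
    ∃ t, ∀ u, ¬ Releases a i t u := by
  obtain ⟨t, ht, hmax⟩ := h.exists_maximal ⟨0, Or.inl rfl⟩
  refine ⟨t, ?_⟩
  rintro u (⟨-, htu, hu⟩ | ⟨hn, -⟩)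
  · exact htu.not_ge (hmax hu htu.le)
  · exact hn ht

theorem exists_isLeast_of_releases (h : Releases a i t u) :
    ∃ v, IsLeast {w | Releases a i t w} v := by
  classical
  exact ⟨Nat.find ⟨u, h⟩, Nat.find_spec (⟨u, h⟩ : ∃ w, Releases a i t w),
    fun _ hw => Nat.find_min' _ hw⟩

/-- Position `(i, t)` follows `α i` while it has not been released, and `β (g (i, u - 1))` once it
has been released at stage `u`. -/
theorem exists_switching {β : ℕ → ℕ →. ℕ} (ha : IsStageApprox a α) (hβ : Partrec₂ β)
    {g : ℕ → ℕ} (hg : Computable g)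
    (hext : ∀ i v, Reset a i (v + 1) → ∀ x y, a (v + 1) i x = some y →
      y ∈ β (g (Nat.pair i v)) x) :
    ∃ ν : ℕ × ℕ → ℕ →. ℕ, Partrec₂ ν ∧
      (∀ i t u, IsLeast {v | Releases a i t v} u → ν (i, t) = β (g (Nat.pair i (u - 1)))) ∧
      ∀ i t, (∀ u, ¬ Releases a i t u) → ν (i, t) = α i := by
  classical
  let T : (ℕ × ℕ) × ℕ → ℕ → Prop := fun p u =>
    Releases a p.1.1 p.1.2 u ∨ (Reset a p.1.1 p.1.2 ∧ a u p.1.1 p.2 ≠ none)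
  let R : (ℕ × ℕ) × ℕ → ℕ → Prop := fun p u => Releases a p.1.1 p.1.2 u
  have h11 : Primrec fun q : ((ℕ × ℕ) × ℕ) × ℕ => q.1.1.1 :=
    Primrec.fst.comp (Primrec.fst.comp Primrec.fst)
  have h12 : Primrec fun q : ((ℕ × ℕ) × ℕ) × ℕ => q.1.1.2 :=
    Primrec.snd.comp (Primrec.fst.comp Primrec.fst)
  have hx : Primrec fun q : ((ℕ × ℕ) × ℕ) × ℕ => q.1.2 := Primrec.snd.comp Primrec.fst
  have hav : Primrec fun q : ((ℕ × ℕ) × ℕ) × ℕ => a q.2 q.1.1.1 q.1.2 :=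
    ha.primrec.comp (Primrec.snd.pair (h11.pair hx))
  have hR : PrimrecRel R := primrecPred_releases ha.primrec h11 h12 Primrec.snd
  have hT : PrimrecRel T :=
    hR.or ((primrecPred_reset ha.primrec h11 h12).and (Primrec.eq.comp hav (.const none)).not)
  let F : (ℕ × ℕ) × ℕ → ℕ → Part ℕ := fun p u =>
    bif decide (R p u) then β (g (Nat.pair p.1.1 (u - 1))) p.2 else (a u p.1.1 p.2 : Part ℕ)
  have hF : Partrec₂ F := by
    refine Partrec.cond hR.decide.to_comp ?_ hav.to_comp.ofOption
    exact hβ.comp (hg.comp (Primrec₂.natPair.to_comp.comp h11.to_comp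
      (Primrec.pred.to_comp.comp Computable.snd))) hx.to_comp
  have hTc : Computable₂ fun p u => decide (T p u) := hT.decide.to_comp
  have hν : Partrec fun p => (Nat.rfind fun u => Part.some (decide (T p u))).bind (F p) :=
    (Partrec.rfind hTc.partrec₂).bind hF
  have hval : ∀ p r, IsLeast {u | T p u} r →
      (Nat.rfind fun u => Part.some (decide (T p u))).bind (F p) = F p r := by
    intro p r hr
    have : Nat.rfind (fun u => Part.some (decide (T p u))) = Part.some r := by
      refine Part.eq_some_iff.2 (Nat.mem_rfind.2 ⟨by simpa using hr.1, fun {m} hm => ?_⟩)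
      simpa using fun h => hm.not_ge (hr.2 h)
    rw [this, Part.bind_some]
  have hleast : ∀ p u, T p u → ∃ r, IsLeast {u | T p u} r := fun p u h =>
    ⟨Nat.find ⟨u, h⟩, Nat.find_spec (⟨u, h⟩ : ∃ u, T p u), fun _ hw => Nat.find_min' _ hw⟩
  refine ⟨fun q x => (Nat.rfind fun u => Part.some (decide (T (q, x) u))).bind (F (q, x)),
    hν, ?_, ?_⟩
  · intro i t u hu
    funext x
    obtain ⟨r, hr⟩ := hleast ((i, t), x) u (Or.inl hu.1)
    simp only [hval _ r hr]
    by_cases hRr : R ((i, t), x) r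
    · have hru : r = u := le_antisymm (hr.2 (Or.inl hu.1)) (hu.2 hRr)
      subst hru
      simp [F, hRr]
    · have hru : r < u := lt_of_le_of_ne (hr.2 (Or.inl hu.1)) fun h => hRr (h ▸ hu.1)
      obtain ⟨hrt, har⟩ := hr.1.resolve_left hRr
      obtain ⟨y, hy⟩ := Option.ne_none_iff_exists'.1 har
      have hures : Reset a i (u - 1 + 1) := by
        rw [Nat.sub_add_cancel hu.1.pos]
        rcases hu.1 with ⟨-, -, h⟩ | ⟨h, -⟩
        · exact h
        · exact absurd hrt h
      have hmem := hext i (u - 1) hures x y (ha.mono (by omega) hy)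
      rw [Part.eq_some_iff.2 hmem]
      simp only at hy
      simp [F, hRr, hy]
  · intro i t h
    have hrt := reset_of_forall_not_releases h
    funext x
    by_cases hex : ∃ u, T ((i, t), x) u
    · obtain ⟨u, hu⟩ := hex
      obtain ⟨r, hr⟩ := hleast _ u hu
      simp only [hval _ r hr]
      obtain ⟨-, har⟩ := hr.1.resolve_left (h r)
      obtain ⟨y, hy⟩ := Option.ne_none_iff_exists'.1 har
      simp only at hy
      have hRr : ¬ R ((i, t), x) r := h r
      rw [Part.eq_some_iff.2 (ha.mem_iff.2 ⟨r, hy⟩)]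
      simp [F, hRr, hy]
    · have h1 : α i x = Part.none := Part.eq_none_iff.2 fun y hy => by
        obtain ⟨s, hs⟩ := ha.mem_iff.1 hy
        exact hex ⟨s, Or.inr ⟨hrt, by simp [hs]⟩⟩
      rw [h1]
      refine Part.eq_none_iff.2 fun y hy => ?_
      obtain ⟨r, hr, -⟩ := Part.mem_bind_iff.1 hy
      exact hex ⟨r, by simpa using (Nat.mem_rfind.1 hr).1⟩

end Approximation

/-- Every reset stage can hand the finite piece built so far over to an unused member of `B`. -/
theorem exists_assignment {A B : Set (ℕ →. ℕ)} {α β : ℕ → ℕ →. ℕ} {a : ℕ → ℕ → ℕ → Option ℕ}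
    (hα : IsNumbering A α) (hβ : IsFriedberg B β) (ha : IsStageApprox a α)
    (hext : ∀ f ∈ A, ∀ g : ℕ →. ℕ, FinSubfn g f → {h | h ∈ B ∧ Subfn g h}.Infinite) :
    ∃ g : ℕ → ℕ, Computable g ∧ Function.Bijective g ∧
      ∀ i v, Reset a i (v + 1) → ∀ x y, a (v + 1) i x = some y →
        y ∈ β (g (Nat.pair i v)) x := by
  obtain ⟨b, hb⟩ := exists_isStageApprox hβ.1.2
  let P : ℕ → ℕ → Prop := fun q n => ¬ Reset a q.unpair.1 (q.unpair.2 + 1) ∨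
    ∀ x < q.unpair.2 + 1, a (q.unpair.2 + 1) q.unpair.1 x = none ∨
      b n.unpair.2 n.unpair.1 x = a (q.unpair.2 + 1) q.unpair.1 x
  have hq₁ : Primrec fun s : ℕ × ℕ => s.1.unpair.1 :=
    Primrec.fst.comp (Primrec.unpair.comp Primrec.fst)
  have hq₂ : Primrec fun s : ℕ × ℕ => s.1.unpair.2 + 1 :=
    Primrec.succ.comp (Primrec.snd.comp (Primrec.unpair.comp Primrec.fst))
  have hn : Primrec fun s : ℕ × ℕ => s.2.unpair := Primrec.unpair.comp Primrec.snd
  have hP : PrimrecRel P := by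
    refine (primrecPred_reset ha.primrec hq₁ hq₂).not.or ?_
    have key : PrimrecRel fun (x : ℕ) (s : ℕ × ℕ) =>
        a (s.1.unpair.2 + 1) s.1.unpair.1 x = none ∨
          b s.2.unpair.2 s.2.unpair.1 x = a (s.1.unpair.2 + 1) s.1.unpair.1 x :=
      primrecPred_confirms ha.primrec hb.primrec (hq₂.comp Primrec.snd) (hq₁.comp Primrec.snd)
        ((Primrec.snd.comp hn).comp Primrec.snd) ((Primrec.fst.comp hn).comp Primrec.snd)
        Primrec.fst
    exact primrecPred_forall_lt key hq₂
  have hex : ∀ (L : List ℕ) q, ∃ n, n.unpair.1 ∉ L ∧ P q n := by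
    intro L q
    have hfin : FinSubfn (fun x => (a (q.unpair.2 + 1) q.unpair.1 x : Part ℕ))
        (α q.unpair.1) := by
      refine ⟨(Set.finite_Iio (q.unpair.2 + 1)).subset fun x hx => ?_, fun x y hy => ?_⟩
      · obtain ⟨y, hy⟩ := Part.dom_iff_mem.1 hx
        exact ha.bound (Part.mem_ofOption.1 hy)
      · exact ha.mem_iff.2 ⟨_, Part.mem_ofOption.1 hy⟩
    obtain ⟨h, ⟨hB, hsub⟩, hL⟩ :=
      (hext _ (hα.1 q.unpair.1) _ hfin).exists_notMem_finite (L.toFinset.finite_toSet.image β)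
    obtain ⟨j, rfl⟩ := hβ.1.1.2 h hB
    obtain ⟨w, hw⟩ := hb.eventually_confirms (j := j) (o := a (q.unpair.2 + 1) q.unpair.1)
      (q.unpair.2 + 1) fun x y hy => hsub x y (Part.mem_ofOption.2 hy)
    refine ⟨Nat.pair j w, ?_, Or.inr ?_⟩
    · intro hj
      exact hL ⟨j, by simpa using hj, rfl⟩
    · simpa using hw w le_rfl
  have hinf : {q | ∀ n, P q n}.Infinite := by
    refine Set.infinite_of_injective_forall_mem (f := fun v => Nat.pair 0 v)
      (fun v w h => (Nat.pair_eq_pair.1 h).2) fun v n => Or.inl ?_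
    simp [Reset]
  obtain ⟨g, hgc, hgb, hgP⟩ := exists_greedy_bijection hP hex hinf
  refine ⟨g, hgc, hgb, fun i v hr x y hy => ?_⟩
  obtain ⟨w, hw⟩ := hgP (Nat.pair i v)
  simp only [P, Nat.unpair_pair] at hw
  have := (hw.resolve_left (not_not.2 hr)) x (ha.bound hy)
  rw [hy] at this
  exact hb.mem_iff.2 ⟨w, by simpa using this⟩

/-- Kummer's Extension Lemma. -/
theorem kummer_extension_lemma (A B : Set (ℕ →. ℕ))
    (hA : A ⊆ PCF) (hB : B ⊆ PCF) (hdisj : Disjoint A B)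
    (hAnum : ∃ ν : ℕ → ℕ →. ℕ, IsCompNumbering A ν)
    (hBnum : ∃ ν : ℕ → ℕ →. ℕ, IsFriedberg B ν)
    (hext : ∀ f ∈ A, ∀ g : ℕ →. ℕ, FinSubfn g f → {h | h ∈ B ∧ Subfn g h}.Infinite) :
    ∃ ν : ℕ → ℕ →. ℕ, IsFriedberg (A ∪ B) ν := by
  obtain ⟨α, hα, hαc⟩ := hAnum
  obtain ⟨β, hβ⟩ := hBnum
  obtain ⟨a, ha⟩ := exists_isStageApprox hαc
  obtain ⟨g, hgc, hgb, hgext⟩ := exists_assignment hα hβ ha hext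
  obtain ⟨ν, hνc, hνβ, hνα⟩ := exists_switching ha hβ.1.2 hgc hgext
  have hcases : ∀ i t, (∃ u, IsLeast {v | Releases a i t v} u) ∨ ∀ u, ¬ Releases a i t u := by
    intro i t
    by_cases h : ∃ u, Releases a i t u
    · obtain ⟨u, hu⟩ := h
      exact Or.inl (exists_isLeast_of_releases hu)
    · exact Or.inr (not_exists.1 h)
  have hmin : ∀ i t, (∀ u, ¬ Releases a i t u) → ∀ j < i, α i ≠ α j := fun i t h j hj he =>
    ha.infinite_reset hj he (finite_reset_of_forall_not_releases h)
  have hne : ∀ i j, α i ≠ β j := fun i j h =>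
    Set.disjoint_left.1 hdisj (hα.1 i) (h ▸ hβ.1.1.1 j)
  have hinj : Function.Injective ν := by
    rintro ⟨i, s⟩ ⟨j, t⟩ h
    rcases hcases i s with ⟨u, hu⟩ | hs <;> rcases hcases j t with ⟨v, hv⟩ | ht
    · rw [hνβ i s u hu, hνβ j t v hv] at h
      obtain ⟨rfl, huv⟩ := Nat.pair_eq_pair.1 (hgb.1 (hβ.2 h))
      have hu0 := hu.1.pos
      have hv0 := hv.1.pos
      obtain rfl : u = v := by omega
      rw [eq_of_isLeast_releases hu hv]
    · rw [hνβ i s u hu, hνα j t ht] at h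
      exact absurd h.symm (hne _ _)
    · rw [hνα i s hs, hνβ j t v hv] at h
      exact absurd h (hne _ _)
    · rw [hνα i s hs, hνα j t ht] at h
      obtain rfl : i = j := by
        by_contra hij
        rcases Nat.lt_or_gt_of_ne hij with hlt | hlt
        · exact hmin j t ht i hlt h.symm
        · exact hmin i s hs j hlt h
      rw [eq_of_forall_not_releases hs ht]
  refine ⟨fun p => ν p.unpair, ⟨⟨fun p => ?_, ?_⟩, ?_⟩, ?_⟩
  · rcases hcases p.unpair.1 p.unpair.2 with ⟨u, hu⟩ | h
    · exact Or.inr (Set.mem_of_eq_of_mem (hνβ _ _ u hu) (hβ.1.1.1 _))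
    · exact Or.inl (Set.mem_of_eq_of_mem (hνα _ _ h) (hα.1 _))
  · suffices ∀ f ∈ A ∪ B, ∃ i t, ν (i, t) = f by
      intro f hf
      obtain ⟨i, t, rfl⟩ := this f hf
      exact ⟨Nat.pair i t, by simp⟩
    rintro f (hf | hf)
    · classical
      have hf' := hα.2 f hf
      have hfin := ha.finite_reset (i := Nat.find hf') fun j hj h =>
        Nat.find_min hf' hj (h ▸ Nat.find_spec hf')
      obtain ⟨t, ht⟩ := exists_forall_not_releases hfin
      exact ⟨_, t, (hνα _ t ht).trans (Nat.find_spec hf')⟩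
    · obtain ⟨j, rfl⟩ := hβ.1.1.2 f hf
      obtain ⟨q, rfl⟩ := hgb.2 j
      obtain ⟨t, ht⟩ := exists_isLeast_releases (a := a) (i := q.unpair.1)
        (Nat.succ_pos q.unpair.2)
      exact ⟨_, t, by simpa using hνβ _ t _ ht⟩
  · exact hνc.comp (Computable.unpair.comp Computable.fst) Computable.snd
  · intro p q h
    have h' := hinj h
    rw [← Nat.pair_unpair p, ← Nat.pair_unpair q, h']
end

section
/- (Pour-El–Putnam) Let 𝒜 ⊆ 𝒫⁽¹⁾ have a computable numbering and let f ∈ 𝒫⁽¹⁾ have infinite domain. Then there is ℬ ⊆ 𝒫⁽¹⁾ such that: (1) 𝒜 ⊆ ℬ; (2) every member of ℬ \ 𝒜 has finite domain; (3) for every g ∈ ℬ \ 𝒜 there is h ∈ 𝒜 with g ⊆ f ∪ h; (4) ℬ has a Friedberg numbering. -/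
namespace FriedbergNumbering

section BoundedSearch

/-- Boolean bounded universal quantifier. -/
def ball (p : ℕ → Bool) (n : ℕ) : Bool := n.rec true fun k r => r && p k

/-- Boolean bounded existential quantifier. -/
def bex (p : ℕ → Bool) (n : ℕ) : Bool := n.rec false fun k r => r || p k

@[simp] theorem ball_iff {p : ℕ → Bool} {n : ℕ} : ball p n = true ↔ ∀ k < n, p k = true := by
  induction n with
  | zero => simp [ball]
  | succ n ih =>
    have : ball p (n + 1) = (ball p n && p n) := rfl
    rw [this, Bool.and_eq_true, ih, Nat.forall_lt_succ_right]

@[simp] theorem bex_iff {p : ℕ → Bool} {n : ℕ} : bex p n = true ↔ ∃ k < n, p k = true := by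
  induction n with
  | zero => simp [bex]
  | succ n ih =>
    have : bex p (n + 1) = (bex p n || p n) := rfl
    rw [this, Bool.or_eq_true, ih, Nat.exists_lt_succ_right]

variable {α : Type*} [Primcodable α]

theorem computable_ball {p : α → ℕ → Bool} {n : α → ℕ}
    (hp : Computable fun q : α × ℕ => p q.1 q.2) (hn : Computable n) :
    Computable fun a => ball (p a) (n a) :=
  Computable.nat_rec hn (Computable.const true)
    (Primrec.and.to_comp.comp (Computable.snd.comp Computable.snd)
      (hp.comp (Computable.fst.pair (Computable.fst.comp Computable.snd)))).to₂

theorem computable_bex {p : α → ℕ → Bool} {n : α → ℕ}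
    (hp : Computable fun q : α × ℕ => p q.1 q.2) (hn : Computable n) :
    Computable fun a => bex (p a) (n a) :=
  Computable.nat_rec hn (Computable.const false)
    (Primrec.or.to_comp.comp (Computable.snd.comp Computable.snd)
      (hp.comp (Computable.fst.pair (Computable.fst.comp Computable.snd)))).to₂

theorem computable_count {p : α → ℕ → Bool} {n : α → ℕ}
    (hp : Computable fun q : α × ℕ => p q.1 q.2) (hn : Computable n) :
    Computable fun a => Nat.count (fun k => p a k = true) (n a) := by
  have hq : Computable fun q : α × ℕ × ℕ => p q.1 q.2.1 :=
    hp.comp (Computable.fst.pair (Computable.fst.comp Computable.snd))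
  have hs : Computable fun q : α × ℕ × ℕ => q.2.2 := Computable.snd.comp Computable.snd
  refine (Computable.nat_rec hn (Computable.const 0)
    (Computable.cond hq (Computable.succ.comp hs) hs).to₂).of_eq fun a => ?_
  induction n a with
  | zero => simp
  | succ m ih =>
    simp only [] at ih ⊢
    rw [Nat.count_succ, ← ih]
    cases h : p a m <;> simp

theorem exists_computable_search {p : α → ℕ → Bool}
    (hp : Computable fun q : α × ℕ => p q.1 q.2) (h : ∀ a, ∃ n, p a n = true) :
    ∃ m : α → ℕ, Computable m ∧ ∀ a, p a (m a) = true := by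
  choose m hm using fun a => Nat.rfind_min' (h a).choose_spec
  have hpart : Partrec fun a => Nat.rfind fun n => (Part.some (p a n) : Part Bool) :=
    Partrec.rfind (Computable.partrec hp).to₂
  refine ⟨m, hpart.of_eq_tot fun a => (hm a).1, fun a => ?_⟩
  simpa using Nat.rfind_spec (hm a).1

end BoundedSearch

section Limits

/-- The partial function approximated by the stages `a s`. -/
def lim (a : ℕ → ℕ → Option ℕ) : ℕ →. ℕ := fun x => Nat.rfindOpt fun s => a s x

/-- The partial function given by an option-valued function. -/
def toPFun (a : ℕ → Option ℕ) : ℕ →. ℕ := fun x => (a x : Part ℕ)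

theorem toPFun_injective : Function.Injective toPFun := by
  intro a b h
  funext x
  refine Option.ext fun y => ?_
  have := congrFun h x
  simp only [toPFun] at this
  rw [← Option.mem_def, ← Option.mem_def, ← Part.mem_ofOption, this, Part.mem_ofOption]

theorem mem_toPFun {a : ℕ → Option ℕ} {x y : ℕ} : y ∈ toPFun a x ↔ a x = some y := by
  simp [toPFun]

theorem eq_toPFun_iff {a : ℕ → Option ℕ} {g : ℕ →. ℕ} :
    g = toPFun a ↔ ∀ x y, y ∈ g x ↔ a x = some y := by
  constructor
  · rintro rfl x y
    exact mem_toPFun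
  · intro h
    funext x
    ext y
    rw [h, mem_toPFun]

/-- The stages are increasing. -/
def Mono (a : ℕ → ℕ → Option ℕ) : Prop := ∀ s x y, a s x = some y → a (s + 1) x = some y

theorem Mono.le {a : ℕ → ℕ → Option ℕ} (h : Mono a) {s t x y : ℕ} (hst : s ≤ t)
    (hy : a s x = some y) : a t x = some y := by
  induction hst with
  | refl => exact hy
  | step _ ih => exact h _ _ _ ih

theorem Mono.mem_lim {a : ℕ → ℕ → Option ℕ} (h : Mono a) {x y : ℕ} :
    y ∈ lim a x ↔ ∃ s, a s x = some y :=
  Nat.rfindOpt_mono fun hmn hy => h.le hmn hy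

theorem mem_lim_of_functional {a : ℕ → ℕ → Option ℕ} {x : ℕ}
    (h : ∀ s t y z, a s x = some y → a t x = some z → y = z) {y : ℕ} :
    y ∈ lim a x ↔ ∃ s, a s x = some y := by
  refine ⟨Nat.rfindOpt_spec, fun ⟨s, hs⟩ => ?_⟩
  have hd : (lim a x).Dom := Nat.rfindOpt_dom.2 ⟨s, y, hs⟩
  obtain ⟨t, ht⟩ := Nat.rfindOpt_spec (Part.get_mem hd)
  rw [h s t _ _ hs ht]
  exact Part.get_mem hd

theorem Mono.eventually_eq {a : ℕ → ℕ → Option ℕ} (h : Mono a) (x : ℕ) :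
    ∀ᶠ s in Filter.atTop, (a s x : Part ℕ) = lim a x := by
  by_cases hx : ∃ s y, a s x = some y
  · obtain ⟨s, y, hy⟩ := hx
    filter_upwards [Filter.eventually_ge_atTop s] with t ht
    rw [h.le ht hy, Part.eq_some_iff.2 (h.mem_lim.2 ⟨s, hy⟩)]
    rfl
  · push Not at hx
    refine Filter.Eventually.of_forall fun t => ?_
    ext y
    rw [h.mem_lim]
    simp [hx]

end Limits

section Followers

/-- The last stage `t ≤ s` at which `i` was seen to agree with a smaller index below its previous
such stage. -/
def lastJump (a : ℕ → ℕ → ℕ → Option ℕ) (i s : ℕ) : ℕ :=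
  s.rec 0 fun t r =>
    bif bex (fun j => ball (fun x => decide (a i (t + 1) x = a j (t + 1) x)) r) i then t + 1 else r

/-- The stages of the program following `a i` from stage `s`, which turns into `dv (c ⟨i, t⟩)` when
`i` jumps at stage `t`. -/
def follower (a : ℕ → ℕ → ℕ → Option ℕ) (dv : ℕ → ℕ → Option ℕ) (c : ℕ → ℕ) (i s t x : ℕ) :
    Option ℕ :=
  bif lastJump a i (s + t) == s then a i (s + t) x
  else bif lastJump a i (s + t) == s + t && lastJump a i (s + t - 1) == s then
    dv (c (Nat.pair i (s + t))) x
  else none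

/-- `e = ⟨i, s⟩` is a positive stage `s` at which `i` jumps. -/
def isJump (a : ℕ → ℕ → ℕ → Option ℕ) (e : ℕ) : Bool :=
  !(e.unpair.2 == 0) && lastJump a e.unpair.1 e.unpair.2 == e.unpair.2

/-- Indices `⟨0, d⟩` denote `dv d`; indices `⟨i + 1, s⟩` denote the follower of `i` from stage
`s`. -/
def program (a : ℕ → ℕ → ℕ → Option ℕ) (dv : ℕ → ℕ → Option ℕ) (c : ℕ → ℕ) (w t x : ℕ) :
    Option ℕ :=
  bif w.unpair.1 == 0 then dv w.unpair.2 x else follower a dv c (w.unpair.1 - 1) w.unpair.2 t x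

/-- The indices kept in the injective numbering. -/
def isIndex (a : ℕ → ℕ → ℕ → Option ℕ) (D : ℕ → Bool) (c : ℕ → ℕ) (w : ℕ) : Bool :=
  bif w.unpair.1 == 0 then
    D w.unpair.2 && !bex (fun e => isJump a e && c e == w.unpair.2) (w.unpair.2 + 1)
  else lastJump a (w.unpair.1 - 1) w.unpair.2 == w.unpair.2

section Computability

variable {α : Type*} [Primcodable α] {a : ℕ → ℕ → ℕ → Option ℕ} {dv : ℕ → ℕ → Option ℕ}
  {D : ℕ → Bool} {c : ℕ → ℕ}

theorem computable_decide_eq {β : Type*} [Primcodable β] [DecidableEq β] {f g : α → β}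
    (hf : Computable f) (hg : Computable g) : Computable fun x => decide (f x = g x) :=
  Primrec.eq.decide.to_comp.comp hf hg

theorem computable_beq {β : Type*} [Primcodable β] [DecidableEq β] {f g : α → β}
    (hf : Computable f) (hg : Computable g) : Computable fun x => f x == g x :=
  Primrec.beq.to_comp.comp hf hg

theorem computable_and {f g : α → Bool} (hf : Computable f) (hg : Computable g) :
    Computable fun x => f x && g x :=
  Primrec.and.to_comp.comp hf hg

theorem computable_not {f : α → Bool} (hf : Computable f) : Computable fun x => !f x :=
  Primrec.not.to_comp.comp hf

theorem computable_add {f g : α → ℕ} (hf : Computable f) (hg : Computable g) :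
    Computable fun x => f x + g x :=
  Primrec.nat_add.to_comp.comp hf hg

theorem computable_pred {f : α → ℕ} (hf : Computable f) : Computable fun x => f x - 1 :=
  Primrec.pred.to_comp.comp hf

theorem computable_left {f : α → ℕ} (hf : Computable f) : Computable fun x => (f x).unpair.1 :=
  Computable.fst.comp (Computable.unpair.comp hf)

theorem computable_right {f : α → ℕ} (hf : Computable f) : Computable fun x => (f x).unpair.2 :=
  Computable.snd.comp (Computable.unpair.comp hf)

theorem computable_pair {f g : α → ℕ} (hf : Computable f) (hg : Computable g) :
    Computable fun x => Nat.pair (f x) (g x) :=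
  Primrec₂.natPair.to_comp.comp hf hg

theorem computable_app₃ {β : Type*} [Primcodable β] {g : ℕ → ℕ → ℕ → β}
    (hg : Computable fun p : ℕ × ℕ × ℕ => g p.1 p.2.1 p.2.2) {i s x : α → ℕ}
    (hi : Computable i) (hs : Computable s) (hx : Computable x) :
    Computable fun p => g (i p) (s p) (x p) :=
  hg.comp (hi.pair (hs.pair hx))

theorem computable_lastJump (ha : Computable fun p : ℕ × ℕ × ℕ => a p.1 p.2.1 p.2.2) {i s : α → ℕ}
    (hi : Computable i) (hs : Computable s) : Computable fun p => lastJump a (i p) (s p) := by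
  have hp := Computable.fst (α := α × ℕ × ℕ) (β := ℕ)
  have hp' := hp.comp (Computable.fst (β := ℕ))
  have hi' : Computable fun p : α × ℕ × ℕ => i p.1 := hi.comp Computable.fst
  have ht : Computable fun p : α × ℕ × ℕ => p.2.1 + 1 :=
    Computable.succ.comp (Computable.fst.comp Computable.snd)
  have hr : Computable fun p : α × ℕ × ℕ => p.2.2 := Computable.snd.comp Computable.snd
  have h1 : Computable fun q : ((α × ℕ × ℕ) × ℕ) × ℕ => i q.1.1.1 := hi'.comp hp'
  have h2 : Computable fun q : ((α × ℕ × ℕ) × ℕ) × ℕ => q.1.1.2.1 + 1 := ht.comp hp'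
  have h3 : Computable fun q : ((α × ℕ × ℕ) × ℕ) × ℕ => q.1.2 :=
    Computable.snd.comp Computable.fst
  have h4 : Computable fun q : ((α × ℕ × ℕ) × ℕ) × ℕ => q.2 := Computable.snd
  have hagree : Computable fun q : ((α × ℕ × ℕ) × ℕ) × ℕ =>
      decide (a (i q.1.1.1) (q.1.1.2.1 + 1) q.2 = a q.1.2 (q.1.1.2.1 + 1) q.2) :=
    computable_decide_eq (computable_app₃ ha h1 h2 h4) (computable_app₃ ha h3 h2 h4)
  have hball : Computable fun q : (α × ℕ × ℕ) × ℕ =>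
      ball (fun x => decide (a (i q.1.1) (q.1.2.1 + 1) x = a q.2 (q.1.2.1 + 1) x)) q.1.2.2 :=
    computable_ball (p := fun (q : (α × ℕ × ℕ) × ℕ) x =>
      decide (a (i q.1.1) (q.1.2.1 + 1) x = a q.2 (q.1.2.1 + 1) x)) hagree (hr.comp hp)
  have hbex : Computable fun p : α × ℕ × ℕ =>
      bex (fun j => ball (fun x => decide (a (i p.1) (p.2.1 + 1) x = a j (p.2.1 + 1) x)) p.2.2) (i p.1) :=
    computable_bex (p := fun (p : α × ℕ × ℕ) j =>
      ball (fun x => decide (a (i p.1) (p.2.1 + 1) x = a j (p.2.1 + 1) x)) p.2.2) hball hi'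
  exact Computable.nat_rec hs (Computable.const 0) (Computable.cond hbex ht hr).to₂

theorem computable_program (ha : Computable fun p : ℕ × ℕ × ℕ => a p.1 p.2.1 p.2.2)
    (hdv : Computable₂ dv) (hc : Computable c) {w t x : α → ℕ} (hw : Computable w)
    (ht : Computable t) (hx : Computable x) :
    Computable fun p => program a dv c (w p) (t p) (x p) := by
  have hi := computable_pred (computable_left hw)
  have hs := computable_right hw
  have hst := computable_add hs ht
  refine Computable.cond (computable_beq (computable_left hw) (Computable.const 0))
    (hdv.comp hs hx) ?_
  refine Computable.cond (computable_beq (computable_lastJump ha hi hst) hs)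
    (computable_app₃ ha hi hst hx) ?_
  exact Computable.cond
    (computable_and (computable_beq (computable_lastJump ha hi hst) hst)
      (computable_beq (computable_lastJump ha hi (computable_pred hst)) hs))
    (hdv.comp (hc.comp (computable_pair hi hst)) hx) (Computable.const none)

theorem computable_isIndex (ha : Computable fun p : ℕ × ℕ × ℕ => a p.1 p.2.1 p.2.2)
    (hD : Computable D) (hc : Computable c) {w : α → ℕ} (hw : Computable w) :
    Computable fun p => isIndex a D c (w p) := by
  have hd := computable_right hw
  refine Computable.cond (computable_beq (computable_left hw) (Computable.const 0))
    (computable_and (hD.comp hd) (computable_not (computable_bex ?_ (Computable.succ.comp hd))))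
    (computable_beq (computable_lastJump ha (computable_pred (computable_left hw)) hd) hd)
  have he := Computable.snd (α := α) (β := ℕ)
  refine computable_and (computable_and (computable_not (computable_beq (computable_right he)
    (Computable.const 0))) ?_) (computable_beq (hc.comp he) (hd.comp Computable.fst))
  exact computable_beq (computable_lastJump ha (computable_left he) (computable_right he))
    (computable_right he)

end Computability

section Jumps

variable {a : ℕ → ℕ → ℕ → Option ℕ} {dv : ℕ → ℕ → Option ℕ} {c : ℕ → ℕ} {i s t : ℕ}

@[simp] theorem lastJump_zero : lastJump a i 0 = 0 := rfl

theorem lastJump_succ_of_agree {j : ℕ} (hj : j < i)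
    (h : ∀ x < lastJump a i s, a i (s + 1) x = a j (s + 1) x) :
    lastJump a i (s + 1) = s + 1 := by
  have h' : bex (fun j => ball (fun x => decide (a i (s + 1) x = a j (s + 1) x)) (lastJump a i s)) i
      = true := by
    simp only [bex_iff, ball_iff, decide_eq_true_eq]
    exact ⟨j, hj, h⟩
  exact congrArg (fun b => bif b then s + 1 else lastJump a i s) h'

theorem lastJump_succ_of_disagree
    (h : ∀ j < i, ∃ x < lastJump a i s, a i (s + 1) x ≠ a j (s + 1) x) :
    lastJump a i (s + 1) = lastJump a i s := by
  have h' : bex (fun j => ball (fun x => decide (a i (s + 1) x = a j (s + 1) x)) (lastJump a i s)) i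
      = false := by
    rw [← Bool.not_eq_true]
    simp only [bex_iff, ball_iff, decide_eq_true_eq]
    rintro ⟨j, hj, hx⟩
    obtain ⟨x, hxs, hne⟩ := h j hj
    exact hne (hx x hxs)
  exact congrArg (fun b => bif b then s + 1 else lastJump a i s) h'

theorem lastJump_succ :
    lastJump a i (s + 1) = s + 1 ∨ lastJump a i (s + 1) = lastJump a i s := by
  by_cases h : ∃ j < i, ∀ x < lastJump a i s, a i (s + 1) x = a j (s + 1) x
  · obtain ⟨j, hj, hx⟩ := h
    exact .inl (lastJump_succ_of_agree hj hx)
  · push Not at h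
    exact .inr (lastJump_succ_of_disagree h)

theorem lastJump_le : lastJump a i s ≤ s := by
  induction s with
  | zero => simp
  | succ s ih => rcases lastJump_succ (a := a) (i := i) (s := s) with h | h <;> omega

theorem lastJump_mono : Monotone (lastJump a i) := by
  refine monotone_nat_of_le_succ fun s => ?_
  have := lastJump_le (a := a) (i := i) (s := s)
  rcases lastJump_succ (a := a) (i := i) (s := s) with h | h <;> omega

theorem lastJump_lastJump : lastJump a i (lastJump a i s) = lastJump a i s := by
  induction s with
  | zero => simp
  | succ s ih => rcases lastJump_succ (a := a) (i := i) (s := s) with h | h <;> simp [h, ih]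

theorem lastJump_eventually_of_no_jump (h : ∀ t, s ≤ t → lastJump a i (t + 1) ≠ t + 1) :
    ∀ t, lastJump a i s ≤ t → lastJump a i t = lastJump a i s := by
  intro t ht
  rcases le_total t s with hts | hst
  · refine le_antisymm (lastJump_mono hts) ?_
    calc lastJump a i s = lastJump a i (lastJump a i s) := lastJump_lastJump.symm
      _ ≤ lastJump a i t := lastJump_mono ht
  · induction t, hst using Nat.le_induction with
    | base => rfl
    | succ t hst ih =>
      rw [(lastJump_succ.resolve_left (h t hst)), ih (lastJump_le.trans hst)]

/-- An index whose limit differs from the limits of all smaller indices jumps finitely often. -/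
theorem exists_no_jump (hmono : ∀ i, Mono (a i)) (h : ∀ j < i, lim (a i) ≠ lim (a j)) :
    ∃ s, lastJump a i s = s ∧ ∀ t, s ≤ t → lastJump a i t = s := by
  suffices H : ∃ s, ∀ t, s ≤ t → lastJump a i (t + 1) ≠ t + 1 by
    obtain ⟨s, hs⟩ := H
    exact ⟨lastJump a i s, lastJump_lastJump, lastJump_eventually_of_no_jump hs⟩
  have hx : ∀ j, ∃ x, j < i → lim (a i) x ≠ lim (a j) x := by
    intro j
    by_cases hj : j < i
    · obtain ⟨x, hx⟩ := Function.ne_iff.1 (h j hj)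
      exact ⟨x, fun _ => hx⟩
    · exact ⟨0, fun h => absurd h hj⟩
  choose x hx using hx
  have hev : ∀ᶠ t in Filter.atTop, ∀ j ∈ Set.Iio i, x j < t ∧ a i t (x j) ≠ a j t (x j) := by
    rw [(Set.finite_Iio i).eventually_all]
    intro j hj
    filter_upwards [(hmono i).eventually_eq (x j), (hmono j).eventually_eq (x j),
      Filter.eventually_gt_atTop (x j)] with t h1 h2 h3
    refine ⟨h3, fun he => hx j hj ?_⟩
    rw [← h1, ← h2, he]
  obtain ⟨T, hT⟩ := Filter.eventually_atTop.1 hev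
  have key : ∀ t, T ≤ t → T ≤ lastJump a i t → lastJump a i (t + 1) = lastJump a i t :=
    fun t ht hJ => lastJump_succ_of_disagree fun j hj =>
      ⟨x j, ((hT T le_rfl j hj).1).trans_le hJ, (hT (t + 1) (by omega) j hj).2⟩
  by_contra hcon
  push Not at hcon
  obtain ⟨t, ht, hJ⟩ := hcon T
  obtain ⟨u, hu, hJ'⟩ := hcon (t + 1)
  have h1 : T ≤ lastJump a i u := by
    have := lastJump_mono (a := a) (i := i) hu
    omega
  have h2 := key u (by omega) h1
  have h3 := lastJump_le (a := a) (i := i) (s := u)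
  omega

/-- An index whose limit is also the limit of a smaller index jumps infinitely often. -/
theorem exists_jump {j : ℕ} (hmono : ∀ i, Mono (a i)) (hj : j < i) (h : lim (a i) = lim (a j))
    (s : ℕ) : ∃ t, s ≤ t ∧ lastJump a i t ≠ s := by
  by_contra! hcon
  have hev : ∀ᶠ t in Filter.atTop, ∀ x ∈ Set.Iio s, a i t x = a j t x := by
    rw [(Set.finite_Iio s).eventually_all]
    intro x _
    filter_upwards [(hmono i).eventually_eq x, (hmono j).eventually_eq x] with t h1 h2
    have : toPFun (fun _ => a i t x) = toPFun (fun _ => a j t x) := by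
      funext _
      simp only [toPFun, h1, h2, h]
    exact congrFun (toPFun_injective this) 0
  obtain ⟨T, hT⟩ := Filter.eventually_atTop.1 hev
  have h1 := hcon (max T s) (le_max_right _ _)
  have h2 := hcon (max T s + 1) (by omega)
  have h3 := lastJump_succ_of_agree (a := a) (s := max T s) hj fun x hx =>
    hT (max T s + 1) (by omega) x (by rw [h1] at hx; exact hx)
  omega

theorem lim_follower_of_no_jump (hmono : ∀ i, Mono (a i))
    (h : ∀ t, s ≤ t → lastJump a i t = s) : lim (follower a dv c i s) = lim (a i) := by
  have hfol : ∀ t x, follower a dv c i s t x = a i (s + t) x := by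
    intro t x
    simp [follower, h (s + t) (by omega)]
  have hfmono : Mono (follower a dv c i s) := by
    intro t x y hy
    rw [hfol] at hy ⊢
    exact hmono i _ _ _ hy
  funext x
  ext y
  rw [hfmono.mem_lim, (hmono i).mem_lim]
  constructor
  · rintro ⟨t, ht⟩
    exact ⟨s + t, by rwa [hfol] at ht⟩
  · rintro ⟨t, ht⟩
    exact ⟨t, by rw [hfol]; exact (hmono i).le (by omega) ht⟩

theorem lim_follower_of_jump (hmono : ∀ i, Mono (a i)) {r : ℕ} (hr : 0 < r)
    (hjump : lastJump a i r = r) (hprev : lastJump a i (r - 1) = s)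
    (hext : ∀ x y, a i r x = some y → dv (c (Nat.pair i r)) x = some y) :
    lim (follower a dv c i s) = toPFun (dv (c (Nat.pair i r))) := by
  have hs : lastJump a i s = s := by rw [← hprev, lastJump_lastJump]
  have hsr : s < r := by
    have := lastJump_le (a := a) (i := i) (s := r - 1)
    omega
  have hlt : ∀ t x, s + t < r → follower a dv c i s t x = a i (s + t) x := by
    intro t x ht
    have h1 := lastJump_mono (a := a) (i := i) (show s ≤ s + t by omega)
    have h2 := lastJump_mono (a := a) (i := i) (show s + t ≤ r - 1 by omega)
    have : lastJump a i (s + t) = s := by omega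
    simp [follower, this]
  have heq : ∀ t x, s + t = r → follower a dv c i s t x = dv (c (Nat.pair i r)) x := by
    intro t x ht
    simp [follower, ht, hjump, hprev, beq_false_of_ne hsr.ne']
  have hgt : ∀ t x, r < s + t → follower a dv c i s t x = none := by
    intro t x ht
    have h1 := lastJump_mono (a := a) (i := i) (show r ≤ s + t by omega)
    have h2 := lastJump_mono (a := a) (i := i) (show r ≤ s + t - 1 by omega)
    have h3 : lastJump a i (s + t) ≠ s := by omega
    have h4 : lastJump a i (s + t - 1) ≠ s := by omega
    simp [follower, beq_false_of_ne h3, beq_false_of_ne h4]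
  have hsub : ∀ t x y, follower a dv c i s t x = some y → dv (c (Nat.pair i r)) x = some y := by
    intro t x y hy
    rcases lt_trichotomy (s + t) r with h | h | h
    · rw [hlt t x h] at hy
      exact hext x y ((hmono i).le h.le hy)
    · rwa [heq t x h] at hy
    · simp [hgt t x h] at hy
  rw [eq_toPFun_iff]
  intro x y
  rw [mem_lim_of_functional fun t t' y z hy hz =>
    Option.some_injective _ ((hsub t x y hy).symm.trans (hsub t' x z hz))]
  exact ⟨fun ⟨t, ht⟩ => hsub t x y ht, fun hy => ⟨r - s, by rw [heq _ _ (by omega), hy]⟩⟩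

theorem no_jump_or_jump (hs : lastJump a i s = s) :
    (∀ t, s ≤ t → lastJump a i t = s) ∨
      ∃ r, 0 < r ∧ lastJump a i r = r ∧ lastJump a i (r - 1) = s := by
  by_cases h : ∃ t, s ≤ t ∧ lastJump a i t ≠ s
  · right
    classical
    have hspec := Nat.find_spec h
    have hmin := fun m => Nat.find_min (m := m) h
    set r := Nat.find h
    have hr : r ≠ s := fun he => hspec.2 (by rw [he, hs])
    have hprev : lastJump a i (r - 1) = s := by
      by_contra hne
      exact hmin (r - 1) (by omega) ⟨by omega, hne⟩
    obtain ⟨q, hq⟩ : ∃ q, r = q + 1 := ⟨r - 1, by omega⟩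
    refine ⟨r, by omega, ?_, hprev⟩
    rw [hq] at hspec hprev ⊢
    exact lastJump_succ.resolve_right fun he => hspec.2 (he.trans hprev)
  · push Not at h
    exact .inl h

end Jumps

end Followers

section Kummer

/-- An infinite decidable set has an injective computable enumeration. -/
theorem exists_computable_enumeration {p : ℕ → Bool} (hp : Computable p)
    (hinf : ∀ N, ∃ n, N ≤ n ∧ p n = true) :
    ∃ m : ℕ → ℕ, Computable m ∧ Function.Injective m ∧ ∀ w, (∃ n, m n = w) ↔ p w = true := by
  have hinf' : (Set.ofPred fun k => p k = true).Infinite :=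
    Set.infinite_of_forall_exists_gt fun N => (hinf (N + 1)).imp fun _ h => ⟨h.2, h.1⟩
  have hcount : Computable fun w => Nat.count (fun k => p k = true) w :=
    computable_count (α := ℕ) (p := fun _ k => p k) (hp.comp Computable.snd) Computable.id
  obtain ⟨m, hm, hspec⟩ := exists_computable_search (α := ℕ)
    (p := fun n w => p w && decide (Nat.count (fun k => p k = true) w = n))
    (computable_and (hp.comp Computable.snd)
      (computable_decide_eq (hcount.comp Computable.snd) Computable.fst)) fun n =>
    ⟨Nat.nth (fun k => p k = true) n, by
      simp only [Bool.and_eq_true, decide_eq_true_eq]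
      exact ⟨Nat.nth_mem_of_infinite hinf' n, Nat.count_nth_of_infinite hinf' n⟩⟩
  simp only [Bool.and_eq_true, decide_eq_true_eq] at hspec
  refine ⟨m, hm, fun n n' h => ?_, fun w => ⟨?_, fun hw => ?_⟩⟩
  · rw [← (hspec n).2, ← (hspec n').2, h]
  · rintro ⟨n, rfl⟩
    exact (hspec n).1
  · exact ⟨_, Nat.count_injective (hspec _).1 hw (hspec _).2⟩

variable {a : ℕ → ℕ → ℕ → Option ℕ} {dv : ℕ → ℕ → Option ℕ} {D : ℕ → Bool}

/-- A strictly increasing computable choice of extensions in `D` of the finite functions `a i s`. -/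
theorem exists_extension_choice (ha : Computable fun p : ℕ × ℕ × ℕ => a p.1 p.2.1 p.2.2)
    (hdv : Computable₂ dv) (hD : Computable D)
    (hsupp : ∀ i s x y, a i s x = some y → x < s)
    (hdense : ∀ i s N, ∃ d, N < d ∧ D d = true ∧ ∀ x y, a i s x = some y → dv d x = some y) :
    ∃ c : ℕ → ℕ, Computable c ∧ StrictMono c ∧ ∀ e, D (c e) = true ∧
      ∀ x y, a e.unpair.1 e.unpair.2 x = some y → dv (c e) x = some y := by
  let ok (q : ℕ × ℕ) (d : ℕ) : Bool := (Nat.blt q.1 d && D d) &&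
    ball (fun x => decide (a q.2.unpair.1 q.2.unpair.2 x = none) ||
      decide (a q.2.unpair.1 q.2.unpair.2 x = dv d x)) q.2.unpair.2
  have hok : Computable fun q : (ℕ × ℕ) × ℕ => ok q.1 q.2 := by
    have hN : Computable fun q : (ℕ × ℕ) × ℕ => q.1.1 := Computable.fst.comp Computable.fst
    have he : Computable fun q : (ℕ × ℕ) × ℕ => q.1.2 := Computable.snd.comp Computable.fst
    have hd : Computable fun q : (ℕ × ℕ) × ℕ => q.2 := Computable.snd
    have hlt : Computable fun q : (ℕ × ℕ) × ℕ => Nat.blt q.1.1 q.2 := by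
      refine (Primrec.nat_lt.decide.to_comp.comp hN hd).of_eq fun q => ?_
      rw [Bool.eq_iff_iff, Nat.blt_eq, decide_eq_true_eq]
    have hp : Computable fun r : ((ℕ × ℕ) × ℕ) × ℕ => r.1 := Computable.fst
    have hx : Computable fun r : ((ℕ × ℕ) × ℕ) × ℕ => r.2 := Computable.snd
    have hax : Computable fun r : ((ℕ × ℕ) × ℕ) × ℕ =>
        a r.1.1.2.unpair.1 r.1.1.2.unpair.2 r.2 :=
      computable_app₃ ha (computable_left (he.comp hp)) (computable_right (he.comp hp)) hx
    refine computable_and (computable_and hlt (hD.comp hd)) (computable_ball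
      (p := fun (q : (ℕ × ℕ) × ℕ) x => decide (a q.1.2.unpair.1 q.1.2.unpair.2 x = none) ||
        decide (a q.1.2.unpair.1 q.1.2.unpair.2 x = dv q.2 x)) ?_ (computable_right he))
    exact Primrec.or.to_comp.comp (computable_decide_eq hax (Computable.const none))
      (computable_decide_eq hax (hdv.comp (hd.comp hp) hx))
  have hok_iff : ∀ q d, ok q d = true ↔ q.1 < d ∧ D d = true ∧
      ∀ x y, a q.2.unpair.1 q.2.unpair.2 x = some y → dv d x = some y := by
    intro q d
    simp only [ok, Bool.and_eq_true, ball_iff, Bool.or_eq_true, decide_eq_true_eq, Nat.blt_eq,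
      and_assoc]
    refine and_congr_right fun _ => and_congr_right fun _ => ⟨fun h x y hy => ?_, fun h x _ => ?_⟩
    · rcases h x (hsupp _ _ _ _ hy) with h | h
      · simp [hy] at h
      · rw [← h, hy]
    · rcases hy : a q.2.unpair.1 q.2.unpair.2 x with _ | y
      · exact .inl rfl
      · exact .inr (h x y hy).symm
  obtain ⟨m, hm, hspec⟩ := exists_computable_search hok fun q => by
    obtain ⟨d, hd⟩ := hdense q.2.unpair.1 q.2.unpair.2 q.1
    exact ⟨d, (hok_iff q d).2 hd⟩
  simp only [hok_iff] at hspec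
  refine ⟨fun e => e.rec (m (0, 0)) fun e r => m (r, e + 1), ?_, ?_, ?_⟩
  · exact Computable.nat_rec Computable.id (Computable.const _)
      (hm.comp ((Computable.snd.comp Computable.snd).pair
        (Computable.succ.comp (Computable.fst.comp Computable.snd)))).to₂
  · exact strictMono_nat_of_lt_succ fun e => (hspec (_, e + 1)).1
  · intro e
    cases e with
    | zero => exact (hspec (0, 0)).2
    | succ e => exact (hspec (_, e + 1)).2

/-- **Kummer's lemma**: a computable sequence of functions, together with a disjoint injectively
indexed computable family of finite functions in which every finite approximation to a member of
the sequence has arbitrarily large extensions, has an injective computable numbering. -/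
theorem exists_injective_numbering (ha : Computable fun p : ℕ × ℕ × ℕ => a p.1 p.2.1 p.2.2)
    (hdv : Computable₂ dv) (hD : Computable D) (hmono : ∀ i, Mono (a i))
    (hsupp : ∀ i s x y, a i s x = some y → x < s)
    (hinj : ∀ d d', D d = true → D d' = true → dv d = dv d' → d = d')
    (hdisj : ∀ i d, D d = true → lim (a i) ≠ toPFun (dv d))
    (hdense : ∀ i s N, ∃ d, N < d ∧ D d = true ∧ ∀ x y, a i s x = some y → dv d x = some y) :
    ∃ ν : ℕ → ℕ →. ℕ, Partrec₂ ν ∧ Function.Injective ν ∧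
      ∀ g, (∃ n, ν n = g) ↔ (∃ i, g = lim (a i)) ∨ ∃ d, D d = true ∧ g = toPFun (dv d) := by
  obtain ⟨c, hc, hcmono, hcspec⟩ := exists_extension_choice ha hdv hD hsupp hdense
  have hext : ∀ i r x y, a i r x = some y → dv (c (Nat.pair i r)) x = some y := by
    intro i r x y h
    exact (hcspec (Nat.pair i r)).2 x y (by simpa using h)
  obtain ⟨m, hm, hminj, hmrange⟩ := exists_computable_enumeration
    (computable_isIndex ha hD hc Computable.id) fun N =>
    ⟨Nat.pair (N + 1) 0, (Nat.le_succ N).trans (Nat.left_le_pair _ _), by simp [isIndex]⟩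
  set θ : ℕ → ℕ →. ℕ := fun w => lim (program a dv c w) with hθ
  have hfree : ∀ d, θ (Nat.pair 0 d) = toPFun (dv d) := by
    intro d
    rw [eq_toPFun_iff]
    intro x y
    have hprog : ∀ t, program a dv c (Nat.pair 0 d) t x = dv d x := by simp [program]
    rw [hθ, mem_lim_of_functional fun s t y z hy hz => by simp_all]
    simp [hprog]
  have hfol : ∀ i s, θ (Nat.pair (i + 1) s) = lim (follower a dv c i s) := by
    intro i s
    simp only [hθ]
    congr 1
    funext t x
    simp [program]
  have hfree_index : ∀ d, isIndex a D c (Nat.pair 0 d) = true ↔ D d = true ∧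
      ¬ ∃ i r, 0 < r ∧ lastJump a i r = r ∧ c (Nat.pair i r) = d := by
    intro d
    simp only [isIndex, Nat.unpair_pair, beq_self_eq_true, cond_true, Bool.and_eq_true,
      Bool.not_eq_true', ← Bool.not_eq_true, bex_iff, isJump, beq_iff_eq]
    refine and_congr_right fun _ => not_congr ⟨?_, ?_⟩
    · rintro ⟨e, _, ⟨h1, h2⟩, h3⟩
      exact ⟨e.unpair.1, e.unpair.2, by omega, h2, by simpa using h3⟩
    · rintro ⟨i, r, h1, h2, h3⟩
      refine ⟨Nat.pair i r, ?_, ⟨by simp; omega, by simpa using h2⟩, h3⟩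
      have := hcmono.le_apply (x := Nat.pair i r)
      omega
  have hfol_index : ∀ i s, isIndex a D c (Nat.pair (i + 1) s) = true ↔ lastJump a i s = s := by
    simp [isIndex]
  have hcases : ∀ w, (∃ d, w = Nat.pair 0 d) ∨ ∃ i s, w = Nat.pair (i + 1) s := by
    intro w
    rw [← Nat.pair_unpair w]
    rcases w.unpair.1 with _ | i
    · exact .inl ⟨_, rfl⟩
    · exact .inr ⟨_, _, rfl⟩
  have hjump : ∀ i s r, 0 < r → lastJump a i r = r → lastJump a i (r - 1) = s →
      θ (Nat.pair (i + 1) s) = toPFun (dv (c (Nat.pair i r))) := by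
    intro i s r h1 h2 h3
    rw [hfol, lim_follower_of_jump hmono h1 h2 h3 (hext i r)]
  have hnojump : ∀ i s, (∀ t, s ≤ t → lastJump a i t = s) →
      θ (Nat.pair (i + 1) s) = lim (a i) := by
    intro i s h
    rw [hfol, lim_follower_of_no_jump hmono h]
  have hdv_inj : ∀ d d', D d = true → D d' = true → toPFun (dv d) = toPFun (dv d') → d = d' :=
    fun d d' h h' he => hinj d d' h h' (toPFun_injective he)
  have hindex_inj : ∀ w w', isIndex a D c w = true → isIndex a D c w' = true → θ w = θ w' →
      w = w' := by
    have hff' : ∀ d i s, isIndex a D c (Nat.pair 0 d) = true →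
        isIndex a D c (Nat.pair (i + 1) s) = true →
        θ (Nat.pair 0 d) ≠ θ (Nat.pair (i + 1) s) := by
      intro d i s hd hi he
      obtain ⟨hd, hn⟩ := (hfree_index d).1 hd
      rw [hfol_index] at hi
      rw [hfree] at he
      rcases no_jump_or_jump hi with h | ⟨r, h1, h2, h3⟩
      · rw [hnojump i s h] at he
        exact hdisj i d hd he.symm
      · rw [hjump i s r h1 h2 h3] at he
        exact hn ⟨i, r, h1, h2, (hdv_inj _ _ hd (hcspec _).1 he).symm⟩
    have hlt : ∀ i j s, (∀ t, s ≤ t → lastJump a i t = s) → lim (a i) = lim (a j) → ¬ j < i := by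
      intro i j s h he hj
      obtain ⟨t, h1, h2⟩ := exists_jump hmono hj he s
      exact h2 (h t h1)
    intro w w' hw hw' he
    rcases hcases w with ⟨d, rfl⟩ | ⟨i, s, rfl⟩ <;> rcases hcases w' with ⟨d', rfl⟩ | ⟨i', s', rfl⟩
    · rw [hfree, hfree] at he
      rw [hdv_inj d d' ((hfree_index d).1 hw).1 ((hfree_index d').1 hw').1 he]
    · exact absurd he (hff' _ _ _ hw hw')
    · exact absurd he.symm (hff' _ _ _ hw' hw)
    · rw [hfol_index] at hw hw'
      rcases no_jump_or_jump hw with h | ⟨r, h1, h2, h3⟩ <;>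
        rcases no_jump_or_jump hw' with h' | ⟨r', h1', h2', h3'⟩
      · rw [hnojump i s h, hnojump i' s' h'] at he
        obtain rfl : i = i' :=
          le_antisymm (not_lt.1 (hlt i i' s h he)) (not_lt.1 (hlt i' i s' h' he.symm))
        rw [← h _ (le_max_left s s'), h' _ (le_max_right s s')]
      · rw [hnojump i s h, hjump i' s' r' h1' h2' h3'] at he
        exact absurd he (hdisj _ _ (hcspec _).1)
      · rw [hnojump i' s' h', hjump i s r h1 h2 h3] at he
        exact absurd he.symm (hdisj _ _ (hcspec _).1)
      · rw [hjump i s r h1 h2 h3, hjump i' s' r' h1' h2' h3'] at he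
        have := hcmono.injective (hdv_inj _ _ (hcspec _).1 (hcspec _).1 he)
        obtain ⟨rfl, rfl⟩ := Nat.pair_eq_pair.1 this
        rw [← h3, ← h3']
  refine ⟨fun n => θ (m n), ?_, fun n n' he => ?_, fun g => ⟨?_, ?_⟩⟩
  · exact Partrec.rfindOpt (f := fun (q : ℕ × ℕ) t => program a dv c (m q.1) t q.2)
      (computable_program ha hdv hc (hm.comp (Computable.fst.comp Computable.fst))
        Computable.snd (Computable.snd.comp Computable.fst))
  · exact hminj (hindex_inj _ _ ((hmrange _).1 ⟨n, rfl⟩) ((hmrange _).1 ⟨n', rfl⟩) he)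
  · rintro ⟨n, rfl⟩
    have hw := (hmrange (m n)).1 ⟨n, rfl⟩
    rcases hcases (m n) with ⟨d, hd⟩ | ⟨i, s, hi⟩
    · simp only [hd] at hw ⊢
      exact .inr ⟨d, ((hfree_index d).1 hw).1, hfree d⟩
    · simp only [hi] at hw ⊢
      rcases no_jump_or_jump ((hfol_index i s).1 hw) with h | ⟨r, h1, h2, h3⟩
      · exact .inl ⟨i, hnojump i s h⟩
      · exact .inr ⟨_, (hcspec _).1, hjump i s r h1 h2 h3⟩
  · have hmem : ∀ w, isIndex a D c w = true → ∃ n, θ (m n) = θ w := by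
      intro w hw
      obtain ⟨n, hn⟩ := (hmrange w).2 hw
      exact ⟨n, by rw [hn]⟩
    rintro (⟨i, rfl⟩ | ⟨d, hd, rfl⟩)
    · classical
      have hex : ∃ j, lim (a j) = lim (a i) := ⟨i, rfl⟩
      have hj := Nat.find_spec hex
      obtain ⟨s, hs, hs'⟩ := exists_no_jump (i := Nat.find hex) hmono fun j hj' he =>
        Nat.find_min hex hj' (he.symm.trans hj)
      rw [← hj, ← hnojump _ s hs']
      exact hmem _ ((hfol_index _ _).2 hs)
    · rw [← hfree d]
      by_cases h : ∃ i r, 0 < r ∧ lastJump a i r = r ∧ c (Nat.pair i r) = d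
      · obtain ⟨i, r, h1, h2, rfl⟩ := h
        rw [hfree, ← hjump i _ r h1 h2 rfl]
        exact hmem _ ((hfol_index _ _).2 lastJump_lastJump)
      · exact hmem _ ((hfree_index d).2 ⟨hd, h⟩)

end Kummer

section FiniteFunctions

/-- The number of arguments at which `g` is defined (zero if there are infinitely many). -/
noncomputable def domCard (g : ℕ → Option ℕ) : ℕ := {x | g x ≠ none}.ncard

theorem count_isSome_eq_domCard {g : ℕ → Option ℕ} {n : ℕ} (h : ∀ x y, g x = some y → x < n) :
    Nat.count (fun x => (g x).isSome = true) n = domCard g := by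
  rw [Nat.count_eq_card_filter_range, domCard, ← Set.ncard_coe_finset]
  congr 1
  ext x
  simp only [Finset.coe_filter, Finset.mem_range, Set.mem_ofPred_eq, Option.isSome_iff_ne_none,
    and_iff_right_iff_imp]
  intro hx
  obtain ⟨y, hy⟩ := Option.ne_none_iff_exists'.1 hx
  exact h x y hy

theorem domCard_update {g : ℕ → Option ℕ} {n z y : ℕ} (h : ∀ x y, g x = some y → x < n)
    (hz : g z = none) : domCard (Function.update g z (some y)) = domCard g + 1 := by
  have hset : {x | Function.update g z (some y) x ≠ none} = insert z {x | g x ≠ none} := by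
    ext x
    by_cases hx : x = z <;> simp [Function.update_apply, hx]
  have hfin : {x | g x ≠ none}.Finite := (Set.finite_Iio n).subset fun x hx => by
    obtain ⟨y, hy⟩ := Option.ne_none_iff_exists'.1 hx
    exact h x y hy
  rw [domCard, hset, Set.ncard_insert_of_notMem (by simpa using hz) hfin, domCard]

end FiniteFunctions

section Enumeration

/-- A computable double sequence of partial functions is computably approximated. -/
theorem exists_stages {g : ℕ → ℕ →. ℕ} (hg : Partrec₂ g) :
    ∃ e : ℕ → ℕ → ℕ → Option ℕ, (Computable fun p : ℕ × ℕ × ℕ => e p.1 p.2.1 p.2.2) ∧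
      ∀ i x y, y ∈ g i x ↔ ∃ t, e i t x = some y := by
  have hn : Partrec fun n : ℕ => g n.unpair.1 n.unpair.2 :=
    hg.comp (computable_left Computable.id) (computable_right Computable.id)
  obtain ⟨c, hc⟩ := Nat.Partrec.Code.exists_code.1 (Partrec.nat_iff.1 hn)
  refine ⟨fun i t x => Nat.Partrec.Code.evaln t c (Nat.pair i x), ?_, fun i x y => ?_⟩
  · have h1 : Computable fun p : ℕ × ℕ × ℕ => p.1 := Computable.fst
    have h2 : Computable fun p : ℕ × ℕ × ℕ => p.2.1 := Computable.fst.comp Computable.snd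
    have h3 : Computable fun p : ℕ × ℕ × ℕ => p.2.2 := Computable.snd.comp Computable.snd
    exact Nat.Partrec.Code.primrec_evaln.to_comp.comp
      ((h2.pair (Computable.const c)).pair (computable_pair h1 h3))
  · have : g i x = Nat.Partrec.Code.eval c (Nat.pair i x) := by simp [hc]
    rw [this]
    exact Nat.Partrec.Code.evaln_complete

variable {e : ℕ → ℕ → ℕ → Option ℕ} {i n s : ℕ}

/-- An approximation defining at most one new value at each stage. -/
def enum (e : ℕ → ℕ → ℕ → Option ℕ) (i n x : ℕ) : Option ℕ :=
  n.rec none fun k r =>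
    bif decide (r = none) && decide (x = k.unpair.1) then e i k.unpair.2 x else r

@[simp] theorem enum_zero : enum e i 0 = fun _ => none := rfl

theorem enum_succ (x : ℕ) : enum e i (n + 1) x =
    if enum e i n x = none ∧ x = n.unpair.1 then e i n.unpair.2 x else enum e i n x := by
  have : enum e i (n + 1) x = bif decide (enum e i n x = none) && decide (x = n.unpair.1)
    then e i n.unpair.2 x else enum e i n x := rfl
  rw [this, ← Bool.decide_and, Bool.cond_decide]

theorem enum_mono : Mono (enum e i) := by
  intro s x y h
  simp [enum_succ, h]

theorem enum_support {x y : ℕ} (h : enum e i n x = some y) : x < n := by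
  induction n with
  | zero => simp at h
  | succ n ih =>
    rw [enum_succ] at h
    split_ifs at h with hx
    · have := Nat.unpair_left_le n
      omega
    · exact (ih h).trans (Nat.lt_succ_self n)

theorem enum_step : enum e i (n + 1) = enum e i n ∨
    ∃ z y, enum e i n z = none ∧ enum e i (n + 1) = Function.update (enum e i n) z (some y) := by
  by_cases hz : enum e i n n.unpair.1 = none
  · rcases hy : e i n.unpair.2 n.unpair.1 with _ | y
    · left
      funext x
      rw [enum_succ]
      split_ifs with hx
      · rw [hx.2, hy, hz]
      · rfl
    · right
      refine ⟨n.unpair.1, y, hz, ?_⟩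
      funext x
      rw [enum_succ, Function.update_apply]
      by_cases hx : x = n.unpair.1
      · simp [hx, hz, hy]
      · simp [hx]
  · left
    funext x
    rw [enum_succ, if_neg]
    rintro ⟨h1, rfl⟩
    exact hz h1

theorem exists_of_enum {x y : ℕ} (h : enum e i n x = some y) : ∃ t, e i t x = some y := by
  induction n with
  | zero => simp at h
  | succ n ih =>
    rw [enum_succ] at h
    split_ifs at h with hx
    · exact ⟨_, h⟩
    · exact ih h

theorem lim_enum {g : ℕ → ℕ →. ℕ} (he : ∀ i x y, y ∈ g i x ↔ ∃ t, e i t x = some y) :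
    lim (enum e i) = g i := by
  funext x
  ext y
  rw [enum_mono.mem_lim]
  constructor
  · rintro ⟨n, hn⟩
    exact (he i x y).2 (exists_of_enum hn)
  · intro hy
    obtain ⟨t, ht⟩ := (he i x y).1 hy
    rcases hn : enum e i (Nat.pair x t) x with _ | z
    · exact ⟨Nat.pair x t + 1, by simp [enum_succ, hn, ht]⟩
    · refine ⟨Nat.pair x t, ?_⟩
      rw [hn, Part.mem_unique ((he i x z).2 (exists_of_enum hn)) hy]

/-- The last stage up to `s` at which the enumerated function has a domain of even size. -/
def evenStage (e : ℕ → ℕ → ℕ → Option ℕ) (i s : ℕ) : ℕ :=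
  s.rec 0 fun t r =>
    bif decide (Nat.count (fun x => (enum e i (t + 1) x).isSome = true) (t + 1) % 2 = 0) then t + 1
    else r

theorem evenStage_succ : evenStage e i (s + 1) =
    if Even (domCard (enum e i (s + 1))) then s + 1 else evenStage e i s := by
  have : evenStage e i (s + 1) = bif decide (Nat.count (fun x => (enum e i (s + 1) x).isSome = true)
    (s + 1) % 2 = 0) then s + 1 else evenStage e i s := rfl
  rw [this, Bool.cond_decide, count_isSome_eq_domCard fun x y h => enum_support h]
  simp only [Nat.even_iff]

theorem evenStage_le : evenStage e i s ≤ s := by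
  induction s with
  | zero => rfl
  | succ s ih =>
    rw [evenStage_succ]
    split_ifs <;> omega

theorem even_domCard_evenStage : Even (domCard (enum e i (evenStage e i s))) := by
  induction s with
  | zero =>
    change Even (domCard (enum e i 0))
    simp [domCard]
  | succ s ih =>
    rw [evenStage_succ]
    split_ifs with h
    · exact h
    · exact ih

theorem evenStage_eq_self (h : Even (domCard (enum e i s))) : evenStage e i s = s := by
  cases s with
  | zero => rfl
  | succ s => rw [evenStage_succ, if_pos h]

theorem evenStage_mono_succ : evenStage e i s ≤ evenStage e i (s + 1) := by
  rw [evenStage_succ]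
  have := evenStage_le (e := e) (i := i) (s := s)
  split_ifs <;> omega

/-- The enumeration of `e i`, delayed to stages at which its domain has even size. -/
def evenPart (e : ℕ → ℕ → ℕ → Option ℕ) (i s x : ℕ) : Option ℕ := enum e i (evenStage e i s) x

theorem evenPart_mono : Mono (evenPart e i) :=
  fun _ _ _ h => enum_mono.le evenStage_mono_succ h

theorem lim_evenPart_or : lim (evenPart e i) = lim (enum e i) ∨
    ∃ N, Odd (domCard (enum e i N)) ∧ lim (enum e i) = toPFun (enum e i N) := by
  by_cases h : ∃ N, ∀ n, N ≤ n → ¬ Even (domCard (enum e i n))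
  · right
    obtain ⟨N, hN⟩ := h
    have hconst : ∀ n, N ≤ n → enum e i n = enum e i N := by
      intro n hn
      induction n, hn using Nat.le_induction with
      | base => rfl
      | succ n hn ih =>
        rcases enum_step (e := e) (i := i) (n := n) with h | ⟨z, y, hz, h⟩
        · rw [h, ih]
        · have hodd := hN (n + 1) (by omega)
          rw [h, domCard_update (fun x y h => enum_support h) hz, Nat.even_add_one, not_not] at hodd
          exact absurd hodd (hN n hn)
    refine ⟨N, Nat.not_even_iff_odd.1 (hN N le_rfl), ?_⟩
    rw [eq_toPFun_iff]
    intro x y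
    rw [enum_mono.mem_lim]
    refine ⟨fun ⟨n, hn⟩ => ?_, fun h => ⟨N, h⟩⟩
    rw [← hconst (max n N) (le_max_right _ _)]
    exact enum_mono.le (le_max_left _ _) hn
  · left
    push Not at h
    funext x
    ext y
    rw [evenPart_mono.mem_lim, enum_mono.mem_lim]
    refine ⟨fun ⟨s, hs⟩ => ⟨_, hs⟩, fun ⟨n, hn⟩ => ?_⟩
    obtain ⟨n', hle, heven⟩ := h n
    refine ⟨n', ?_⟩
    rw [evenPart, evenStage_eq_self heven]
    exact enum_mono.le hle hn

/-- For `d = ⟨⟨i, s⟩, ⟨z, t⟩⟩`, the stage `s` of the enumeration of `e i`, extended at `z` by the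
stage `t` of `e'`. -/
def extend (e e' : ℕ → ℕ → ℕ → Option ℕ) (d x : ℕ) : Option ℕ :=
  bif decide (enum e d.unpair.1.unpair.1 d.unpair.1.unpair.2 x = none) &&
    decide (x = d.unpair.2.unpair.1)
  then e' 0 d.unpair.2.unpair.2 x else enum e d.unpair.1.unpair.1 d.unpair.1.unpair.2 x

variable {e' : ℕ → ℕ → ℕ → Option ℕ} {d : ℕ}

theorem extend_eq (x : ℕ) : extend e e' d x =
    if enum e d.unpair.1.unpair.1 d.unpair.1.unpair.2 x = none ∧ x = d.unpair.2.unpair.1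
    then e' 0 d.unpair.2.unpair.2 x else enum e d.unpair.1.unpair.1 d.unpair.1.unpair.2 x := by
  rw [extend, ← Bool.decide_and, Bool.cond_decide]

theorem extend_support {x y : ℕ} (h : extend e e' d x = some y) : x < d + 1 := by
  rw [extend_eq] at h
  have h1 := Nat.unpair_left_le d
  have h2 := Nat.unpair_right_le d
  have h3 := Nat.unpair_right_le d.unpair.1
  have h4 := Nat.unpair_left_le d.unpair.2
  split_ifs at h with hx
  · omega
  · have := enum_support h
    omega

theorem extend_eq_update {z t y : ℕ} (hz : enum e i s z = none) (hy : e' 0 t z = some y) :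
    extend e e' (Nat.pair (Nat.pair i s) (Nat.pair z t)) =
      Function.update (enum e i s) z (some y) := by
  funext x
  rw [extend_eq, Function.update_apply]
  by_cases hx : x = z
  · simp [hx, hz, hy]
  · simp [hx]

theorem extend_eq_self {z t : ℕ} (hz : enum e i s z ≠ none) :
    extend e e' (Nat.pair (Nat.pair i s) (Nat.pair z t)) = enum e i s := by
  funext x
  rw [extend_eq, if_neg]
  · simp
  · simp only [Nat.unpair_pair]
    rintro ⟨h1, rfl⟩
    exact hz h1

/-- `d` is the least code of an extension whose domain has odd size. -/
def isOddCode (e e' : ℕ → ℕ → ℕ → Option ℕ) (d : ℕ) : Bool :=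
  decide (Nat.count (fun x => (extend e e' d x).isSome = true) (d + 1) % 2 = 1) &&
    ball (fun d' => !ball (fun x => decide (extend e e' d' x = extend e e' d x)) (d + 1)) d

theorem isOddCode_iff : isOddCode e e' d = true ↔
    Odd (domCard (extend e e' d)) ∧ ∀ d' < d, extend e e' d' ≠ extend e e' d := by
  rw [isOddCode, count_isSome_eq_domCard fun x y h => extend_support h]
  simp only [Bool.and_eq_true, decide_eq_true_eq, ball_iff, Bool.not_eq_true',
    ← Bool.not_eq_true, ← Nat.odd_iff]
  refine and_congr_right fun _ => forall₂_congr fun d' hd' => not_congr ⟨fun h => ?_, fun h => ?_⟩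
  · funext x
    by_cases hx : x < d + 1
    · exact h x hx
    · rw [Option.eq_none_iff_forall_ne_some.2 fun y hy => hx (extend_support hy),
        Option.eq_none_iff_forall_ne_some.2 fun y hy =>
          hx ((extend_support hy).trans (Nat.succ_lt_succ hd'))]
  · simp [h]

theorem exists_isOddCode (h : Odd (domCard (extend e e' d))) :
    ∃ d₀, isOddCode e e' d₀ = true ∧ extend e e' d₀ = extend e e' d := by
  classical
  have hex : ∃ d₀, extend e e' d₀ = extend e e' d := ⟨d, rfl⟩
  have hspec := Nat.find_spec hex
  refine ⟨Nat.find hex, isOddCode_iff.2 ⟨by rwa [hspec], fun d' hd' he => ?_⟩, hspec⟩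
  exact Nat.find_min hex hd' (he.trans hspec)

theorem isOddCode_injective {d' : ℕ} (h : isOddCode e e' d = true) (h' : isOddCode e e' d' = true)
    (he : extend e e' d = extend e e' d') : d = d' :=
  le_antisymm (not_lt.1 fun hlt => (isOddCode_iff.1 h).2 _ hlt he.symm)
    (not_lt.1 fun hlt => (isOddCode_iff.1 h').2 _ hlt he)

theorem lim_evenPart_ne (h : Odd (domCard (extend e e' d))) :
    lim (evenPart e i) ≠ toPFun (extend e e' d) := by
  intro he
  have hsub : ∀ s x y, evenPart e i s x = some y → extend e e' d x = some y := by
    intro s x y hy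
    rw [← mem_toPFun, ← he]
    exact evenPart_mono.mem_lim.2 ⟨s, hy⟩
  have hev : ∀ᶠ s in Filter.atTop, ∀ x ∈ Set.Iic d, ∀ y,
      extend e e' d x = some y → evenPart e i s x = some y := by
    rw [(Set.finite_Iic d).eventually_all]
    intro x _
    filter_upwards [evenPart_mono.eventually_eq (a := evenPart e i) x] with s hs y hy
    rwa [← mem_toPFun, ← he, ← hs, Part.mem_ofOption] at hy
  obtain ⟨s, hs⟩ := hev.exists
  have heq : enum e i (evenStage e i s) = extend e e' d := by
    funext x
    ext y
    exact ⟨hsub s x y, fun hy => hs x (Nat.lt_succ_iff.1 (extend_support hy)) y hy⟩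
  rw [← heq] at h
  exact Nat.not_even_iff_odd.2 h even_domCard_evenStage

theorem exists_large_isOddCode {f : ℕ →. ℕ} (hf : f.Dom.Infinite)
    (he' : ∀ x y, y ∈ f x ↔ ∃ t, e' 0 t x = some y) (i s N : ℕ) :
    ∃ d, N < d ∧ isOddCode e e' d = true ∧
      ∀ x y, evenPart e i s x = some y → extend e e' d x = some y := by
  obtain ⟨z, hz, hlt⟩ := hf.exists_gt (N + evenStage e i s)
  obtain ⟨y, hy⟩ := (PFun.mem_dom f z).1 hz
  obtain ⟨t, ht⟩ := (he' z y).1 hy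
  have hnone : enum e i (evenStage e i s) z = none :=
    Option.eq_none_iff_forall_ne_some.2 fun y hy => by
      have := enum_support hy
      omega
  have hupd := extend_eq_update hnone ht
  obtain ⟨d, hd, hdeq⟩ := exists_isOddCode (e := e) (e' := e')
    (d := Nat.pair (Nat.pair i (evenStage e i s)) (Nat.pair z t)) (by
      rw [hupd, domCard_update (fun x y h => enum_support h) hnone]
      exact even_domCard_evenStage.add_one)
  rw [hupd] at hdeq
  refine ⟨d, ?_, hd, fun x w hx => ?_⟩
  · have : z < d + 1 := extend_support (e := e) (e' := e') (y := y) (by simp [hdeq])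
    omega
  · have hxz : x ≠ z := by
      rintro rfl
      rw [evenPart, hnone] at hx
      cases hx
    rw [hdeq, Function.update_of_ne hxz]
    exact hx

section Computability

variable {α : Type*} [Primcodable α]

theorem computable_enum (he : Computable fun p : ℕ × ℕ × ℕ => e p.1 p.2.1 p.2.2) {i n x : α → ℕ}
    (hi : Computable i) (hn : Computable n) (hx : Computable x) :
    Computable fun p => enum e (i p) (n p) (x p) := by
  have hi' : Computable fun p : α × ℕ × Option ℕ => i p.1 := hi.comp Computable.fst
  have hx' : Computable fun p : α × ℕ × Option ℕ => x p.1 := hx.comp Computable.fst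
  have hk : Computable fun p : α × ℕ × Option ℕ => p.2.1 := Computable.fst.comp Computable.snd
  have hr : Computable fun p : α × ℕ × Option ℕ => p.2.2 := Computable.snd.comp Computable.snd
  exact Computable.nat_rec hn (Computable.const none)
    (Computable.cond (computable_and (computable_decide_eq hr (Computable.const none))
      (computable_decide_eq hx' (computable_left hk)))
      (computable_app₃ he hi' (computable_right hk) hx') hr).to₂

theorem computable_mod_two_eq {f : α → ℕ} (hf : Computable f) (b : ℕ) :
    Computable fun p => decide (f p % 2 = b) :=
  computable_decide_eq (Primrec.nat_mod.to_comp.comp hf (Computable.const 2)) (Computable.const b)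

theorem computable_evenStage (he : Computable fun p : ℕ × ℕ × ℕ => e p.1 p.2.1 p.2.2)
    {i s : α → ℕ} (hi : Computable i) (hs : Computable s) :
    Computable fun p => evenStage e (i p) (s p) := by
  have hi' : Computable fun p : α × ℕ × ℕ => i p.1 := hi.comp Computable.fst
  have ht : Computable fun p : α × ℕ × ℕ => p.2.1 + 1 :=
    Computable.succ.comp (Computable.fst.comp Computable.snd)
  have hr : Computable fun p : α × ℕ × ℕ => p.2.2 := Computable.snd.comp Computable.snd
  have hp : Computable fun q : (α × ℕ × ℕ) × ℕ => q.1 := Computable.fst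
  have hi'' : Computable fun q : (α × ℕ × ℕ) × ℕ => i q.1.1 := hi'.comp hp
  have ht' : Computable fun q : (α × ℕ × ℕ) × ℕ => q.1.2.1 + 1 := ht.comp hp
  have hx : Computable fun q : (α × ℕ × ℕ) × ℕ => q.2 := Computable.snd
  have hsome : Computable fun q : (α × ℕ × ℕ) × ℕ =>
      (enum e (i q.1.1) (q.1.2.1 + 1) q.2).isSome :=
    Primrec.option_isSome.to_comp.comp (computable_enum he hi'' ht' hx)
  have hcount : Computable fun p : α × ℕ × ℕ =>
      Nat.count (fun x => (enum e (i p.1) (p.2.1 + 1) x).isSome = true) (p.2.1 + 1) :=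
    computable_count
      (p := fun (p : α × ℕ × ℕ) x => (enum e (i p.1) (p.2.1 + 1) x).isSome) hsome ht
  exact Computable.nat_rec hs (Computable.const 0)
    (Computable.cond (computable_mod_two_eq hcount 0) ht hr).to₂

theorem computable_evenPart (he : Computable fun p : ℕ × ℕ × ℕ => e p.1 p.2.1 p.2.2) :
    Computable fun p : ℕ × ℕ × ℕ => evenPart e p.1 p.2.1 p.2.2 := by
  have hi : Computable fun p : ℕ × ℕ × ℕ => p.1 := Computable.fst
  have hs : Computable fun p : ℕ × ℕ × ℕ => p.2.1 := Computable.fst.comp Computable.snd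
  have hx : Computable fun p : ℕ × ℕ × ℕ => p.2.2 := Computable.snd.comp Computable.snd
  exact computable_enum he hi (computable_evenStage he hi hs) hx

theorem computable_extend (he : Computable fun p : ℕ × ℕ × ℕ => e p.1 p.2.1 p.2.2)
    (he' : Computable fun p : ℕ × ℕ × ℕ => e' p.1 p.2.1 p.2.2) {d x : α → ℕ}
    (hd : Computable d) (hx : Computable x) : Computable fun p => extend e e' (d p) (x p) := by
  have h1 := computable_left hd
  have h2 := computable_right hd
  have henum := computable_enum he (computable_left h1) (computable_right h1) hx
  exact Computable.cond (computable_and (computable_decide_eq henum (Computable.const none))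
    (computable_decide_eq hx (computable_left h2)))
    (computable_app₃ he' (Computable.const 0) (computable_right h2) hx) henum

theorem computable_isOddCode (he : Computable fun p : ℕ × ℕ × ℕ => e p.1 p.2.1 p.2.2)
    (he' : Computable fun p : ℕ × ℕ × ℕ => e' p.1 p.2.1 p.2.2) :
    Computable (isOddCode e e') := by
  have hsome : Computable fun q : ℕ × ℕ => (extend e e' q.1 q.2).isSome :=
    Primrec.option_isSome.to_comp.comp (computable_extend he he' Computable.fst Computable.snd)
  have hcount : Computable fun d : ℕ =>
      Nat.count (fun x => (extend e e' d x).isSome = true) (d + 1) :=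
    computable_count (α := ℕ) (p := fun d x => (extend e e' d x).isSome) hsome Computable.succ
  have hd : Computable fun q : (ℕ × ℕ) × ℕ => q.1.1 := Computable.fst.comp Computable.fst
  have hd' : Computable fun q : (ℕ × ℕ) × ℕ => q.1.2 := Computable.snd.comp Computable.fst
  have hx : Computable fun q : (ℕ × ℕ) × ℕ => q.2 := Computable.snd
  have hball : Computable fun q : ℕ × ℕ =>
      ball (fun x => decide (extend e e' q.2 x = extend e e' q.1 x)) (q.1 + 1) :=
    computable_ball (p := fun (q : ℕ × ℕ) x => decide (extend e e' q.2 x = extend e e' q.1 x))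
      (computable_decide_eq (computable_extend he he' hd' hx) (computable_extend he he' hd hx))
      (Computable.succ.comp Computable.fst)
  exact computable_and (computable_mod_two_eq hcount 1)
    (computable_ball (α := ℕ) (p := fun d d' =>
      !ball (fun x => decide (extend e e' d' x = extend e e' d x)) (d + 1))
      (computable_not hball) Computable.id)

end Computability

end Enumeration

end FriedbergNumbering

open FriedbergNumbering in
/-- Pour-El–Putnam. -/
theorem pour_el_putnam (A : Set (ℕ →. ℕ)) (hA : A ⊆ PCF)
    (hAnum : ∃ ν : ℕ → ℕ →. ℕ, IsCompNumbering A ν)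
    (f : ℕ →. ℕ) (hf : f ∈ PCF) (hfdom : f.Dom.Infinite) :
    ∃ B : Set (ℕ →. ℕ), B ⊆ PCF ∧ A ⊆ B ∧
      (∀ g ∈ B \ A, g.Dom.Finite) ∧
      (∀ g ∈ B \ A, ∃ h ∈ A, ∀ x y, y ∈ g x → y ∈ f x ∨ y ∈ h x) ∧
      ∃ ν : ℕ → ℕ →. ℕ, IsFriedberg B ν := by
  obtain ⟨ν, ⟨hνA, hνsurj⟩, hν⟩ := hAnum
  obtain ⟨e, he, hemem⟩ := exists_stages hν
  obtain ⟨e', he', hfmem⟩ := exists_stages (g := fun _ => f)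
    ((Partrec.nat_iff.2 hf).comp Computable.snd)
  have hlim : ∀ i, lim (enum e i) = ν i := fun i => lim_enum hemem
  obtain ⟨μ, hμ, hμinj, hμrange⟩ := exists_injective_numbering (computable_evenPart he)
    (computable_extend he he' Computable.fst Computable.snd) (computable_isOddCode he he')
    (fun i => evenPart_mono) (fun i s x y h => (enum_support h).trans_le evenStage_le)
    (fun d d' => isOddCode_injective) (fun i d hd => lim_evenPart_ne (isOddCode_iff.1 hd).1)
    (exists_large_isOddCode hfdom (hfmem 0))
  have henum : ∀ {i n x y}, enum e i n x = some y → y ∈ ν i x := fun {i n x y} h => by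
    rw [← hlim]
    exact enum_mono.mem_lim.2 ⟨n, h⟩
  have heven : ∀ {i x y}, y ∈ lim (evenPart e i) x → y ∈ ν i x := fun h =>
    henum (evenPart_mono.mem_lim.1 h).choose_spec
  refine ⟨Set.range μ, ?_, ?_, ?_, ?_, μ, ⟨⟨fun i => ⟨i, rfl⟩, fun g hg => hg⟩, hμ⟩, hμinj⟩
  · rintro _ ⟨n, rfl⟩
    exact Partrec.nat_iff.1 (hμ.comp (Computable.const n) Computable.id)
  · intro g hg
    obtain ⟨i, rfl⟩ := hνsurj g hg
    refine (hμrange _).2 ?_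
    rcases lim_evenPart_or (e := e) (i := i) with h | ⟨N, hodd, h⟩
    · exact .inl ⟨i, by rw [h, hlim]⟩
    · have hne : domCard (enum e i N) ≠ 0 := fun h0 => by simp [h0] at hodd
      obtain ⟨z, hz⟩ := Set.nonempty_of_ncard_ne_zero hne
      have hself := extend_eq_self (e' := e') (t := 0) hz
      obtain ⟨d, hd, hdeq⟩ := exists_isOddCode (hself.symm ▸ hodd)
      exact .inr ⟨d, hd, by rw [hdeq, hself, ← h, hlim]⟩
  · rintro g ⟨hg, hgA⟩
    rcases (hμrange g).1 hg with ⟨i, rfl⟩ | ⟨d, -, rfl⟩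
    · rcases lim_evenPart_or (e := e) (i := i) with h | ⟨N, -, h⟩
      · rw [h, hlim] at hgA
        exact absurd (hνA i) hgA
      · refine (Set.finite_Iio N).subset fun x hx => ?_
        obtain ⟨y, hy⟩ := (PFun.mem_dom _ x).1 hx
        have := heven hy
        rw [← hlim, h, mem_toPFun] at this
        exact enum_support this
    · refine (Set.finite_Iio (d + 1)).subset fun x hx => ?_
      obtain ⟨y, hy⟩ := (PFun.mem_dom _ x).1 hx
      exact extend_support (mem_toPFun.1 hy)
  · rintro g ⟨hg, -⟩
    rcases (hμrange g).1 hg with ⟨i, rfl⟩ | ⟨d, -, rfl⟩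
    · exact ⟨ν i, hνA i, fun x y hy => .inr (heven hy)⟩
    · refine ⟨_, hνA d.unpair.1.unpair.1, fun x y hy => ?_⟩
      rw [mem_toPFun, extend_eq] at hy
      split_ifs at hy
      · exact .inl ((hfmem 0 x y).2 ⟨_, hy⟩)
      · exact .inr (henum hy)
end
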